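/- Let β > 1 and 0 < λ < 1 with λβ > 1. Let f_β(x) = βx mod 1 be the β-expansion map on [0,1], and define the β-Takagi function H_{β,λ} : [0,1] → ℝ by H_{β,λ}(x) = Σ_{n=0}^∞ λ^n · dist(f_β^n(x), ℤ), where dist(x, ℤ) = min_{k∈ℤ} |x − k|. Then the Hausdorff dimension of the graph of H_{β,λ} equals 2 + log λ / log β. -/

import Mathlib

open Set Filter MeasureTheory

noncomputable section

/-- The distance from a real number to the set of integers. -/
def distInt (t : ℝ) : ℝ := |t - (round t : ℤ)|

/-- The β-expansion map `x ↦ βx mod 1`. -/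
def betaMap (b : ℝ) (x : ℝ) : ℝ := Int.fract (b * x)

/-- The β-Takagi function `H_{β,λ}(x) = Σ_{n≥0} λ^n dist(f_β^n(x), ℤ)`. -/
def betaTakagi (b lam : ℝ) (x : ℝ) : ℝ := ∑' n : ℕ, lam ^ n * distInt ((betaMap b)^[n] x)

/-- One half of the Fejér kernel, as a cosine integral. -/
def fejer (x : ℝ) : ℝ := ∫ ξ in (0:ℝ)..1, (1 - ξ) * Real.cos (ξ * x)

theorem fejer_eq {x : ℝ} (hx : x ≠ 0) : fejer x = (1 - Real.cos x) / x ^ 2 := by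
  have h : ∀ ξ ∈ uIcc (0:ℝ) 1, HasDerivAt
      (fun ξ : ℝ => (1 - ξ) * (Real.sin (ξ * x) / x) - Real.cos (ξ * x) / x ^ 2)
      ((1 - ξ) * Real.cos (ξ * x)) ξ := by
    intro ξ _
    have h1 : HasDerivAt (fun ξ : ℝ => ξ * x) x ξ := by
      simpa using (hasDerivAt_id ξ).mul_const x
    have h2 := (((hasDerivAt_id ξ).const_sub 1).mul (h1.sin.div_const x)).sub
      (h1.cos.div_const (x ^ 2))
    refine h2.congr_deriv ?_
    simp only [id]
    field_simp
    ring
  rw [fejer, intervalIntegral.integral_eq_sub_of_hasDerivAt h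
    (Continuous.intervalIntegrable (by fun_prop) _ _)]
  simp
  ring

theorem fejer_le_one (x : ℝ) : fejer x ≤ 1 := by
  have : fejer x ≤ ∫ ξ in (0:ℝ)..1, (1:ℝ) := by
    apply intervalIntegral.integral_mono_on (by norm_num)
      (Continuous.intervalIntegrable (by fun_prop) _ _)
      (Continuous.intervalIntegrable (by fun_prop) _ _)
    intro ξ hξ
    have := Real.cos_le_one (ξ * x)
    nlinarith [hξ.1, hξ.2]
  simpa using this

theorem fejer_nonneg (x : ℝ) : 0 ≤ fejer x := by
  by_cases hx : x = 0
  · subst hx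
    refine intervalIntegral.integral_nonneg (by norm_num) fun ξ hξ => ?_
    simpa using hξ.2
  · rw [fejer_eq hx]
    have := Real.cos_le_one x
    exact div_nonneg (by linarith) (by positivity)

theorem fejer_le (x : ℝ) : fejer x ≤ 4 / (1 + x ^ 2) := by
  rw [le_div_iff₀ (by positivity)]
  by_cases hx : |x| ≤ 1
  · have h1 : x ^ 2 ≤ 1 := by
      rw [← sq_abs]; nlinarith [abs_nonneg x]
    nlinarith [fejer_le_one x, fejer_nonneg x, sq_nonneg x]
  · push Not at hx
    have hx0 : x ≠ 0 := by rintro rfl; simp at hx; linarith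
    have h1 : 1 < x ^ 2 := by rw [← sq_abs]; nlinarith
    have h2 : fejer x * x ^ 2 = 1 - Real.cos x := by
      rw [fejer_eq hx0]; field_simp
    nlinarith [fejer_nonneg x, Real.neg_one_le_cos x]

theorem fejer_ge {x : ℝ} (hx : |x| ≤ 1) : 1 / 4 ≤ fejer x := by
  have h : ∫ ξ in (0:ℝ)..1, (1 - ξ) * (1/2) ≤ fejer x := by
    apply intervalIntegral.integral_mono_on (by norm_num)
      (Continuous.intervalIntegrable (by fun_prop) _ _)
      (Continuous.intervalIntegrable (by fun_prop) _ _)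
    intro ξ hξ
    have h1 : 1 - (ξ * x) ^ 2 / 2 ≤ Real.cos (ξ * x) := Real.one_sub_sq_div_two_le_cos
    have h2 : (ξ * x) ^ 2 ≤ 1 := by
      rw [mul_pow, ← sq_abs x]
      have := hξ.1; have := hξ.2
      have : ξ ^ 2 ≤ 1 := by nlinarith
      have : |x| ^ 2 ≤ 1 := by nlinarith [abs_nonneg x]
      nlinarith [sq_nonneg ξ, sq_nonneg |x|]
    exact mul_le_mul_of_nonneg_left (by linarith) (by linarith [hξ.2])
  have h2 : ∫ ξ in (0:ℝ)..1, (1 - ξ) * (1/2 : ℝ) = 1/4 := by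
    rw [intervalIntegral.integral_mul_const, intervalIntegral.integral_sub
      (Continuous.intervalIntegrable (by fun_prop) _ _)
      (Continuous.intervalIntegrable (by fun_prop) _ _)]
    simp
    norm_num
  linarith

/-- The exponential sum with frequencies `x a`, `a ∈ s`. -/
def expSum {ι : Type*} (s : Finset ι) (x : ι → ℝ) (ξ : ℝ) : ℂ :=
  ∑ a ∈ s, Complex.exp ((ξ * x a : ℝ) * Complex.I)

theorem continuous_expSum {ι : Type*} (s : Finset ι) (x : ι → ℝ) :
    Continuous (expSum s x) := by
  unfold expSum
  fun_prop

theorem norm_expSum_le {ι : Type*} (s : Finset ι) (x : ι → ℝ) (ξ : ℝ) :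
    ‖expSum s x ξ‖ ≤ s.card := by
  refine (norm_sum_le _ _).trans ?_
  simp only [Complex.norm_exp_ofReal_mul_I, Finset.sum_const, nsmul_eq_mul, mul_one, le_refl]

theorem norm_expSum_sq {ι : Type*} (s : Finset ι) (x : ι → ℝ) (ξ : ℝ) :
    ‖expSum s x ξ‖ ^ 2 = ∑ a ∈ s, ∑ b ∈ s, Real.cos (ξ * (x a - x b)) := by
  have h1 : ‖expSum s x ξ‖ ^ 2
      = (∑ a ∈ s, Real.cos (ξ * x a)) ^ 2 + (∑ a ∈ s, Real.sin (ξ * x a)) ^ 2 := by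
    rw [Complex.sq_norm, Complex.normSq_apply]
    simp only [expSum, Complex.re_sum, Complex.im_sum, Complex.exp_ofReal_mul_I_re,
      Complex.exp_ofReal_mul_I_im]
    ring
  rw [h1, sq, sq, Finset.sum_mul_sum, Finset.sum_mul_sum, ← Finset.sum_add_distrib]
  refine Finset.sum_congr rfl fun a _ => ?_
  rw [← Finset.sum_add_distrib]
  refine Finset.sum_congr rfl fun b _ => ?_
  rw [mul_sub, Real.cos_sub]

theorem integral_fejer_expSum {ι : Type*} (s : Finset ι) (x : ι → ℝ) (R : ℝ) :
    ∫ ξ in (0:ℝ)..1, (1 - ξ) * ‖expSum s x (R * ξ)‖ ^ 2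
      = ∑ a ∈ s, ∑ b ∈ s, fejer (R * (x a - x b)) := by
  simp only [norm_expSum_sq, Finset.mul_sum, fejer]
  rw [intervalIntegral.integral_finsetSum
    (fun _ _ => Continuous.intervalIntegrable (by fun_prop) _ _)]
  refine Finset.sum_congr rfl fun a _ => ?_
  rw [intervalIntegral.integral_finsetSum
    (fun _ _ => Continuous.intervalIntegrable (by fun_prop) _ _)]
  refine Finset.sum_congr rfl fun b _ => ?_
  refine intervalIntegral.integral_congr fun ξ _ => ?_
  ring_nf

/-- An absolute constant for the large sieve type bound. -/
def sieveConst : ℝ := ∑' i : ℤ, 4 / (1 + (i : ℝ) ^ 2)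

theorem summable_sieve : Summable fun i : ℤ => 4 / (1 + (i : ℝ) ^ 2) := by
  have h : Summable fun i : ℤ => 4 * (1 / |(i : ℝ)| ^ (2:ℝ)) :=
    (Real.summable_one_div_int_add_rpow 0 2 |>.2 (by norm_num)).mul_left 4 |>.congr (by simp)
  refine Summable.of_norm_bounded_eventually (g := fun i : ℤ => 4 * (1 / |(i : ℝ)| ^ (2:ℝ))) h ?_
  filter_upwards [(Set.finite_singleton (0:ℤ)).compl_mem_cofinite] with i hi
  have hi : (i:ℝ) ≠ 0 := by exact_mod_cast hi
  have : |(i : ℝ)| ^ (2:ℝ) = (i:ℝ)^2 := by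
    rw [show (2:ℝ) = ((2:ℕ):ℝ) by norm_num, Real.rpow_natCast, sq_abs]
  rw [this, Real.norm_eq_abs, abs_of_nonneg (by positivity), mul_one_div]
  gcongr
  linarith

theorem sieveConst_nonneg : 0 ≤ sieveConst := tsum_nonneg fun _ => by positivity

/-- If every window of radius `τ` contains at most `B` of the points then the kernel sums are
bounded by a multiple of `B`. -/
theorem sum_fejer_le {ι : Type*} (s : Finset ι) (x : ι → ℝ) {R τ B : ℝ} (hτ : 0 < τ)
    (hR : 1 ≤ R * τ) (hB : ∀ t, ((s.filter fun a => |x a - t| ≤ τ).card : ℝ) ≤ B) (y : ℝ) :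
    ∑ b ∈ s, fejer (2 * R * (y - x b)) ≤ sieveConst * B := by
  classical
  have hB0 : 0 ≤ B := le_trans (by positivity) (hB 0)
  let j : ι → ℤ := fun b => round ((x b - y) / τ)
  have h1 : ∀ b ∈ s, fejer (2 * R * (y - x b)) ≤ 4 / (1 + (j b : ℝ) ^ 2) := by
    intro b _
    refine (fejer_le _).trans ?_
    have h := abs_sub_round ((x b - y) / τ)
    have hR0 : 0 < R := by
      by_contra hh
      nlinarith
    have h2 : (j b : ℝ) ^ 2 ≤ (2 * R * (y - x b)) ^ 2 := by
      rw [sq_le_sq]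
      by_cases hj : j b = 0
      · rw [hj, Int.cast_zero, abs_zero]; exact abs_nonneg _
      · have h3 : (1:ℝ) ≤ |(j b : ℝ)| := by exact_mod_cast Int.one_le_abs hj
        have h4 : |(j b : ℝ)| ≤ |(x b - y) / τ| + 1 / 2 := by
          have := abs_sub_abs_le_abs_sub (j b : ℝ) ((x b - y) / τ)
          rw [abs_sub_comm] at this
          linarith
        have h5 : |2 * R * (y - x b)| = 2 * (R * τ) * |(x b - y) / τ| := by
          rw [abs_div, abs_of_pos hτ, abs_mul, abs_of_pos (by positivity : 0 < 2 * R),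
            abs_sub_comm]
          field_simp
        rw [h5]
        nlinarith [abs_nonneg ((x b - y) / τ)]
    gcongr
  refine (Finset.sum_le_sum h1).trans ?_
  have h6 : ∑ b ∈ s, 4 / (1 + (j b : ℝ) ^ 2)
      = ∑ i ∈ s.image j, ((s.filter fun b => j b = i).card : ℝ) * (4 / (1 + (i : ℝ) ^ 2)) := by
    rw [← Finset.sum_fiberwise_of_maps_to (g := j) (t := s.image j)
      (fun a ha => Finset.mem_image_of_mem j ha)]
    refine Finset.sum_congr rfl fun i _ => ?_
    rw [Finset.sum_congr rfl (g := fun _ => 4 / (1 + (i : ℝ) ^ 2)), Finset.sum_const, nsmul_eq_mul]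
    intro b hb
    rw [(Finset.mem_filter.1 hb).2]
  rw [h6]
  have h7 : ∀ i : ℤ, ((s.filter fun b => j b = i).card : ℝ) ≤ B := by
    intro i
    refine le_trans ?_ (hB (y + i * τ))
    gcongr with b hb
    rintro rfl
    have h := abs_sub_round ((x b - y) / τ)
    have e : x b - (y + (j b : ℝ) * τ) = τ * ((x b - y) / τ - round ((x b - y) / τ)) := by
      field_simp
      simp only [j]
      ring
    rw [e, abs_mul, abs_of_pos hτ]
    nlinarith
  calc _ ≤ ∑ i ∈ s.image j, B * (4 / (1 + (i : ℝ) ^ 2)) := by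
        gcongr with i hi; exact h7 i
    _ = (∑ i ∈ s.image j, (4 / (1 + (i : ℝ) ^ 2))) * B := by
        rw [← Finset.mul_sum, mul_comm]
    _ ≤ _ := by
        gcongr
        exact summable_sieve.sum_le_tsum _ (fun _ _ => by positivity)

/-- A large sieve type inequality. -/
theorem integral_expSum_le {ι : Type*} (s : Finset ι) (x : ι → ℝ) {R κ τ B : ℝ} (hτ : 0 < τ)
    (hκ : 0 < κ)
    (hR : 1 ≤ κ * R * τ) (hB : ∀ t, ((s.filter fun a => |x a - t| ≤ τ).card : ℝ) ≤ B) :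
    ∫ ξ in (0:ℝ)..κ, ‖expSum s x (R * ξ)‖ ^ 2 ≤ 4 * sieveConst * κ * (s.card * B) := by
  have hc := continuous_expSum s x
  have h1 : ∫ ξ in (0:ℝ)..κ, ‖expSum s x (R * ξ)‖ ^ 2
      = κ * ∫ ξ in (0:ℝ)..1, ‖expSum s x (R * (κ * ξ))‖ ^ 2 := by
    have := intervalIntegral.mul_integral_comp_mul_left (a := 0) (b := 1)
      (f := fun ξ => ‖expSum s x (R * ξ)‖ ^ 2) κ
    simp only [mul_zero, mul_one] at this
    rw [this]
  have h2 : ∫ ξ in (0:ℝ)..1, ‖expSum s x (R * (κ * ξ))‖ ^ 2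
      = 2 * ∫ ξ in (0:ℝ)..(1/2), ‖expSum s x (2 * κ * R * ξ)‖ ^ 2 := by
    have := intervalIntegral.mul_integral_comp_mul_left (a := 0) (b := 1/2)
      (f := fun ξ => ‖expSum s x (R * (κ * ξ))‖ ^ 2) 2
    rw [show (2:ℝ) * (1/2) = 1 by norm_num, mul_zero] at this
    rw [← this]
    congr 2
    ext ξ
    ring_nf
  have h3 : ∫ ξ in (0:ℝ)..(1/2), ‖expSum s x (2 * κ * R * ξ)‖ ^ 2
      ≤ ∫ ξ in (0:ℝ)..(1/2), 2 * ((1 - ξ) * ‖expSum s x (2 * κ * R * ξ)‖ ^ 2) := by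
    apply intervalIntegral.integral_mono_on (by norm_num)
      (Continuous.intervalIntegrable (by fun_prop) _ _)
      (Continuous.intervalIntegrable (by fun_prop) _ _)
    intro ξ hξ
    nlinarith [hξ.2, sq_nonneg ‖expSum s x (2 * κ * R * ξ)‖]
  have h4 : ∫ ξ in (0:ℝ)..(1/2), 2 * ((1 - ξ) * ‖expSum s x (2 * κ * R * ξ)‖ ^ 2)
      ≤ ∫ ξ in (0:ℝ)..1, 2 * ((1 - ξ) * ‖expSum s x (2 * κ * R * ξ)‖ ^ 2) := by
    apply intervalIntegral.integral_mono_interval le_rfl (by norm_num) (by norm_num)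
    · refine (ae_restrict_iff' measurableSet_Ioc).2 (Eventually.of_forall fun ξ hξ => ?_)
      have := hξ.2
      exact mul_nonneg (by norm_num) (mul_nonneg (by linarith) (by positivity))
    · exact Continuous.intervalIntegrable (by fun_prop) _ _
  rw [intervalIntegral.integral_const_mul 2 (fun ξ => (1 - ξ) * ‖expSum s x (2 * κ * R * ξ)‖ ^ 2)
    (a := 0) (b := 1), integral_fejer_expSum] at h4
  have h5 : ∑ a ∈ s, ∑ b ∈ s, fejer (2 * κ * R * (x a - x b)) ≤ s.card * (sieveConst * B) := by
    rw [← nsmul_eq_mul]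
    refine Finset.sum_le_card_nsmul _ _ _ fun a _ => ?_
    have := sum_fejer_le s x (R := κ * R) hτ hR hB (x a)
    simpa only [mul_assoc] using this
  rw [h1, h2]
  nlinarith [h3, h4, h5]

theorem norm_expSum_neg {ι : Type*} (s : Finset ι) (x : ι → ℝ) (ξ : ℝ) :
    ‖expSum s x (-ξ)‖ = ‖expSum s x ξ‖ := by
  rw [← sq_eq_sq₀ (norm_nonneg _) (norm_nonneg _), norm_expSum_sq, norm_expSum_sq]
  simp [Real.cos_neg]

/-- Schur's test for averages of sums of characters. -/
theorem sum_norm_sq_le {ι κ : Type*} (S : Finset ι) (s : Finset κ) (θ : ι → ℝ) (x : κ → ℝ)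
    (z : κ → ℂ) {ζ B : ℝ}
    (hB : ∀ w ∈ s, ∑ v ∈ s, ‖expSum S θ (ζ * (x w - x v))‖ ≤ B) :
    ∑ a ∈ S, ‖∑ w ∈ s, z w * Complex.exp ((ζ * (θ a * x w) : ℝ) * Complex.I)‖ ^ 2
      ≤ B * ∑ w ∈ s, ‖z w‖ ^ 2 := by
  have h1 : ((∑ a ∈ S, ‖∑ w ∈ s, z w * Complex.exp ((ζ * (θ a * x w) : ℝ) * Complex.I)‖ ^ 2 : ℝ)
      : ℂ) = ∑ w ∈ s, ∑ v ∈ s, z w * starRingEnd ℂ (z v) * expSum S θ (ζ * (x w - x v)) := by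
    push_cast
    have : ∀ a ∈ S, ((‖∑ w ∈ s, z w * Complex.exp ((ζ * (θ a * x w) : ℝ) * Complex.I)‖ : ℂ)) ^ 2
        = ∑ w ∈ s, ∑ v ∈ s, z w * starRingEnd ℂ (z v) *
          Complex.exp ((ζ * (x w - x v) * θ a : ℝ) * Complex.I) := by
      intro a _
      rw [← Complex.mul_conj', map_sum, Finset.sum_mul_sum]
      refine Finset.sum_congr rfl fun w _ => Finset.sum_congr rfl fun v _ => ?_
      rw [map_mul, ← Complex.exp_conj, map_mul, Complex.conj_I, Complex.conj_ofReal,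
        mul_mul_mul_comm, ← Complex.exp_add]
      congr 2
      push_cast
      ring
    push_cast at this
    rw [Finset.sum_congr rfl this, Finset.sum_comm]
    refine Finset.sum_congr rfl fun w _ => ?_
    rw [Finset.sum_comm]
    refine Finset.sum_congr rfl fun v _ => ?_
    rw [expSum, Finset.mul_sum]
    push_cast
    rfl
  have h2 : ∑ a ∈ S, ‖∑ w ∈ s, z w * Complex.exp ((ζ * (θ a * x w) : ℝ) * Complex.I)‖ ^ 2
      ≤ ∑ w ∈ s, ∑ v ∈ s, (‖z w‖ ^ 2 + ‖z v‖ ^ 2) / 2 * ‖expSum S θ (ζ * (x w - x v))‖ := by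
    refine (le_abs_self _).trans ?_
    rw [← Real.norm_eq_abs, ← Complex.norm_real, h1]
    refine (norm_sum_le _ _).trans (Finset.sum_le_sum fun w _ => ?_)
    refine (norm_sum_le _ _).trans (Finset.sum_le_sum fun v _ => ?_)
    rw [norm_mul, norm_mul, RCLike.norm_conj]
    gcongr
    nlinarith [sq_nonneg (‖z w‖ - ‖z v‖)]
  refine h2.trans ?_
  have h3 : ∑ w ∈ s, ∑ v ∈ s, ‖z w‖ ^ 2 * ‖expSum S θ (ζ * (x w - x v))‖
      ≤ B * ∑ w ∈ s, ‖z w‖ ^ 2 := by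
    rw [Finset.mul_sum]
    refine Finset.sum_le_sum fun w hw => ?_
    rw [← Finset.mul_sum, mul_comm]
    exact mul_le_mul_of_nonneg_right (hB w hw) (by positivity)
  have h4 : ∑ w ∈ s, ∑ v ∈ s, ‖z v‖ ^ 2 * ‖expSum S θ (ζ * (x w - x v))‖
      ≤ B * ∑ w ∈ s, ‖z w‖ ^ 2 := by
    rw [Finset.sum_comm]
    refine le_trans (le_of_eq ?_) h3
    refine Finset.sum_congr rfl fun w _ => Finset.sum_congr rfl fun v _ => ?_
    rw [← norm_expSum_neg]
    ring_nf
  have h5 : ∑ w ∈ s, ∑ v ∈ s, (‖z w‖ ^ 2 + ‖z v‖ ^ 2) / 2 * ‖expSum S θ (ζ * (x w - x v))‖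
      = (∑ w ∈ s, ∑ v ∈ s, ‖z w‖ ^ 2 * ‖expSum S θ (ζ * (x w - x v))‖
        + ∑ w ∈ s, ∑ v ∈ s, ‖z v‖ ^ 2 * ‖expSum S θ (ζ * (x w - x v))‖) / 2 := by
    rw [← Finset.sum_add_distrib, Finset.sum_div]
    refine Finset.sum_congr rfl fun w _ => ?_
    rw [← Finset.sum_add_distrib, Finset.sum_div]
    refine Finset.sum_congr rfl fun v _ => ?_
    ring
  linarith

/-- The averaged correlation estimate behind the flattening of the projected measures. -/
theorem sum_sum_fejer_le {ι κ ν : Type*} (S : Finset ι) (s : Finset κ) (T : κ → Finset ν)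
    (θ : ι → ℝ) (c x : κ → ℝ) (Y : κ → ν → ℝ) {R k τ₁ τ₂ B₁ B₂ B₃ P : ℝ}
    (hτ₁ : 0 < τ₁) (hτ₂ : 0 < τ₂) (hk : 0 < k) (hk1 : k ≤ 1)
    (hR₁ : 1 ≤ R * τ₁) (hR₂ : 1 ≤ k * R * τ₂)
    (hB₁ : (s.card : ℝ) ≤ B₁) (hB₃0 : 0 ≤ B₃)
    (hB₂ : ∀ w ∈ s, ∀ y, (((T w).filter fun t => |Y w t - y| ≤ τ₁).card : ℝ) ≤ B₂)
    (hB₃ : ∀ w ∈ s, ∀ y, (((T w).filter fun t => |Y w t - y| ≤ τ₂).card : ℝ) ≤ B₃)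
    (hP0 : 0 ≤ P)
    (hP : ∀ ζ, k * R ≤ ζ → ζ ≤ R → ∀ w ∈ s,
      ∑ v ∈ s, ‖expSum S θ (ζ * (x w - x v))‖ ≤ S.card * P) :
    ∑ a ∈ S, ∑ p ∈ s.sigma T, ∑ q ∈ s.sigma T,
      fejer (R * ((c p.1 + θ a * x p.1 + Y p.1 p.2) - (c q.1 + θ a * x q.1 + Y q.1 q.2)))
      ≤ S.card * (4 * sieveConst * (s.sigma T).card * (k * B₁ * B₃ + P * B₂)) := by
  classical
  set V : ι → (Σ _ : κ, ν) → ℝ := fun a p => c p.1 + θ a * x p.1 + Y p.1 p.2 with hV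
  have hR0 : 0 < R := by
    by_contra hh
    nlinarith
  have hcont : ∀ a, Continuous fun ξ : ℝ => ‖expSum (s.sigma T) (V a) (R * ξ)‖ ^ 2 := fun a => by
    have := continuous_expSum (s.sigma T) (V a)
    fun_prop
  have hlow : ∀ a ∈ S, ∫ ξ in (0:ℝ)..k, ‖expSum (s.sigma T) (V a) (R * ξ)‖ ^ 2
      ≤ 4 * sieveConst * (s.sigma T).card * (k * B₁ * B₃) := by
    intro a _
    have := integral_expSum_le (s.sigma T) (V a) (B := B₁ * B₃) hτ₂ hk hR₂ ?_
    · refine this.trans (le_of_eq (by ring))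
    intro y
    have h1 : ((s.sigma T).filter fun p => |V a p - y| ≤ τ₂)
        = s.sigma fun w => (T w).filter fun t => |Y w t - (y - c w - θ a * x w)| ≤ τ₂ := by
      ext p
      simp only [Finset.mem_filter, Finset.mem_sigma, hV, and_assoc]
      refine and_congr_right fun _ => and_congr_right fun _ => ?_
      ring_nf
    rw [h1, Finset.card_sigma, Nat.cast_sum]
    calc _ ≤ ∑ w ∈ s, B₃ := Finset.sum_le_sum fun w hw => hB₃ w hw _
      _ = s.card * B₃ := by simp
      _ ≤ _ := by gcongr
  have hpt : ∀ ξ ∈ Icc k 1, ∑ a ∈ S, ‖expSum (s.sigma T) (V a) (R * ξ)‖ ^ 2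
      ≤ S.card * P * ∑ w ∈ s, ‖expSum (T w) (Y w) (R * ξ)‖ ^ 2 := by
    intro ξ hξ
    have h := sum_norm_sq_le S s θ x
      (fun w => Complex.exp ((R * ξ * c w : ℝ) * Complex.I) * expSum (T w) (Y w) (R * ξ))
      (ζ := R * ξ) (B := S.card * P)
      (hP (R * ξ) (by nlinarith [hξ.1]) (by nlinarith [hξ.2]))
    simp only [norm_mul, Complex.norm_exp_ofReal_mul_I, one_mul] at h
    refine le_trans (le_of_eq ?_) h
    refine Finset.sum_congr rfl fun a _ => ?_
    congr 2
    rw [expSum, Finset.sum_sigma]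
    refine Finset.sum_congr rfl fun w _ => ?_
    rw [expSum, Finset.mul_sum, Finset.sum_mul]
    refine Finset.sum_congr rfl fun t _ => ?_
    rw [← Complex.exp_add, ← Complex.exp_add]
    congr 1
    simp only [hV]
    push_cast
    ring
  have hcontY : ∀ w, Continuous fun ξ : ℝ => ‖expSum (T w) (Y w) (R * ξ)‖ ^ 2 := fun w => by
    have := continuous_expSum (T w) (Y w)
    fun_prop
  have hhigh : ∑ a ∈ S, ∫ ξ in k..1, ‖expSum (s.sigma T) (V a) (R * ξ)‖ ^ 2
      ≤ S.card * (4 * sieveConst * (s.sigma T).card * (P * B₂)) := by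
    rw [← intervalIntegral.integral_finsetSum
      (fun a _ => (hcont a).intervalIntegrable _ _)]
    have h1 : ∫ ξ in k..1, ∑ a ∈ S, ‖expSum (s.sigma T) (V a) (R * ξ)‖ ^ 2
        ≤ ∫ ξ in k..1, S.card * P * ∑ w ∈ s, ‖expSum (T w) (Y w) (R * ξ)‖ ^ 2 :=
      intervalIntegral.integral_mono_on hk1
        (Continuous.intervalIntegrable (by fun_prop) _ _)
        (Continuous.intervalIntegrable (by fun_prop) _ _) hpt
    have h2 : ∫ ξ in k..1, S.card * P * ∑ w ∈ s, ‖expSum (T w) (Y w) (R * ξ)‖ ^ 2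
        ≤ ∫ ξ in (0:ℝ)..1, S.card * P * ∑ w ∈ s, ‖expSum (T w) (Y w) (R * ξ)‖ ^ 2 :=
      intervalIntegral.integral_mono_interval hk.le hk1 le_rfl
        (Eventually.of_forall fun ξ => by positivity)
        (Continuous.intervalIntegrable (by fun_prop) _ _)
    rw [intervalIntegral.integral_const_mul (a := 0), intervalIntegral.integral_finsetSum
      (a := 0) (fun w _ => (hcontY w).intervalIntegrable _ _)] at h2
    have h3 : ∑ w ∈ s, ∫ ξ in (0:ℝ)..1, ‖expSum (T w) (Y w) (R * ξ)‖ ^ 2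
        ≤ ∑ w ∈ s, 4 * sieveConst * ((T w).card * B₂) := by
      refine Finset.sum_le_sum fun w hw => ?_
      have := integral_expSum_le (T w) (Y w) (κ := 1) (R := R) (B := B₂) hτ₁ one_pos
        (by linarith) (hB₂ w hw)
      linarith
    have h4 : ∑ w ∈ s, 4 * sieveConst * ((T w).card * B₂)
        = 4 * sieveConst * ((s.sigma T).card * B₂) := by
      rw [Finset.card_sigma, Nat.cast_sum, Finset.sum_mul, Finset.mul_sum]
    have h5 := mul_le_mul_of_nonneg_left (h3.trans h4.le)
      (by positivity : 0 ≤ (S.card : ℝ) * P)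
    calc _ ≤ _ := h1.trans h2
      _ ≤ _ := h5
      _ = _ := by ring
  calc _ = ∑ a ∈ S, ∫ ξ in (0:ℝ)..1, (1 - ξ) * ‖expSum (s.sigma T) (V a) (R * ξ)‖ ^ 2 := by
        refine Finset.sum_congr rfl fun a _ => ?_
        rw [integral_fejer_expSum]
    _ ≤ ∑ a ∈ S, ((∫ ξ in (0:ℝ)..k, ‖expSum (s.sigma T) (V a) (R * ξ)‖ ^ 2)
          + ∫ ξ in k..1, ‖expSum (s.sigma T) (V a) (R * ξ)‖ ^ 2) := by
        refine Finset.sum_le_sum fun a _ => ?_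
        rw [intervalIntegral.integral_add_adjacent_intervals
          ((hcont a).intervalIntegrable _ _) ((hcont a).intervalIntegrable _ _)]
        refine intervalIntegral.integral_mono_on zero_le_one
          (((continuous_const.sub continuous_id).mul (hcont a)).intervalIntegrable _ _)
          ((hcont a).intervalIntegrable _ _) fun ξ hξ => ?_
        nlinarith [hξ.1, sq_nonneg ‖expSum (s.sigma T) (V a) (R * ξ)‖]
    _ ≤ _ := by
        rw [Finset.sum_add_distrib]
        have := Finset.sum_le_sum hlow
        rw [Finset.sum_const, nsmul_eq_mul] at this
        linarith

/-- Weight penalizing points far from the integers. -/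
def ekWeight (κ b : ℝ) (y : ℝ) : ℝ := if |y - round y| < κ then 1 else b

/-- The product of consecutive weights along the orbit `y, g y, g² y, …`. -/
def ekProd (κ b g : ℝ) : ℕ → ℝ → ℝ
  | 0, _ => 1
  | J + 1, y => ekWeight κ b y * ekWeight κ b (g * y) * ekProd κ b g J (g * y)

theorem ekWeight_nonneg {κ b : ℝ} (hb : 0 ≤ b) (y : ℝ) : 0 ≤ ekWeight κ b y := by
  unfold ekWeight; split_ifs <;> linarith

theorem ekWeight_le_one {κ b : ℝ} (hb1 : b ≤ 1) (y : ℝ) : ekWeight κ b y ≤ 1 := by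
  unfold ekWeight; split_ifs <;> linarith

theorem ekProd_nonneg {κ b g : ℝ} (hb : 0 ≤ b) (J : ℕ) (y : ℝ) : 0 ≤ ekProd κ b g J y := by
  induction J generalizing y with
  | zero => simp [ekProd]
  | succ J ih =>
    exact mul_nonneg (mul_nonneg (ekWeight_nonneg hb _) (ekWeight_nonneg hb _)) (ih _)

/-- Integers whose unit intervals meet a bounded interval. -/
theorem card_int_le (T : Finset ℤ) {c r : ℝ} (hr : 0 ≤ r) (h : ∀ k ∈ T, |(k : ℝ) - c| ≤ r) :
    (T.card : ℝ) ≤ 2 * r + 1 := by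
  have hsub : T ⊆ Finset.Icc ⌈c - r⌉ ⌊c + r⌋ := by
    intro k hk
    have := abs_le.1 (h k hk)
    rw [Finset.mem_Icc, Int.ceil_le, Int.le_floor]
    constructor <;> linarith
  have h1 : (T.card : ℝ) ≤ ((Finset.Icc ⌈c - r⌉ ⌊c + r⌋).card : ℝ) := by
    exact_mod_cast Finset.card_le_card hsub
  rw [Int.card_Icc] at h1
  by_cases h2 : 0 ≤ ⌊c + r⌋ + 1 - ⌈c - r⌉
  · have h3 : (((⌊c + r⌋ + 1 - ⌈c - r⌉).toNat : ℕ) : ℝ) = ⌊c + r⌋ + 1 - ⌈c - r⌉ := by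
      have := Int.toNat_of_nonneg h2
      exact_mod_cast this
    rw [h3] at h1
    have h4 := Int.floor_le (c + r)
    have h5 := Int.le_ceil (c - r)
    linarith
  · rw [Int.toNat_of_nonpos (by omega)] at h1
    push_cast at h1
    linarith

theorem sum_ekWeight_le {g b : ℝ} (hg : 0 < g) (hg1 : g < 1) (hb : 0 ≤ b) (hb1 : b ≤ 1)
    (T : Finset ℤ) (y : ℤ → ℝ) (hy : ∀ k ∈ T, round (y k) = k) (i : ℤ)
    (hi : ∀ k ∈ T, round (g * y k) = i) :
    ∑ k ∈ T, ekWeight (g / 8) b (y k) * ekWeight (g / 8) b (g * y k) ≤ 1 + (1 / g + 2) * b := by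
  classical
  let N : ℤ → Prop := fun k => |y k - k| < g / 8 ∧ |g * y k - i| < g / 8
  have h1 : ∀ k ∈ T, ekWeight (g / 8) b (y k) * ekWeight (g / 8) b (g * y k)
      ≤ (if N k then 1 else 0) + b := by
    intro k hk
    unfold ekWeight
    rw [hy k hk, hi k hk]
    by_cases h1 : |y k - k| < g / 8 <;> by_cases h2 : |g * y k - i| < g / 8 <;>
      simp [N, h1, h2] <;> nlinarith
  refine (Finset.sum_le_sum h1).trans ?_
  rw [Finset.sum_add_distrib, Finset.sum_boole, Finset.sum_const, nsmul_eq_mul]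
  have h2 : ((T.filter N).card : ℝ) ≤ 1 := by
    have : (T.filter N).card ≤ 1 := by
      refine Finset.card_le_one.2 fun k hk l hl => ?_
      simp only [Finset.mem_filter, N] at hk hl
      obtain ⟨-, hk1, hk2⟩ := hk
      obtain ⟨-, hl1, hl2⟩ := hl
      rw [abs_lt] at hk1 hk2 hl1 hl2
      have h3 : |g * (y k - y l)| < g * (1 / 4) := by
        rw [abs_lt]; constructor <;> nlinarith
      rw [abs_mul, abs_of_pos hg] at h3
      have h4 := lt_of_mul_lt_mul_left h3 hg.le
      rw [abs_lt] at h4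
      have h5 : (k : ℝ) - l < 1 := by linarith
      have h6 : (l : ℝ) - k < 1 := by linarith
      have h5 : k - l < 1 := by exact_mod_cast h5
      have h6 : l - k < 1 := by exact_mod_cast h6
      omega
    exact_mod_cast this
  have h3 : (T.card : ℝ) ≤ 1 / g + 2 := by
    have := card_int_le T (c := i / g) (r := 1 / 2 + 1 / (2 * g)) (by positivity) ?_
    · refine this.trans (le_of_eq ?_)
      field_simp
      ring
    intro k hk
    have h4 := abs_sub_round (y k)
    have h5 := abs_sub_round (g * y k)
    rw [hy k hk] at h4
    rw [hi k hk] at h5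
    have h6 : |y k - i / g| ≤ 1 / (2 * g) := by
      have : y k - i / g = (g * y k - i) / g := by field_simp
      rw [this, abs_div, abs_of_pos hg, div_le_div_iff₀ hg (by positivity)]
      nlinarith
    rw [abs_le] at *
    constructor <;> linarith
  have h4 := mul_le_mul_of_nonneg_right h3 hb
  linarith

/-- The Erdős–Kahane counting estimate. -/
theorem sum_ekProd_le {g b X : ℝ} (hg : 0 < g) (hg1 : g < 1) (hb : 0 ≤ b) (hb1 : b ≤ 1)
    (hX : 0 ≤ X) (J : ℕ) (T : Finset ℤ) (y : ℤ → ℝ) (hy : ∀ k ∈ T, round (y k) = k)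
    (hyX : ∀ k ∈ T, g ^ J * |y k| ≤ X) :
    ∑ k ∈ T, ekProd (g / 8) b g J (y k) ≤ (2 * X + 2) * (1 + (1 / g + 2) * b) ^ J := by
  classical
  induction J generalizing T y with
  | zero =>
    simp only [ekProd, Finset.sum_const, nsmul_eq_mul, mul_one, pow_zero]
    have := card_int_le T (c := 0) (r := X + 1 / 2) (by positivity) ?_
    · linarith
    intro k hk
    have h1 := hyX k hk
    have h2 := abs_sub_round (y k)
    rw [hy k hk] at h2
    rw [pow_zero, one_mul] at h1
    rw [abs_le] at *
    constructor <;> linarith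
  | succ J ih =>
    let j : ℤ → ℤ := fun k => round (g * y k)
    have hmax : ∀ i ∈ T.image j, ∃ k ∈ T.filter (fun k => j k = i),
        ∀ l ∈ T.filter (fun k => j k = i),
          ekProd (g / 8) b g J (g * y l) ≤ ekProd (g / 8) b g J (g * y k) := by
      intro i hi
      obtain ⟨k, hk, rfl⟩ := Finset.mem_image.1 hi
      exact Finset.exists_max_image _ _ ⟨k, Finset.mem_filter.2 ⟨hk, rfl⟩⟩
    choose! r hr hrmax using hmax
    have h1 := ih (T.image j) (fun i => g * y (r i))
      (fun i hi => (Finset.mem_filter.1 (hr i hi)).2)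
      (fun i hi => by
        have := hyX _ (Finset.mem_filter.1 (hr i hi)).1
        rw [abs_mul, abs_of_pos hg, ← mul_assoc, ← pow_succ]
        exact this)
    have hK : 0 ≤ 1 + (1 / g + 2) * b := by positivity
    calc ∑ k ∈ T, ekProd (g / 8) b g (J + 1) (y k)
        = ∑ i ∈ T.image j, ∑ k ∈ T.filter (fun k => j k = i),
            ekProd (g / 8) b g (J + 1) (y k) :=
          (Finset.sum_fiberwise_of_maps_to (fun k hk => Finset.mem_image_of_mem j hk) _).symm
      _ ≤ ∑ i ∈ T.image j, (1 + (1 / g + 2) * b) * ekProd (g / 8) b g J (g * y (r i)) := by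
          refine Finset.sum_le_sum fun i hi => ?_
          calc _ ≤ ∑ k ∈ T.filter (fun k => j k = i),
                ekWeight (g / 8) b (y k) * ekWeight (g / 8) b (g * y k)
                  * ekProd (g / 8) b g J (g * y (r i)) := by
                refine Finset.sum_le_sum fun k hk => ?_
                exact mul_le_mul_of_nonneg_left (hrmax i hi k hk)
                  (mul_nonneg (ekWeight_nonneg hb _) (ekWeight_nonneg hb _))
            _ ≤ _ := by
                rw [← Finset.sum_mul]
                refine mul_le_mul_of_nonneg_right ?_ (ekProd_nonneg hb _ _)
                exact sum_ekWeight_le hg hg1 hb hb1 _ y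
                  (fun k hk => hy k (Finset.mem_filter.1 hk).1) i
                  (fun k hk => (Finset.mem_filter.1 hk).2)
      _ ≤ (1 + (1 / g + 2) * b) * ((2 * X + 2) * (1 + (1 / g + 2) * b) ^ J) := by
          rw [← Finset.mul_sum]
          exact mul_le_mul_of_nonneg_left h1 hK
      _ = _ := by ring

theorem sum_ekProd_le_mul {ι : Type*} {g b X B : ℝ} (hg : 0 < g) (hg1 : g < 1) (hb : 0 ≤ b)
    (hb1 : b ≤ 1) (hX : 0 ≤ X) (J : ℕ) (s : Finset ι) (y : ι → ℝ) (hB0 : 0 ≤ B)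
    (hB : ∀ i : ℤ, ((s.filter fun k => round (y k) = i).card : ℝ) ≤ B)
    (hyX : ∀ k ∈ s, g ^ J * |y k| ≤ X) :
    ∑ k ∈ s, ekProd (g / 8) b g J (y k) ≤ B * ((2 * X + 2) * (1 + (1 / g + 2) * b) ^ J) := by
  classical
  rcases s.eq_empty_or_nonempty with rfl | ⟨k₀, -⟩
  · rw [Finset.sum_empty]; positivity
  have : Nonempty ι := ⟨k₀⟩
  let j : ι → ℤ := fun k => round (y k)
  have hmax : ∀ i ∈ s.image j, ∃ k ∈ s.filter (fun k => j k = i),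
      ∀ l ∈ s.filter (fun k => j k = i),
        ekProd (g / 8) b g J (y l) ≤ ekProd (g / 8) b g J (y k) := by
    intro i hi
    obtain ⟨k, hk, rfl⟩ := Finset.mem_image.1 hi
    exact Finset.exists_max_image _ _ ⟨k, Finset.mem_filter.2 ⟨hk, rfl⟩⟩
  choose! r hr hrmax using hmax
  have h1 := sum_ekProd_le hg hg1 hb hb1 hX J (s.image j) (fun i => y (r i))
    (fun i hi => (Finset.mem_filter.1 (hr i hi)).2)
    (fun i hi => hyX _ (Finset.mem_filter.1 (hr i hi)).1)
  calc ∑ k ∈ s, ekProd (g / 8) b g J (y k)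
      = ∑ i ∈ s.image j, ∑ k ∈ s.filter (fun k => j k = i), ekProd (g / 8) b g J (y k) :=
        (Finset.sum_fiberwise_of_maps_to (fun k hk => Finset.mem_image_of_mem j hk) _).symm
    _ ≤ ∑ i ∈ s.image j, B * ekProd (g / 8) b g J (y (r i)) := by
        refine Finset.sum_le_sum fun i hi => ?_
        refine (Finset.sum_le_card_nsmul _ _ _ (hrmax i hi)).trans ?_
        rw [nsmul_eq_mul]
        exact mul_le_mul_of_nonneg_right (hB i) (ekProd_nonneg hb _ _)
    _ ≤ _ := by
        rw [← Finset.mul_sum]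
        exact mul_le_mul_of_nonneg_left h1 hB0

/-- The words of length `n` over a finite alphabet. -/
def words (W : Type) [Fintype W] : ℕ → Finset (List W)
  | 0 => {[]}
  | n + 1 => (Finset.univ ×ˢ words W n).map
      ⟨fun p : W × List W => p.1 :: p.2, fun p q h => by
        obtain ⟨h1, h2⟩ := List.cons.inj h
        exact Prod.ext h1 h2⟩

section Words

variable {W : Type} [Fintype W]

theorem sum_words_succ {E : Type*} [AddCommMonoid E] (n : ℕ) (F : List W → E) :
    ∑ w ∈ words W (n + 1), F w = ∑ v, ∑ w ∈ words W n, F (v :: w) := by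
  rw [words, Finset.sum_map, Finset.sum_product]
  rfl

theorem sum_words_add {E : Type*} [AddCommMonoid E] (k l : ℕ) (F : List W → E) :
    ∑ w ∈ words W (k + l), F w = ∑ w ∈ words W k, ∑ t ∈ words W l, F (w ++ t) := by
  induction k generalizing F with
  | zero => simp [words]
  | succ k ih =>
    rw [Nat.succ_add, sum_words_succ, sum_words_succ]
    exact Finset.sum_congr rfl fun v _ => ih _

theorem card_words (n : ℕ) : (words W n).card = Fintype.card W ^ n := by
  induction n with
  | zero => simp [words]
  | succ n ih => rw [words, Finset.card_map, Finset.card_product, ih, pow_succ']; rfl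

theorem mem_words {n : ℕ} {w : List W} : w ∈ words W n ↔ w.length = n := by
  induction n generalizing w with
  | zero => simp [words]
  | succ n ih =>
    simp only [words, Finset.mem_map, Finset.mem_product, Finset.mem_univ, true_and,
      Prod.exists]
    constructor
    · rintro ⟨v, u, hu, rfl⟩
      change u.length + 1 = n + 1
      rw [ih.1 hu]
    · intro h
      cases w with
      | nil => simp at h
      | cons v u => exact ⟨v, u, ih.2 (by simpa using h), rfl⟩

end Words

/-- The combinatorial data of a finite affine system of skew products: the `v`-th branch contracts
the base by `ρ`, the fibres by `Λ`, and shears with slope `e v`. -/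
structure AffSys (W : Type) where
  /-- The contraction of the base. -/
  ρ : ℝ
  /-- The contraction of the fibres. -/
  Λ : ℝ
  /-- The base translations. -/
  a : W → ℝ
  /-- The shears. -/
  e : W → ℝ
  /-- The fibre translations. -/
  d : W → ℝ
  ρ_pos : 0 < ρ
  ρ_lt : ρ < Λ
  Λ_lt : Λ < 1
  a_nonneg : ∀ v, 0 ≤ a v
  a_lt : ∀ v, a v + ρ < 1
  a_sep : ∀ v v', v ≠ v' → ρ ≤ |a v - a v'|
  v₀ : W
  v₁ : W
  e_ne : e v₀ ≠ e v₁

namespace AffSys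

variable {W : Type} (S : AffSys W)

theorem Λ_pos : 0 < S.Λ := S.ρ_pos.trans S.ρ_lt

/-- The ratio of the two contractions. -/
def Γ : ℝ := S.ρ / S.Λ

theorem Γ_pos : 0 < S.Γ := div_pos S.ρ_pos S.Λ_pos

theorem Γ_lt : S.Γ < 1 := (div_lt_one S.Λ_pos).2 S.ρ_lt

theorem Γ_mul : S.Λ * S.Γ = S.ρ := by
  have := S.Λ_pos
  unfold Γ
  field_simp

/-- The base coordinate of a word. -/
def A : List W → ℝ
  | [] => 0
  | v :: w => S.ρ * A w + S.a v

/-- The projection of a word along the direction of slope `θ`. -/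
def X : ℝ → List W → ℝ
  | _, [] => 0
  | θ, v :: w => S.Λ * X (S.e v + S.Γ * θ) w + (S.d v + θ * S.a v)

/-- The slope obtained from `θ` by following a word. -/
def th : ℝ → List W → ℝ
  | θ, [] => θ
  | θ, v :: w => th (S.e v + S.Γ * θ) w

theorem X_append (θ : ℝ) (w w' : List W) :
    S.X θ (w ++ w') = S.X θ w + S.Λ ^ w.length * S.X (S.th θ w) w' := by
  induction w generalizing θ with
  | nil => simp [X, th]
  | cons v w ih => simp only [List.cons_append, X, th, ih, List.length_cons]; ring

theorem th_append (θ : ℝ) (w w' : List W) : S.th θ (w ++ w') = S.th (S.th θ w) w' := by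
  induction w generalizing θ with
  | nil => simp [th]
  | cons v w ih => simp only [List.cons_append, th, ih]

theorem X_add (θ η : ℝ) (w : List W) : S.X (θ + η) w = S.X θ w + η * S.A w := by
  induction w generalizing θ η with
  | nil => simp [X, A]
  | cons v w ih =>
    simp only [X, A, mul_add, ← add_assoc, ih, ← S.Γ_mul]
    ring

theorem th_add (θ η : ℝ) (w : List W) : S.th (θ + η) w = S.th θ w + S.Γ ^ w.length * η := by
  induction w generalizing θ η with
  | nil => simp [th]
  | cons v w ih => simp only [th, mul_add, ← add_assoc, ih, List.length_cons]; ring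

theorem th_zero_append (w w' : List W) :
    S.th 0 (w ++ w') = S.th 0 w' + S.Γ ^ w'.length * S.th 0 w := by
  rw [th_append, ← S.th_add, zero_add]

theorem A_nonneg (w : List W) : 0 ≤ S.A w := by
  induction w with
  | nil => simp [A]
  | cons v w ih => exact add_nonneg (mul_nonneg S.ρ_pos.le ih) (S.a_nonneg v)

theorem A_lt_one (w : List W) : S.A w < 1 := by
  induction w with
  | nil => simp [A]
  | cons v w ih =>
    have := S.a_lt v
    have := S.ρ_pos
    simp only [A]
    nlinarith

theorem A_add_le (w : List W) : S.A w + S.ρ ^ w.length ≤ 1 := by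
  induction w with
  | nil => simp [A]
  | cons v w ih =>
    have := S.a_lt v
    have := S.ρ_pos
    simp only [A, List.length_cons, pow_succ']
    nlinarith

theorem A_sep {k : ℕ} {w w' : List W} (hw : w.length = k) (hw' : w'.length = k) (h : w ≠ w') :
    S.ρ ^ k ≤ |S.A w - S.A w'| := by
  induction k generalizing w w' with
  | zero =>
    rw [List.length_eq_zero_iff] at hw hw'
    exact absurd (hw.trans hw'.symm) h
  | succ k ih =>
    obtain ⟨v, u, rfl⟩ := List.exists_cons_of_length_eq_add_one hw
    obtain ⟨v', u', rfl⟩ := List.exists_cons_of_length_eq_add_one hw'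
    simp only [List.length_cons, Nat.add_right_cancel_iff] at hw hw'
    simp only [A]
    by_cases hv : v = v'
    · subst hv
      have hu : u ≠ u' := fun hh => h (by rw [hh])
      have := ih hw hw' hu
      rw [add_sub_add_right_eq_sub, ← mul_sub, abs_mul, abs_of_pos S.ρ_pos, pow_succ']
      exact mul_le_mul_of_nonneg_left this S.ρ_pos.le
    · have h1 := S.A_add_le u
      have h2 := S.A_add_le u'
      have h3 := S.A_nonneg u
      have h4 := S.A_nonneg u'
      have h5 := S.ρ_pos
      rw [hw] at h1
      rw [hw'] at h2
      rw [pow_succ']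
      rcases le_abs.1 (S.a_sep v v' hv) with h | h
      · exact le_abs.2 (Or.inl (by nlinarith))
      · exact le_abs.2 (Or.inr (by nlinarith))

/-- A bound for the slopes. -/
def thBound [Fintype W] : ℝ := (∑ v, |S.e v|) / (1 - S.Γ)

theorem abs_th_le [Fintype W] (w : List W) : ∀ θ, |θ| ≤ S.thBound → |S.th θ w| ≤ S.thBound := by
  induction w with
  | nil => intro θ h; exact h
  | cons v w ih =>
    intro θ h
    refine ih _ ?_
    have h1 : |S.e v| ≤ ∑ v, |S.e v| :=
      Finset.single_le_sum (f := fun v => |S.e v|) (fun _ _ => abs_nonneg _) (Finset.mem_univ v)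
    have h2 := S.Γ_lt
    have h3 := S.Γ_pos
    have h4 : S.thBound * (1 - S.Γ) = ∑ v, |S.e v| := by
      unfold thBound; field_simp [show (1 - S.Γ) ≠ 0 by linarith]
    refine (abs_add_le _ _).trans ?_
    rw [abs_mul, abs_of_pos h3]
    nlinarith

theorem thBound_nonneg [Fintype W] : 0 ≤ S.thBound :=
  div_nonneg (Finset.sum_nonneg fun _ _ => abs_nonneg _) (by linarith [S.Γ_lt])

theorem abs_th_zero_le [Fintype W] (w : List W) : |S.th 0 w| ≤ S.thBound :=
  S.abs_th_le w 0 (by simpa using S.thBound_nonneg)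

/-- The exponential sums of the slopes factor. -/
theorem expSum_th [Fintype W] (n : ℕ) (ζ : ℝ) :
    expSum (words W (n + 1)) (S.th 0) ζ
      = expSum Finset.univ S.e ζ * expSum (words W n) (S.th 0) (S.Γ * ζ) := by
  have h : ∀ w ∈ words W n, ∀ v, S.th 0 (w ++ [v]) = S.e v + S.Γ * S.th 0 w := by
    intro w _ v
    rw [th_append]
    rfl
  rw [expSum, sum_words_add n 1, expSum, expSum, Finset.sum_mul_sum, Finset.sum_comm]
  have h1 : ∀ t : List W → ℂ, ∑ u ∈ words W 1, t u = ∑ v, t [v] := by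
    intro t
    rw [show (1:ℕ) = 0 + 1 from rfl, sum_words_succ]
    simp [words]
  rw [h1]
  refine Finset.sum_congr rfl fun v _ => Finset.sum_congr rfl fun w hw => ?_
  rw [h w hw, ← Complex.exp_add]
  congr 1
  push_cast
  ring

/-- Normalized phase. -/
def phase (ζ : ℝ) : ℝ := ζ * (S.e S.v₁ - S.e S.v₀) / (2 * Real.pi)

theorem phase_mul (c ζ : ℝ) : S.phase (c * ζ) = c * S.phase ζ := by
  unfold phase; ring

theorem cos_le_of_round {κ y : ℝ} (hκ : 0 ≤ κ) (h : κ ≤ |y - round y|) :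
    Real.cos (2 * Real.pi * y) ≤ Real.cos (2 * Real.pi * κ) := by
  have h1 : Real.cos (2 * Real.pi * y) = Real.cos |2 * Real.pi * (y - round y)| := by
    rw [Real.cos_abs, mul_sub, mul_comm (2 * Real.pi) (round y : ℝ), Real.cos_sub_int_mul_two_pi]
  have h2 := abs_sub_round y
  rw [h1, abs_mul, abs_of_pos Real.two_pi_pos]
  apply Real.cos_le_cos_of_nonneg_of_le_pi
  · positivity
  · nlinarith [Real.pi_pos]
  · nlinarith [Real.pi_pos]

theorem norm_expSum_e_sq_le [Fintype W] (ζ : ℝ) :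
    ‖expSum Finset.univ S.e ζ‖ ^ 2
      ≤ (Fintype.card W : ℝ) ^ 2 - 2 * (1 - Real.cos (2 * Real.pi * S.phase ζ)) := by
  classical
  have hpi := Real.pi_pos
  have hph : 2 * Real.pi * S.phase ζ = ζ * (S.e S.v₁ - S.e S.v₀) := by
    unfold phase; field_simp
  rw [norm_expSum_sq, hph]
  have h1 : ∑ p : W × W, (if p = (S.v₁, S.v₀) ∨ p = (S.v₀, S.v₁) then
      (1 - Real.cos (ζ * (S.e S.v₁ - S.e S.v₀))) else 0)
      ≤ ∑ p : W × W, (1 - Real.cos (ζ * (S.e p.1 - S.e p.2))) := by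
    refine Finset.sum_le_sum fun p _ => ?_
    split_ifs with h
    · rcases h with rfl | rfl
      · rfl
      · simp only
        rw [← Real.cos_neg]
        ring_nf
        rfl
    · linarith [Real.cos_le_one (ζ * (S.e p.1 - S.e p.2))]
  rw [← Finset.sum_filter, Finset.sum_const, nsmul_eq_mul] at h1
  have h2 : (Finset.univ.filter fun p : W × W => p = (S.v₁, S.v₀) ∨ p = (S.v₀, S.v₁))
      = {(S.v₁, S.v₀), (S.v₀, S.v₁)} := by
    ext p; simp
  have h3 : (S.v₁, S.v₀) ≠ (S.v₀, S.v₁) := by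
    intro h
    have : S.v₁ = S.v₀ := congrArg Prod.fst h
    exact S.e_ne (by rw [this])
  rw [h2, Finset.card_pair h3, Finset.sum_sub_distrib, Fintype.sum_prod_type] at h1
  rw [Fintype.sum_prod_type] at h1
  simp only [Finset.sum_const, Finset.card_univ, nsmul_eq_mul, mul_one] at h1
  push_cast at h1
  nlinarith

/-- Mean decay of the Fourier transforms of the slope distributions. -/
theorem exists_sum_expSum_th_le [Fintype W] {ε : ℝ} (hε : 0 < ε) : ∃ p : ℕ, 1 ≤ p ∧
    ∀ {ι : Type} (s : Finset ι) (z : ι → ℝ) (J m : ℕ) (B X : ℝ), J + 1 ≤ m → 0 ≤ B → 0 ≤ X →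
      (∀ i : ℤ, ((s.filter fun k => round (S.phase (z k)) = i).card : ℝ) ≤ B) →
      (∀ k ∈ s, S.Γ ^ J * |S.phase (z k)| ≤ X) →
      ∑ k ∈ s, (‖expSum (words W m) (S.th 0) (z k)‖ / (Fintype.card W : ℝ) ^ m) ^ p
        ≤ B * ((2 * X + 2) * (1 + ε) ^ J) := by
  have hΓ := S.Γ_pos
  have hΓ1 := S.Γ_lt
  have hM2 : (2:ℝ) ≤ Fintype.card W := by
    have : 1 < Fintype.card W := Fintype.one_lt_card_iff.2 ⟨S.v₀, S.v₁, fun h => S.e_ne (by rw [h])⟩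
    exact_mod_cast this
  set M : ℝ := ((Fintype.card W : ℕ) : ℝ) with hM
  have hM0 : 0 < M := by linarith
  set q : ℝ := 1 - 2 * (1 - Real.cos (2 * Real.pi * (S.Γ / 8))) / M ^ 2 with hq
  have hcos : Real.cos (2 * Real.pi * (S.Γ / 8)) < 1 := by
    rw [← Real.cos_zero]
    apply Real.cos_lt_cos_of_nonneg_of_le_pi_div_two le_rfl
    · nlinarith [Real.pi_pos]
    · have := Real.pi_pos
      positivity
  have hq1 : q < 1 := by
    have : 0 < 2 * (1 - Real.cos (2 * Real.pi * (S.Γ / 8))) / M ^ 2 := by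
      apply div_pos <;> nlinarith
    linarith
  have hq0 : 0 ≤ q := by
    have := Real.neg_one_le_cos (2 * Real.pi * (S.Γ / 8))
    have : 2 * (1 - Real.cos (2 * Real.pi * (S.Γ / 8))) / M ^ 2 ≤ 1 := by
      rw [div_le_one (by positivity)]; nlinarith
    linarith
  obtain ⟨n, hn⟩ := exists_pow_lt_of_lt_one
    (show 0 < min 1 (ε / (1 / S.Γ + 2)) by positivity) hq1
  set b := q ^ n with hb
  have hb0 : 0 ≤ b := pow_nonneg hq0 n
  have hb1 : b ≤ 1 := (hn.trans_le (min_le_left _ _)).le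
  have hbε : (1 / S.Γ + 2) * b ≤ ε := by
    have := (hn.trans_le (min_le_right _ _)).le
    rw [le_div_iff₀ (by positivity)] at this
    linarith
  have hle : ∀ (m : ℕ) (ζ : ℝ), ‖expSum (words W m) (S.th 0) ζ‖ / M ^ m ≤ 1 := by
    intro m ζ
    rw [div_le_one (by positivity)]
    refine (norm_expSum_le _ _ _).trans (le_of_eq ?_)
    rw [card_words]; push_cast; rfl
  have hstep : ∀ ζ : ℝ, ((‖expSum Finset.univ S.e ζ‖ / M) ^ 2) ^ n
      ≤ ekWeight (S.Γ / 8) b (S.phase ζ) := by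
    intro ζ
    have h1 := S.norm_expSum_e_sq_le ζ
    rw [← hM] at h1
    have h2 : (‖expSum Finset.univ S.e ζ‖ / M) ^ 2
        ≤ 1 - 2 * (1 - Real.cos (2 * Real.pi * S.phase ζ)) / M ^ 2 := by
      rw [div_pow, div_le_iff₀ (by positivity), sub_mul, div_mul_cancel₀ _ (by positivity)]
      linarith
    unfold ekWeight
    split_ifs with h
    · refine pow_le_one₀ (by positivity) (h2.trans ?_)
      have : 0 ≤ 2 * (1 - Real.cos (2 * Real.pi * S.phase ζ)) / M ^ 2 := by
        have := Real.cos_le_one (2 * Real.pi * S.phase ζ)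
        exact div_nonneg (by linarith) (by positivity)
      linarith
    · push Not at h
      refine pow_le_pow_left₀ (by positivity) (h2.trans ?_) n
      rw [hq]
      have := cos_le_of_round (by positivity) h
      gcongr
  have hprod : ∀ (J m : ℕ) (ζ : ℝ), J + 1 ≤ m →
      ((‖expSum (words W m) (S.th 0) ζ‖ / M ^ m) ^ 2) ^ n *
      ((‖expSum (words W m) (S.th 0) ζ‖ / M ^ m) ^ 2) ^ n
        ≤ ekWeight (S.Γ / 8) b (S.phase ζ) * ekProd (S.Γ / 8) b S.Γ J (S.phase ζ) := by
    intro J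
    induction J with
    | zero =>
      intro m ζ hm
      obtain ⟨m, rfl⟩ : ∃ k, m = k + 1 := ⟨m - 1, by omega⟩
      have h1 : ‖expSum (words W (m + 1)) (S.th 0) ζ‖ / M ^ (m + 1)
          ≤ ‖expSum Finset.univ S.e ζ‖ / M := by
        rw [S.expSum_th, norm_mul, pow_succ', mul_div_mul_comm]
        exact mul_le_of_le_one_right (by positivity) (hle m _)
      have h2 : ((‖expSum (words W (m + 1)) (S.th 0) ζ‖ / M ^ (m + 1)) ^ 2) ^ n
          ≤ ekWeight (S.Γ / 8) b (S.phase ζ) := le_trans (by gcongr) (hstep ζ)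
      simp only [ekProd, mul_one]
      refine (mul_le_mul_of_nonneg_left (h2.trans (ekWeight_le_one hb1 _)) (by positivity)).trans ?_
      rw [mul_one]
      exact h2
    | succ J ih =>
      intro m ζ hm
      obtain ⟨m, rfl⟩ : ∃ k, m = k + 1 := ⟨m - 1, by omega⟩
      have h1 := ih m (S.Γ * ζ) (by omega)
      have h2 := hstep ζ
      rw [S.phase_mul] at h1
      have h3 : ((‖expSum (words W (m + 1)) (S.th 0) ζ‖ / M ^ (m + 1)) ^ 2) ^ n
          = ((‖expSum Finset.univ S.e ζ‖ / M) ^ 2) ^ n *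
            ((‖expSum (words W m) (S.th 0) (S.Γ * ζ)‖ / M ^ m) ^ 2) ^ n := by
        rw [S.expSum_th, norm_mul, pow_succ' M m, mul_div_mul_comm, mul_pow, mul_pow]
      rw [h3, mul_mul_mul_comm]
      refine (mul_le_mul (mul_le_mul h2 h2 (by positivity) (ekWeight_nonneg hb0 _)) h1
        (by positivity) (mul_nonneg (ekWeight_nonneg hb0 _) (ekWeight_nonneg hb0 _))).trans
        (le_of_eq ?_)
      simp only [ekProd]
      ring
  refine ⟨4 * n + 1, by omega, ?_⟩
  intro ι s z J m B X hJ hB0 hX hB hzX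
  have h1 := sum_ekProd_le_mul hΓ hΓ1 hb0 hb1 hX J s (fun k => S.phase (z k)) hB0 hB hzX
  calc _ ≤ ∑ k ∈ s, ekProd (S.Γ / 8) b S.Γ J (S.phase (z k)) := by
        refine Finset.sum_le_sum fun k _ => ?_
        have h2 := hprod J m (z k) hJ
        have h3 := ekWeight_le_one (κ := S.Γ / 8) hb1 (S.phase (z k))
        have h4 := ekProd_nonneg (κ := S.Γ / 8) (g := S.Γ) hb0 J (S.phase (z k))
        rw [pow_succ]
        refine (mul_le_of_le_one_right (by positivity) (hle m _)).trans ?_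
        refine le_trans (le_of_eq ?_) (h2.trans (mul_le_of_le_one_left h4 h3))
        ring
    _ ≤ _ := h1
    _ ≤ _ := by gcongr

end AffSys

/-- Separated points in an interval. -/
theorem card_le_of_separated {ι : Type*} (s : Finset ι) (f : ι → ℝ) {h c r : ℝ} (hh : 0 < h)
    (hr : 0 ≤ r) (hs : ∀ a ∈ s, ∀ b ∈ s, a ≠ b → h ≤ |f a - f b|) (hc : ∀ a ∈ s, |f a - c| ≤ r) :
    (s.card : ℝ) ≤ 2 * (r / h) + 2 := by
  classical
  have hinj : InjOn (fun a => ⌊f a / h⌋) s := by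
    intro a ha b hb hab
    by_contra hne
    have h1 := Int.abs_sub_lt_one_of_floor_eq_floor hab
    have h2 := hs a ha b hb hne
    rw [← sub_div, abs_div, abs_of_pos hh, div_lt_one hh] at h1
    linarith
  rw [← Finset.card_image_of_injOn hinj]
  have := card_int_le (s.image fun a => ⌊f a / h⌋) (c := c / h - 1 / 2) (r := r / h + 1 / 2)
    (by positivity) ?_
  · linarith
  intro k hk
  obtain ⟨a, ha, rfl⟩ := Finset.mem_image.1 hk
  have h1 := Int.floor_le (f a / h)
  have h2 := Int.lt_floor_add_one (f a / h)
  have h3 : |f a / h - c / h| ≤ r / h := by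
    rw [← sub_div, abs_div, abs_of_pos hh]
    exact div_le_div_of_nonneg_right (hc a ha) hh.le
  rw [abs_le] at *
  constructor <;> linarith

theorem le_add_rpow {u h : ℝ} (hu : 0 ≤ u) (hu1 : u ≤ 1) (hh : 0 < h) (p : ℕ) :
    u ≤ h + u ^ p / h ^ p := by
  by_cases h1 : u ≤ h
  · have : 0 ≤ u ^ p / h ^ p := by positivity
    linarith
  · push Not at h1
    have : 1 ≤ u ^ p / h ^ p := by
      rw [one_le_div (by positivity)]
      gcongr
    linarith

namespace AffSys

variable {W : Type} [Fintype W] (S : AffSys W)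

theorem two_le_card (T : AffSys W) : (2:ℝ) ≤ (Fintype.card W : ℕ) := by
  have : 1 < Fintype.card W := Fintype.one_lt_card_iff.2 ⟨T.v₀, T.v₁, fun h => T.e_ne (by rw [h])⟩
  exact_mod_cast this

theorem inv_pow_le {σ : ℝ} (hM : 1 ≤ (Fintype.card W : ℕ) * S.ρ * S.Λ ^ (-σ)) (k : ℕ) :
    (S.ρ ^ k)⁻¹ ≤ (Fintype.card W : ℝ) ^ k * (S.Λ ^ k) ^ (-σ) := by
  have h1 := S.ρ_pos
  have h2 := S.Λ_pos
  have h3 : (1:ℝ) ≤ ((Fintype.card W : ℕ) * S.ρ * S.Λ ^ (-σ)) ^ k := one_le_pow₀ hM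
  have h4 : (S.Λ ^ k) ^ (-σ) = (S.Λ ^ (-σ)) ^ k := by
    rw [← Real.rpow_natCast, ← Real.rpow_natCast, ← Real.rpow_mul h2.le, ← Real.rpow_mul h2.le,
      mul_comm]
  rw [mul_pow, mul_pow] at h3
  rw [h4, inv_le_iff_one_le_mul₀ (by positivity)]
  linarith

set_option maxHeartbeats 1000000 in
/-- The row sums in Schur's test. -/
theorem exists_row_bound {σ η K : ℝ} (hσ : 0 ≤ σ) (hση : σ + η < 1) (hη : 0 < η)
    (hK : 1 ≤ K) (hM : 1 ≤ (Fintype.card W : ℕ) * S.ρ * S.Λ ^ (-σ)) :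
    ∃ ε > 0, ∃ C > 0, ∀ (s : ℝ) (J m k : ℕ), 0 < s → s ≤ 1 → S.Γ ^ (J + 2) ≤ s → s < S.Γ ^ (J + 1) →
      J + 1 ≤ m → S.Λ ^ k ≤ s → S.Λ * s ≤ S.Λ ^ k →
      ∀ ζ, s ^ (η / 8) * (1 / (K * s ^ 2)) ≤ ζ → ζ ≤ 1 / (K * s ^ 2) →
      ∀ T ⊆ words W k, ∀ w ∈ T,
        ∑ v ∈ T, ‖expSum (words W m) (S.th 0)
          (ζ * (S.Γ ^ (J + 2) * S.A w - S.Γ ^ (J + 2) * S.A v))‖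
        ≤ (words W m).card * (T.card * s ^ ε + C * (Fintype.card W : ℝ) ^ k * s ^ (1 - σ - η + ε)) := by
  have hΓ := S.Γ_pos
  have hΓ1 := S.Γ_lt
  have hΛ := S.Λ_pos
  have hΛ1 := S.Λ_lt
  have hρ := S.ρ_pos
  have hM2 := S.two_le_card
  set M : ℝ := ((Fintype.card W : ℕ) : ℝ) with hMdef
  have hM0 : 0 < M := by linarith
  set Δ : ℝ := |S.e S.v₁ - S.e S.v₀| / (2 * Real.pi) with hΔ
  have hΔ0 : 0 < Δ := div_pos (abs_pos.2 (sub_ne_zero.2 S.e_ne.symm)) Real.two_pi_pos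
  have hε1 : 0 < S.Γ ^ (-(η / 8)) - 1 := by
    have := Real.one_lt_rpow_of_pos_of_lt_one_of_neg hΓ hΓ1 (show -(η / 8) < 0 by linarith)
    linarith
  obtain ⟨p, hp, hEK⟩ := S.exists_sum_expSum_th_le hε1
  set X : ℝ := Δ / S.Γ ^ 2 with hX
  have hX0 : 0 < X := by positivity
  set C₁ : ℝ := S.Λ ^ (-σ) * (K / (S.Γ * Δ)) + 2 with hC₁
  have hC₁0 : 0 < C₁ := by positivity
  set ε : ℝ := η / (4 * (p + 1)) with hε
  have hε0 : 0 < ε := by positivity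
  have hpε : p * ε ≤ η / 4 ∧ ε ≤ η / 8 := by
    have hp' : (1:ℝ) ≤ p := by exact_mod_cast hp
    constructor
    · rw [hε, mul_div_assoc', div_le_div_iff₀ (by positivity) (by norm_num)]
      nlinarith
    · rw [hε]
      gcongr
      linarith
  refine ⟨ε, hε0, C₁ * (2 * X + 2), by positivity, ?_⟩
  intro s J m k hs hs1 hJ1 hJ2 hJm hk1 hk2 ζ hζ1 hζ2 T hT w hw
  set z : List W → ℝ := fun v => ζ * (S.Γ ^ (J + 2) * S.A w - S.Γ ^ (J + 2) * S.A v) with hz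
  set Z : ℝ := ζ * S.Γ ^ (J + 2) * Δ with hZ
  have hζ0 : 0 < ζ := lt_of_lt_of_le (by positivity) hζ1
  have hZ0 : 0 < Z := by positivity
  have hphase : ∀ v, |S.phase (z v)| = Z * |S.A v - S.A w| := by
    intro v
    have : S.phase (z v) = (ζ * S.Γ ^ (J + 2)) * ((S.e S.v₁ - S.e S.v₀) / (2 * Real.pi))
        * -(S.A v - S.A w) := by
      simp only [phase, hz]; ring
    rw [this, abs_mul, abs_mul, abs_neg, abs_div, abs_of_pos Real.two_pi_pos,
      abs_of_pos (show 0 < ζ * S.Γ ^ (J + 2) by positivity)]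
  have hZlow : S.Γ * Δ / K * s ^ (η / 8 - 1) ≤ Z := by
    have h1 : S.Γ * s ≤ S.Γ ^ (J + 2) := by
      rw [pow_succ' S.Γ (J + 1)]
      exact mul_le_mul_of_nonneg_left hJ2.le hΓ.le
    have h2 : S.Γ * Δ / K * s ^ (η / 8 - 1) = s ^ (η / 8) * (1 / (K * s ^ 2)) * (S.Γ * s) * Δ := by
      rw [Real.rpow_sub hs, Real.rpow_one]
      field_simp
    rw [h2, hZ]
    gcongr
  set B : ℝ := C₁ * M ^ k * s ^ (1 - σ - η / 8) with hB
  have hcount : ∀ i : ℤ, ((T.filter fun v => round (S.phase (z v)) = i).card : ℝ) ≤ B := by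
    intro i
    have hΛσ : (S.Λ ^ k) ^ (-σ) ≤ S.Λ ^ (-σ) * s ^ (-σ) := by
      rw [← Real.mul_rpow hΛ.le hs.le]
      exact Real.rpow_le_rpow_of_nonpos (by positivity) hk2 (by linarith)
    have h1 := card_le_of_separated (T.filter fun v => round (S.phase (z v)) = i) S.A
      (h := S.ρ ^ k) (c := S.A w - i * (S.phase (z w - z w) + (ζ * S.Γ ^ (J + 2)) *
        ((S.e S.v₁ - S.e S.v₀) / (2 * Real.pi)))⁻¹) (r := 1 / (2 * Z)) (by positivity)
      (by positivity)
      (fun a ha b hb hab => S.A_sep (mem_words.1 (hT (Finset.mem_filter.1 ha).1))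
        (mem_words.1 (hT (Finset.mem_filter.1 hb).1)) hab)
      (fun v hv => by
        have h1 := abs_sub_round (S.phase (z v))
        rw [(Finset.mem_filter.1 hv).2] at h1
        have h2 : S.phase (z w - z w) = 0 := by simp [phase]
        set q := (ζ * S.Γ ^ (J + 2)) * ((S.e S.v₁ - S.e S.v₀) / (2 * Real.pi)) with hq
        have hqZ : |q| = Z := by
          rw [hq, abs_mul, abs_div, abs_of_pos Real.two_pi_pos,
            abs_of_pos (show 0 < ζ * S.Γ ^ (J + 2) by positivity)]
        have hq0 : q ≠ 0 := by
          intro h0; rw [h0, abs_zero] at hqZ; linarith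
        have h3 : S.phase (z v) = q * (S.A w - S.A v) := by
          simp only [phase, hz, hq]; ring
        rw [h2, zero_add]
        have h4 : S.A v - (S.A w - i * q⁻¹) = -((S.phase (z v) - i) / q) := by
          rw [h3]; field_simp; ring
        rw [h4, abs_neg, abs_div, hqZ, div_le_div_iff₀ hZ0 (by positivity)]
        nlinarith)
    refine h1.trans ?_
    have h2 : 2 * (1 / (2 * Z) / S.ρ ^ k) ≤ S.Λ ^ (-σ) * (K / (S.Γ * Δ)) * M ^ k *
        s ^ (1 - σ - η / 8) := by
      have h3 : 2 * (1 / (2 * Z) / S.ρ ^ k) = Z⁻¹ * (S.ρ ^ k)⁻¹ := by field_simp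
      have h4 : Z⁻¹ ≤ (S.Γ * Δ / K * s ^ (η / 8 - 1))⁻¹ := inv_anti₀ (by positivity) hZlow
      have h5 : (S.Γ * Δ / K * s ^ (η / 8 - 1))⁻¹ = K / (S.Γ * Δ) * s ^ (1 - η / 8) := by
        rw [mul_inv, inv_div, ← Real.rpow_neg hs.le]; ring_nf
      have h6 : s ^ (1 - σ - η / 8) = s ^ (1 - η / 8) * s ^ (-σ) := by
        rw [← Real.rpow_add hs]; ring_nf
      rw [h3, h6]
      calc Z⁻¹ * (S.ρ ^ k)⁻¹ ≤ (K / (S.Γ * Δ) * s ^ (1 - η / 8)) *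
            (M ^ k * (S.Λ ^ (-σ) * s ^ (-σ))) := by
            rw [h5] at h4
            gcongr
            exact (S.inv_pow_le hM k).trans (by gcongr)
        _ = _ := by ring
    have h3 : (1:ℝ) ≤ M ^ k * s ^ (1 - σ - η / 8) := by
      have h4 : 1 ≤ S.ρ ^ k * (M ^ k * (S.Λ ^ k) ^ (-σ)) := by
        have := S.inv_pow_le hM k
        rwa [inv_le_iff_one_le_mul₀ (by positivity), mul_comm] at this
      have h5 : S.ρ ^ k ≤ S.Λ ^ k := pow_le_pow_left₀ hρ.le S.ρ_lt.le k
      have h6 : S.Λ ^ k * (S.Λ ^ k) ^ (-σ) = (S.Λ ^ k) ^ (1 - σ) := by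
        rw [sub_eq_add_neg, Real.rpow_add (by positivity), Real.rpow_one]
      have h7 : (S.Λ ^ k) ^ (1 - σ) ≤ s ^ (1 - σ) :=
        Real.rpow_le_rpow (by positivity) hk1 (by linarith)
      have h8 : s ^ (1 - σ) ≤ s ^ (1 - σ - η / 8) :=
        Real.rpow_le_rpow_of_exponent_ge hs hs1 (by linarith)
      calc (1:ℝ) ≤ S.ρ ^ k * (M ^ k * (S.Λ ^ k) ^ (-σ)) := h4
        _ ≤ S.Λ ^ k * (M ^ k * (S.Λ ^ k) ^ (-σ)) := by gcongr
        _ = M ^ k * (S.Λ ^ k) ^ (1 - σ) := by rw [← h6]; ring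
        _ ≤ _ := by gcongr; exact h7.trans h8
    rw [hB, hC₁]
    nlinarith
  have hsmall : ∀ v ∈ T, S.Γ ^ J * |S.phase (z v)| ≤ X := by
    intro v _
    rw [hphase]
    have h1 : |S.A v - S.A w| ≤ 1 := by
      rw [abs_le]
      constructor <;> linarith [S.A_nonneg v, S.A_nonneg w, S.A_lt_one v, S.A_lt_one w]
    have h2 : ζ ≤ 1 / s ^ 2 := hζ2.trans (by gcongr; nlinarith [sq_nonneg s])
    have h3 : S.Γ ^ (J + 2) * S.Γ ^ (J + 2) ≤ s ^ 2 := by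
      rw [sq]; gcongr
    have h4 : ζ * s ^ 2 ≤ 1 := by
      rwa [le_div_iff₀ (by positivity)] at h2
    have h5 : ζ * (S.Γ ^ (J + 2) * S.Γ ^ (J + 2)) ≤ 1 :=
      (mul_le_mul_of_nonneg_left h3 hζ0.le).trans h4
    rw [hX, le_div_iff₀ (by positivity)]
    calc S.Γ ^ J * (Z * |S.A v - S.A w|) * S.Γ ^ 2
        ≤ S.Γ ^ J * (Z * 1) * S.Γ ^ 2 := by gcongr
      _ = (ζ * (S.Γ ^ (J + 2) * S.Γ ^ (J + 2))) * Δ := by rw [hZ, pow_add]; ring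
      _ ≤ 1 * Δ := by gcongr
      _ = Δ := one_mul _
  have hB0 : 0 ≤ B := by positivity
  have h1 := hEK T z J m B X hJm hB0 hX0.le hcount hsmall
  rw [add_sub_cancel] at h1
  have h2 : (S.Γ ^ (-(η / 8))) ^ J ≤ s ^ (-(η / 8)) := by
    have : (S.Γ ^ (-(η / 8))) ^ J = (S.Γ ^ J) ^ (-(η / 8)) := by
      rw [← Real.rpow_natCast, ← Real.rpow_natCast, ← Real.rpow_mul hΓ.le,
        ← Real.rpow_mul hΓ.le, mul_comm]
    rw [this]
    refine Real.rpow_le_rpow_of_nonpos hs ?_ (by linarith)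
    refine hJ2.le.trans ?_
    rw [pow_succ]
    exact mul_le_of_le_one_right (by positivity) hΓ1.le
  have hcard : ((words W m).card : ℝ) = M ^ m := by rw [card_words]; push_cast; rfl
  have hsε : 0 < s ^ ε := by positivity
  have h3 : ∀ v ∈ T, ‖expSum (words W m) (S.th 0) (z v)‖ ≤ M ^ m * (s ^ ε
      + (‖expSum (words W m) (S.th 0) (z v)‖ / M ^ m) ^ p / (s ^ ε) ^ p) := by
    intro v _
    have h4 : ‖expSum (words W m) (S.th 0) (z v)‖ / M ^ m ≤ 1 := by
      rw [div_le_one (by positivity), ← hcard]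
      exact norm_expSum_le _ _ _
    have h5 := le_add_rpow (by positivity) h4 hsε p
    rwa [div_le_iff₀' (by positivity)] at h5
  refine (Finset.sum_le_sum h3).trans ?_
  rw [hcard, ← Finset.mul_sum, Finset.sum_add_distrib, Finset.sum_const, nsmul_eq_mul,
    ← Finset.sum_div]
  gcongr
  rw [div_le_iff₀ (by positivity)]
  refine h1.trans ?_
  have h6 : s ^ (1 - σ - η / 8) * s ^ (-(η / 8)) ≤ s ^ (1 - σ - η + ε) * (s ^ ε) ^ p := by
    rw [← Real.rpow_natCast, ← Real.rpow_mul hs.le, ← Real.rpow_add hs, ← Real.rpow_add hs]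
    refine Real.rpow_le_rpow_of_exponent_ge hs hs1 ?_
    have := hpε.1
    have := hpε.2
    nlinarith
  calc B * ((2 * X + 2) * (S.Γ ^ (-(η / 8))) ^ J)
      ≤ B * ((2 * X + 2) * s ^ (-(η / 8))) := by gcongr
    _ = C₁ * (2 * X + 2) * M ^ k * (s ^ (1 - σ - η / 8) * s ^ (-(η / 8))) := by rw [hB]; ring
    _ ≤ C₁ * (2 * X + 2) * M ^ k * (s ^ (1 - σ - η + ε) * (s ^ ε) ^ p) := by gcongr
    _ = _ := by ring

end AffSys

namespace AffSys

variable {W : Type} [Fintype W] (S : AffSys W)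

/-- A bound for the projections. -/
def XBound : ℝ := (∑ v, |S.d v| + S.thBound) / (1 - S.Λ)

theorem XBound_nonneg : 0 ≤ S.XBound :=
  div_nonneg (add_nonneg (Finset.sum_nonneg fun _ _ => abs_nonneg _) S.thBound_nonneg)
    (by linarith [S.Λ_lt])

theorem abs_X_le (w : List W) : ∀ θ, |θ| ≤ S.thBound → |S.X θ w| ≤ S.XBound := by
  induction w with
  | nil => intro θ _; simpa [X] using S.XBound_nonneg
  | cons v w ih =>
    intro θ h
    have h1 : |S.d v| ≤ ∑ v, |S.d v| :=
      Finset.single_le_sum (f := fun v => |S.d v|) (fun _ _ => abs_nonneg _) (Finset.mem_univ v)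
    have h2 := ih (S.e v + S.Γ * θ) (S.abs_th_le [v] θ h)
    have h3 := S.Λ_pos
    have h4 := S.Λ_lt
    have h5 : S.XBound * (1 - S.Λ) = ∑ v, |S.d v| + S.thBound := by
      unfold XBound; field_simp [show (1 - S.Λ) ≠ 0 by linarith]
    have h6 : |θ * S.a v| ≤ S.thBound := by
      rw [abs_mul, abs_of_nonneg (S.a_nonneg v)]
      have := S.a_lt v
      have := S.ρ_pos
      have := S.a_nonneg v
      nlinarith [abs_nonneg θ]
    have h7 : |S.Λ * S.X (S.e v + S.Γ * θ) w| ≤ S.Λ * S.XBound := by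
      rw [abs_mul, abs_of_pos h3]
      gcongr
    refine (abs_add_le _ _).trans ?_
    have := abs_add_le (S.d v) (θ * S.a v)
    linarith

/-- Approximation of the projection of a concatenation by a sum of simpler terms. -/
theorem abs_X_append_sub_le (α p w t : List W) :
    |S.X (S.th 0 (α ++ p)) (w ++ t) - (S.X (S.th 0 p) w + S.th 0 α * (S.Γ ^ p.length * S.A w)
      + S.Λ ^ w.length * S.X (S.th 0 (p ++ w)) t)|
      ≤ S.thBound * (S.Λ ^ w.length * S.Γ ^ p.length) := by
  have hΓ := S.Γ_pos
  have hΛ := S.Λ_pos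
  have h1 : S.th (S.th 0 (α ++ p)) w = S.th 0 (p ++ w)
      + S.Γ ^ (p ++ w).length * S.th 0 α := by
    rw [← th_append, List.append_assoc, th_zero_append]
  have h2 : S.X (S.th 0 (α ++ p)) (w ++ t) - (S.X (S.th 0 p) w +
      S.th 0 α * (S.Γ ^ p.length * S.A w) + S.Λ ^ w.length * S.X (S.th 0 (p ++ w)) t)
      = S.th 0 α * ((S.Λ ^ w.length * S.Γ ^ p.length) * (S.Γ ^ w.length * S.A t)) := by
    rw [X_append, h1, X_add, th_zero_append S α p, X_add, List.length_append, pow_add]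
    ring
  rw [h2, abs_mul]
  have h3 : |S.Λ ^ w.length * S.Γ ^ p.length * (S.Γ ^ w.length * S.A t)|
      ≤ S.Λ ^ w.length * S.Γ ^ p.length := by
    have h4 := S.A_nonneg t
    have h5 := (S.A_lt_one t).le
    have h6 : S.Γ ^ w.length ≤ 1 := pow_le_one₀ hΓ.le S.Γ_lt.le
    rw [abs_of_nonneg (by positivity)]
    exact mul_le_of_le_one_right (by positivity) (mul_le_one₀ h6 h4 h5)
  exact mul_le_mul (S.abs_th_zero_le α) h3 (abs_nonneg _) S.thBound_nonneg

open Classical in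
set_option maxHeartbeats 1000000 in
/-- One step of flattening, for a fixed middle word `p`. -/
theorem exists_flatten_core {σ η : ℝ} (hσ : 0 ≤ σ) (hση : σ + η < 1) (hη : 0 < η)
    (hM : 1 ≤ (Fintype.card W : ℕ) * S.ρ * S.Λ ^ (-σ)) :
    ∃ g > 0, ∀ C > 0, ∃ C' > 0, ∀ (δ s : ℝ) (J m k l : ℕ) (p : List W)
      (E₁ : List W → Prop) (E₂ : List W → List W → Prop),
      0 ≤ δ → δ ≤ 1 - σ - η → 0 < s → s ≤ 1 → S.Γ ^ (J + 2) ≤ s → s < S.Γ ^ (J + 1) →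
      J + 1 ≤ m → S.Λ ^ k ≤ s → S.Λ * s ≤ S.Λ ^ k → p.length = J + 2 →
      (∀ y, (((words W k).filter fun w => E₁ w ∧ |S.X (S.th 0 p) w - y| ≤ s).card : ℝ)
        ≤ C * s ^ δ * (Fintype.card W : ℝ) ^ k) →
      (∀ w ∈ words W k, ∀ y, (((words W l).filter fun t => E₂ w t ∧
        |S.X (S.th 0 (p ++ w)) t - y| ≤ (2 + 2 * S.thBound) * s / S.Λ).card : ℝ)
        ≤ C * s ^ δ * (Fintype.card W : ℝ) ^ l) →
      (∀ w ∈ words W k, ∀ y, (((words W l).filter fun t => E₂ w t ∧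
        |S.X (S.th 0 (p ++ w)) t - y| ≤ (2 + 2 * S.thBound) * s ^ (1 - η / 8) / S.Λ).card : ℝ)
        ≤ C * s ^ (δ * (1 - η / 8)) * (Fintype.card W : ℝ) ^ l) →
      ∃ F : List W → List W → List W → Prop,
        (∑ α ∈ words W m, ∑ w ∈ words W k, (((words W l).filter fun t =>
          E₁ w ∧ E₂ w t ∧ ¬ F α w t).card : ℝ) ≤ C' * s ^ (2 * g) *
            ((Fintype.card W : ℝ) ^ m * ((Fintype.card W : ℝ) ^ k * (Fintype.card W : ℝ) ^ l))) ∧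
        ∀ α ∈ words W m, ∀ y, (∑ w ∈ words W k, (((words W l).filter fun t =>
          (E₁ w ∧ E₂ w t ∧ F α w t) ∧ |S.X (S.th 0 (α ++ p)) (w ++ t) - y| ≤ s ^ 2).card : ℝ)
          ≤ C' * s ^ (2 * (δ + g)) * ((Fintype.card W : ℝ) ^ k * (Fintype.card W : ℝ) ^ l)) := by
  have hΓ := S.Γ_pos
  have hΓ1 := S.Γ_lt
  have hΛ := S.Λ_pos
  have hΛ1 := S.Λ_lt
  have hθB := S.thBound_nonneg
  have hXB := S.XBound_nonneg
  have hM2 := S.two_le_card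
  have hsv := sieveConst_nonneg
  set K : ℝ := 2 + 2 * S.thBound with hK
  have hK1 : 1 ≤ K := by linarith
  obtain ⟨ε, hε, CR, hCR, hrow⟩ := S.exists_row_bound hσ hση hη hK1 hM
  set M : ℝ := ((Fintype.card W : ℕ) : ℝ) with hMdef
  have hM0 : 0 < M := by linarith
  refine ⟨min ε (η ^ 2 / 8) / 4, by positivity, fun C hC => ?_⟩
  set g : ℝ := min ε (η ^ 2 / 8) / 4 with hg
  set C₂ : ℝ := 4 * sieveConst * (C * C + (C + CR) * C) with hC₂
  set C₅ : ℝ := 2 * (1 + S.thBound + S.XBound) + 2 with hC₅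
  have hC₂0 : 0 ≤ C₂ := by positivity
  have hC₅0 : 0 < C₅ := by positivity
  refine ⟨C₂ + 4 * C₅, by positivity, ?_⟩
  intro δ s J m k l p E₁ E₂ hδ hδ1 hs hs1 hJ1 hJ2 hJm hk1 hk2 hp hw1 hw2 hw3
  set j : List W → ℤ := fun w => ⌊S.X (S.th 0 p) w / s⌋ with hj
  set R : ℝ := 1 / (K * s ^ 2) with hR
  have hR0 : 0 < R := by positivity
  set T₁ : Finset (List W) := (words W k).filter E₁ with hT₁
  set T : List W → Finset (List W) := fun w => (words W l).filter (E₂ w) with hT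
  set V : List W → (Σ _ : List W, List W) → ℝ := fun α q => S.X (S.th 0 p) q.1 +
    S.th 0 α * (S.Γ ^ (J + 2) * S.A q.1) + S.Λ ^ k * S.X (S.th 0 (p ++ q.1)) q.2 with hV
  set Ω : ℤ → Finset (Σ _ : List W, List W) :=
    fun i => (T₁.filter fun w => j w = i).sigma T with hΩ
  set D : List W → (Σ _ : List W, List W) → ℝ := fun α q =>
    ∑ q' ∈ Ω (j q.1), fejer (R * (V α q - V α q')) with hD
  have hD0 : ∀ α q, 0 ≤ D α q := fun α q => Finset.sum_nonneg fun _ _ => fejer_nonneg _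
  set thr : ℝ := s ^ (2 * (δ + g)) * (M ^ k * M ^ l) with hthr
  have hthr0 : 0 < thr := by positivity
  have hcardl : ∀ n, ((words W n).card : ℝ) = M ^ n := fun n => by
    rw [card_words]; push_cast; rfl
  refine ⟨fun α w t => D α ⟨w, t⟩ ≤ thr, ?_, ?_⟩
  · -- the exceptional set
    have hclass : ∀ i, ((T₁.filter fun w => j w = i).card : ℝ) ≤ C * s ^ δ * M ^ k := by
      intro i
      refine le_trans ?_ (hw1 ((i + 1 / 2) * s))
      rw [hT₁, Finset.filter_filter]
      refine Nat.cast_le.2 (Finset.card_le_card fun w hw => ?_)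
      obtain ⟨hw0, h1, rfl⟩ := Finset.mem_filter.1 hw
      refine Finset.mem_filter.2 ⟨hw0, h1, ?_⟩
      have h2 := Int.floor_le (S.X (S.th 0 p) w / s)
      have h3 := Int.lt_floor_add_one (S.X (S.th 0 p) w / s)
      rw [le_div_iff₀ hs] at h2
      rw [div_lt_iff₀ hs] at h3
      simp only [hj]
      rw [abs_le]
      constructor <;> nlinarith
    have hmain : ∀ i, ∑ α ∈ words W m, ∑ q ∈ Ω i, D α q
        ≤ M ^ m * (C₂ * s ^ (2 * δ + 4 * g) * (M ^ k * M ^ l)) * (Ω i).card := by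
      intro i
      have h1 := sum_sum_fejer_le (words W m) (T₁.filter fun w => j w = i) T (S.th 0)
        (fun w => S.X (S.th 0 p) w) (fun w => S.Γ ^ (J + 2) * S.A w)
        (fun w t => S.Λ ^ k * S.X (S.th 0 (p ++ w)) t)
        (R := R) (k := s ^ (η / 8)) (τ₁ := K * s ^ 2) (τ₂ := K * s ^ (2 - η / 8))
        (B₁ := C * s ^ δ * M ^ k) (B₂ := C * s ^ δ * M ^ l)
        (B₃ := C * s ^ (δ * (1 - η / 8)) * M ^ l)
        (P := (C + CR) * M ^ k * s ^ (δ + ε))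
        (by positivity) (by positivity) (by positivity)
        (Real.rpow_le_one hs.le hs1 (by positivity))
        (le_of_eq (by rw [hR]; field_simp))
        (le_of_eq (by
          have : s ^ (2 - η / 8) = s ^ 2 / s ^ (η / 8) := by
            rw [Real.rpow_sub hs]; norm_num
          rw [hR, this]; field_simp))
        (hclass i) (by positivity)
        (fun w hw y => by
          have hwk := (Finset.mem_filter.1 (Finset.mem_filter.1 hw).1).1
          refine le_trans ?_ (hw2 w hwk (y / S.Λ ^ k))
          simp only [hT, Finset.filter_filter]
          refine Nat.cast_le.2 (Finset.card_le_card fun t ht => ?_)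
          obtain ⟨ht0, h1, h2⟩ := Finset.mem_filter.1 ht
          refine Finset.mem_filter.2 ⟨ht0, h1, ?_⟩
          have h3 : S.X (S.th 0 (p ++ w)) t - y / S.Λ ^ k
              = (S.Λ ^ k * S.X (S.th 0 (p ++ w)) t - y) / S.Λ ^ k := by field_simp
          rw [h3, abs_div, abs_of_pos (by positivity : 0 < S.Λ ^ k),
            div_le_div_iff₀ (by positivity) hΛ]
          calc _ ≤ K * s ^ 2 * S.Λ := by gcongr
            _ = K * s * (S.Λ * s) := by ring
            _ ≤ K * s * S.Λ ^ k := by gcongr)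
        (fun w hw y => by
          have hwk := (Finset.mem_filter.1 (Finset.mem_filter.1 hw).1).1
          refine le_trans ?_ (hw3 w hwk (y / S.Λ ^ k))
          simp only [hT, Finset.filter_filter]
          refine Nat.cast_le.2 (Finset.card_le_card fun t ht => ?_)
          obtain ⟨ht0, h1, h2⟩ := Finset.mem_filter.1 ht
          refine Finset.mem_filter.2 ⟨ht0, h1, ?_⟩
          have h3 : S.X (S.th 0 (p ++ w)) t - y / S.Λ ^ k
              = (S.Λ ^ k * S.X (S.th 0 (p ++ w)) t - y) / S.Λ ^ k := by field_simp
          rw [h3, abs_div, abs_of_pos (by positivity : 0 < S.Λ ^ k),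
            div_le_div_iff₀ (by positivity) hΛ]
          have h4 : s ^ (2 - η / 8) = s ^ (1 - η / 8) * s := by
            rw [← Real.rpow_add_one hs.ne']; ring_nf
          calc _ ≤ K * s ^ (2 - η / 8) * S.Λ := by gcongr
            _ = K * s ^ (1 - η / 8) * (S.Λ * s) := by rw [h4]; ring
            _ ≤ K * s ^ (1 - η / 8) * S.Λ ^ k := by gcongr)
        (by positivity)
        (fun ζ hζ1 hζ2 w hw => by
          have h1 := hrow s J m k hs hs1 hJ1 hJ2 hJm hk1 hk2 ζ hζ1 hζ2
            (T₁.filter fun w => j w = i)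
            ((Finset.filter_subset _ _).trans (Finset.filter_subset _ _)) w hw
          refine h1.trans ?_
          refine mul_le_mul_of_nonneg_left ?_ (by positivity)
          have h2 : s ^ (1 - σ - η + ε) ≤ s ^ (δ + ε) :=
            Real.rpow_le_rpow_of_exponent_ge hs hs1 (by linarith)
          have h3 : s ^ (δ + ε) = s ^ δ * s ^ ε := Real.rpow_add hs _ _
          calc _ ≤ (C * s ^ δ * M ^ k) * s ^ ε + CR * M ^ k * s ^ (δ + ε) := by
                gcongr
                exact hclass i
            _ = _ := by rw [h3]; ring)
      have h2 : ∑ α ∈ words W m, ∑ q ∈ Ω i, D α q = ∑ α ∈ words W m, ∑ q ∈ Ω i, ∑ q' ∈ Ω i,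
          fejer (R * (V α q - V α q')) := by
        refine Finset.sum_congr rfl fun α _ => Finset.sum_congr rfl fun q hq => ?_
        have : j q.1 = i := (Finset.mem_filter.1 (Finset.mem_sigma.1 hq).1).2
        simp only [hD, this]
      rw [h2]
      refine h1.trans ?_
      rw [hcardl]
      have h3 : s ^ (η / 8) * (C * s ^ δ * M ^ k) * (C * s ^ (δ * (1 - η / 8)) * M ^ l)
          + (C + CR) * M ^ k * s ^ (δ + ε) * (C * s ^ δ * M ^ l)
          ≤ (C * C + (C + CR) * C) * (s ^ (2 * δ + 4 * g) * (M ^ k * M ^ l)) := by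
        have h4 : s ^ (η / 8) * s ^ δ * s ^ (δ * (1 - η / 8)) ≤ s ^ (2 * δ + 4 * g) := by
          rw [← Real.rpow_add hs, ← Real.rpow_add hs]
          refine Real.rpow_le_rpow_of_exponent_ge hs hs1 ?_
          have : 4 * g ≤ η ^ 2 / 8 := by
            rw [hg]; linarith [min_le_right ε (η ^ 2 / 8)]
          nlinarith
        have h5 : s ^ (δ + ε) * s ^ δ ≤ s ^ (2 * δ + 4 * g) := by
          rw [← Real.rpow_add hs]
          refine Real.rpow_le_rpow_of_exponent_ge hs hs1 ?_
          have : 4 * g ≤ ε := by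
            rw [hg]; linarith [min_le_left ε (η ^ 2 / 8)]
          linarith
        calc _ = C * C * (s ^ (η / 8) * s ^ δ * s ^ (δ * (1 - η / 8))) * (M ^ k * M ^ l)
              + (C + CR) * C * (s ^ (δ + ε) * s ^ δ) * (M ^ k * M ^ l) := by ring
          _ ≤ C * C * s ^ (2 * δ + 4 * g) * (M ^ k * M ^ l)
              + (C + CR) * C * s ^ (2 * δ + 4 * g) * (M ^ k * M ^ l) := by gcongr
          _ = _ := by ring
      calc _ ≤ M ^ m * (4 * sieveConst * (Ω i).card *
            ((C * C + (C + CR) * C) * (s ^ (2 * δ + 4 * g) * (M ^ k * M ^ l)))) := by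
            gcongr
        _ = _ := by rw [hC₂]; ring
    have hsplit : ∀ f : (Σ _ : List W, List W) → ℝ,
        ∑ w ∈ T₁, ∑ t ∈ T w, f ⟨w, t⟩ = ∑ i ∈ T₁.image j, ∑ q ∈ Ω i, f q := by
      intro f
      rw [← Finset.sum_fiberwise_of_maps_to (fun w hw => Finset.mem_image_of_mem j hw)]
      refine Finset.sum_congr rfl fun i _ => ?_
      rw [hΩ, Finset.sum_sigma]
    have h1 : (∑ α ∈ words W m, ∑ w ∈ words W k, (((words W l).filter fun t =>
          E₁ w ∧ E₂ w t ∧ ¬ D α ⟨w, t⟩ ≤ thr).card : ℝ)) * thr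
        ≤ ∑ α ∈ words W m, ∑ w ∈ T₁, ∑ t ∈ T w, D α ⟨w, t⟩ := by
      rw [Finset.sum_mul]
      refine Finset.sum_le_sum fun α _ => ?_
      rw [Finset.sum_mul, hT₁, Finset.sum_filter]
      refine Finset.sum_le_sum fun w _ => ?_
      split_ifs with h
      · simp only [h, true_and]
        rw [← Finset.filter_filter, ← nsmul_eq_mul]
        refine (Finset.card_nsmul_le_sum _ (fun t => D α ⟨w, t⟩) _ fun t ht => ?_).trans ?_
        · exact (not_le.1 (Finset.mem_filter.1 ht).2).le
        · exact Finset.sum_le_sum_of_subset_of_nonneg (Finset.filter_subset _ _)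
            fun _ _ _ => hD0 _ _
      · simp [h]
    have h2 : ∑ α ∈ words W m, ∑ w ∈ T₁, ∑ t ∈ T w, D α ⟨w, t⟩
        ≤ M ^ m * (C₂ * s ^ (2 * δ + 4 * g) * (M ^ k * M ^ l)) * (M ^ k * M ^ l) := by
      have h3 : ∑ α ∈ words W m, ∑ w ∈ T₁, ∑ t ∈ T w, D α ⟨w, t⟩
          = ∑ i ∈ T₁.image j, ∑ α ∈ words W m, ∑ q ∈ Ω i, D α q :=
        (Finset.sum_congr rfl fun α _ => hsplit (D α)).trans Finset.sum_comm
      rw [h3]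
      refine (Finset.sum_le_sum fun i _ => hmain i).trans ?_
      rw [← Finset.mul_sum]
      refine mul_le_mul_of_nonneg_left ?_ (by positivity)
      have h4 := hsplit fun _ => (1:ℝ)
      simp only [Finset.sum_const, nsmul_eq_mul, mul_one] at h4
      rw [← h4]
      calc ∑ w ∈ T₁, ((T w).card : ℝ) ≤ ∑ w ∈ T₁, M ^ l := by
            refine Finset.sum_le_sum fun w _ => ?_
            rw [← hcardl]
            exact_mod_cast Finset.card_le_card (Finset.filter_subset _ _)
        _ = T₁.card * M ^ l := by simp
        _ ≤ _ := by
            rw [← hcardl k]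
            gcongr
            exact Finset.filter_subset _ _
    have h3 : s ^ (2 * δ + 4 * g) = s ^ (2 * g) * s ^ (2 * (δ + g)) := by
      rw [← Real.rpow_add hs]; ring_nf
    have h4 := h1.trans h2
    have h5 : M ^ m * (C₂ * s ^ (2 * δ + 4 * g) * (M ^ k * M ^ l)) * (M ^ k * M ^ l)
        = (C₂ * s ^ (2 * g) * (M ^ m * (M ^ k * M ^ l))) * thr := by
      rw [h3, hthr]; ring
    rw [h5] at h4
    refine (le_of_mul_le_mul_right h4 hthr0).trans ?_
    gcongr
    linarith
  · intro α hα y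
    set Q : Finset (Σ _ : List W, List W) := T₁.sigma fun w => (T w).filter fun t =>
      D α ⟨w, t⟩ ≤ thr ∧ |S.X (S.th 0 (α ++ p)) (w ++ t) - y| ≤ s ^ 2 with hQ
    have hcard : (∑ w ∈ words W k, (((words W l).filter fun t =>
          (E₁ w ∧ E₂ w t ∧ D α ⟨w, t⟩ ≤ thr) ∧
            |S.X (S.th 0 (α ++ p)) (w ++ t) - y| ≤ s ^ 2).card : ℝ)) = Q.card := by
      rw [hQ, Finset.card_sigma, Nat.cast_sum, hT₁, Finset.sum_filter]
      refine Finset.sum_congr rfl fun w _ => ?_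
      split_ifs with h
      · simp only [h, true_and, hT, Finset.filter_filter, and_assoc]
      · simp [h]
    have hmemQ : ∀ q ∈ Q, q.1 ∈ T₁ ∧ q.2 ∈ T q.1 ∧ D α q ≤ thr ∧
        |S.X (S.th 0 (α ++ p)) (q.1 ++ q.2) - y| ≤ s ^ 2 := by
      rintro ⟨w, t⟩ hq
      have h1 := Finset.mem_sigma.1 hq
      have h2 := Finset.mem_filter.1 h1.2
      exact ⟨h1.1, h2.1, h2.2.1, h2.2.2⟩
    have hlen : ∀ q ∈ Q, q.1.length = k := fun q hq =>
      mem_words.1 (Finset.mem_filter.1 (hmemQ q hq).1).1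
    have hΛΓ : S.Λ ^ k * S.Γ ^ (J + 2) ≤ s ^ 2 := by
      rw [sq]; gcongr
    have herr : ∀ q ∈ Q, |V α q - y| ≤ K * s ^ 2 / 2 := by
      intro q hq
      have h1 := S.abs_X_append_sub_le α p q.1 q.2
      rw [hlen q hq, hp] at h1
      have h2 := (hmemQ q hq).2.2.2
      have h3 := mul_le_mul_of_nonneg_left hΛΓ hθB
      have h4 := h1.trans h3
      simp only [hV, hK]
      rw [abs_le] at *
      constructor <;> linarith
    have hcell : ∀ i ∈ Q.image (fun q => j q.1),
        ((Q.filter fun q => j q.1 = i).card : ℝ) ≤ 4 * thr := by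
      intro i hi
      obtain ⟨q₀, hq₀, rfl⟩ := Finset.mem_image.1 hi
      have h1 := (hmemQ q₀ hq₀).2.2.1
      have h2 : ∑ q ∈ Q.filter (fun q => j q.1 = j q₀.1), (1 / 4 : ℝ) ≤ D α q₀ := by
        refine le_trans (Finset.sum_le_sum (g := fun q => fejer (R * (V α q₀ - V α q)))
          fun q hq => fejer_ge ?_) ?_
        · have h3 := herr q₀ hq₀
          have h4 := herr q (Finset.mem_filter.1 hq).1
          rw [abs_mul, abs_of_pos hR0, hR, one_div, inv_mul_le_iff₀ (by positivity)]
          rw [abs_le] at *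
          constructor <;> linarith
        · refine Finset.sum_le_sum_of_subset_of_nonneg (fun q hq => ?_)
            fun _ _ _ => fejer_nonneg _
          obtain ⟨h3, h4⟩ := Finset.mem_filter.1 hq
          exact Finset.mem_sigma.2 ⟨Finset.mem_filter.2 ⟨(hmemQ q h3).1, h4⟩, (hmemQ q h3).2.1⟩
      rw [Finset.sum_const, nsmul_eq_mul] at h2
      linarith
    have hcells : ((Q.image fun q => j q.1).card : ℝ) ≤ C₅ := by
      have := card_int_le (Q.image fun q => j q.1) (c := y / s - 1 / 2)
        (r := (1 + S.thBound + S.XBound) + 1 / 2) (by positivity) ?_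
      · rw [hC₅]; linarith
      intro i hi
      obtain ⟨q, hq, rfl⟩ := Finset.mem_image.1 hi
      have h1 := Int.floor_le (S.X (S.th 0 p) q.1 / s)
      have h2 := Int.lt_floor_add_one (S.X (S.th 0 p) q.1 / s)
      have h3 : |S.X (S.th 0 p) q.1 / s - y / s| ≤ 1 + S.thBound + S.XBound := by
        rw [← sub_div, abs_div, abs_of_pos hs, div_le_iff₀ hs]
        have h4 := (hmemQ q hq).2.2.2
        have h5 : S.th 0 (α ++ p) = S.th 0 p + S.Γ ^ (J + 2) * S.th 0 α := by
          rw [th_zero_append, hp]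
        rw [X_append, hlen q hq, h5, X_add, ← h5, ← th_append] at h4
        have h6 : |S.Γ ^ (J + 2) * S.th 0 α * S.A q.1| ≤ s * S.thBound := by
          rw [abs_mul, abs_mul, abs_of_pos (by positivity : 0 < S.Γ ^ (J + 2)),
            abs_of_nonneg (S.A_nonneg _)]
          have := S.abs_th_zero_le α
          have := (S.A_lt_one q.1).le
          have := S.A_nonneg q.1
          calc _ ≤ s * S.thBound * 1 := by gcongr
            _ = _ := mul_one _
        have h7 : |S.Λ ^ k * S.X (S.th 0 (α ++ p ++ q.1)) q.2| ≤ s * S.XBound := by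
          rw [abs_mul, abs_of_pos (by positivity : 0 < S.Λ ^ k)]
          have := S.abs_X_le q.2 _ (S.abs_th_zero_le (α ++ p ++ q.1))
          gcongr
        have h8 : s ^ 2 ≤ s := by nlinarith
        rw [abs_le] at *
        constructor <;> nlinarith
      simp only [hj]
      rw [abs_le] at *
      constructor <;> linarith
    rw [hcard, Finset.card_eq_sum_card_image (fun q => j q.1) Q, Nat.cast_sum]
    refine (Finset.sum_le_card_nsmul _ _ _ hcell).trans ?_
    rw [nsmul_eq_mul]
    calc _ ≤ C₅ * (4 * thr) := by gcongr
      _ = 4 * C₅ * thr := by ring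
      _ ≤ (C₂ + 4 * C₅) * thr := by gcongr; linarith
      _ = _ := by rw [hthr]; ring

end AffSys

theorem mem_filter_iff {α : Type*} {p : α → Prop} {_ : DecidablePred p} {s : Finset α} {a : α} :
    a ∈ s.filter p ↔ a ∈ s ∧ p a := Finset.mem_filter

section Words

variable {W : Type} [Fintype W]

theorem card_filter_words_add (k l : ℕ) (P : List W → Prop) {_ : DecidablePred P} :
    ((((words W (k + l)).filter P).card : ℕ) : ℝ)
      = ∑ w ∈ words W k, (((words W l).filter fun t => P (w ++ t)).card : ℝ) := by
  simp only [Finset.card_filter, Nat.cast_sum]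
  rw [sum_words_add]

theorem card_filter_words_le (k : ℕ) (P : List W → Prop) {_ : DecidablePred P} :
    ((((words W k).filter P).card : ℕ) : ℝ) ≤ (Fintype.card W : ℝ) ^ k := by
  have h := Finset.card_le_card (Finset.filter_subset P (words W k))
  rw [card_words] at h
  exact_mod_cast h

end Words

namespace AffSys

variable {W : Type} [Fintype W] (S : AffSys W)

open Classical in
/-- The projected words are spread with exponent `δ`, up to a small exceptional set. -/
def Spread (δ : ℝ) : Prop :=
  ∃ C > 0, ∃ c > (0 : ℝ), ∀ r : ℝ, 0 < r → r ≤ 1 → ∀ m l : ℕ, S.Γ ^ m ≤ r → S.Λ ^ l ≤ r →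
    ∃ E : List W → List W → Prop,
      (∑ p ∈ words W m, (((words W l).filter fun w => ¬ E p w).card : ℝ)
        ≤ C * r ^ c * ((Fintype.card W : ℝ) ^ m * (Fintype.card W : ℝ) ^ l)) ∧
      ∀ p ∈ words W m, ∀ y, (((words W l).filter fun w => E p w ∧
        |S.X (S.th 0 p) w - y| ≤ r).card : ℝ) ≤ C * r ^ δ * (Fintype.card W : ℝ) ^ l

theorem spread_zero : S.Spread 0 := by
  refine ⟨1, one_pos, 1, one_pos, fun r hr _ m l _ _ => ⟨fun _ _ => True, ?_, ?_⟩⟩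
  · simp only [not_true_eq_false, Finset.filter_false, Finset.card_empty, Nat.cast_zero,
      Finset.sum_const_zero]
    positivity
  · intro p _ y
    rw [Real.rpow_zero, one_mul, one_mul]
    exact card_filter_words_le _ _

theorem Spread.mono {δ δ' : ℝ} (h : S.Spread δ) (hδ : δ' ≤ δ) : S.Spread δ' := by
  obtain ⟨C, hC, c, hc, h⟩ := h
  refine ⟨C, hC, c, hc, fun r hr hr1 m l hm hl => ?_⟩
  obtain ⟨E, h1, h2⟩ := h r hr hr1 m l hm hl
  refine ⟨E, h1, fun p hp y => (h2 p hp y).trans ?_⟩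
  have := Real.rpow_le_rpow_of_exponent_ge hr hr1 hδ
  gcongr

open Classical in
theorem bad_sum_le {m j k l : ℕ} (E₁ Ea Eb : List W → List W → Prop)
    (F : List W → List W → List W → List W → Prop) (E : List W → List W → Prop)
    {b₁ ba bb b₀ : ℝ}
    (hE : ∀ α ∈ words W m, ∀ p ∈ words W j, ∀ w ∈ words W k, ∀ t ∈ words W l, E₁ p w →
      Ea (p ++ w) t → Eb (p ++ w) t → F p α w t → E (α ++ p) (w ++ t))
    (h₁ : ∑ p ∈ words W j, (((words W k).filter fun w => ¬ E₁ p w).card : ℝ)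
      ≤ b₁ * ((Fintype.card W : ℝ) ^ j * (Fintype.card W : ℝ) ^ k))
    (ha : ∑ p ∈ words W (j + k), (((words W l).filter fun w => ¬ Ea p w).card : ℝ)
      ≤ ba * ((Fintype.card W : ℝ) ^ (j + k) * (Fintype.card W : ℝ) ^ l))
    (hb : ∑ p ∈ words W (j + k), (((words W l).filter fun w => ¬ Eb p w).card : ℝ)
      ≤ bb * ((Fintype.card W : ℝ) ^ (j + k) * (Fintype.card W : ℝ) ^ l))
    (h₀ : ∀ p ∈ words W j, ∑ α ∈ words W m, ∑ w ∈ words W k, (((words W l).filter fun t =>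
      E₁ p w ∧ (Ea (p ++ w) t ∧ Eb (p ++ w) t) ∧ ¬ F p α w t).card : ℝ) ≤ b₀ *
        ((Fintype.card W : ℝ) ^ m * ((Fintype.card W : ℝ) ^ k * (Fintype.card W : ℝ) ^ l))) :
    ∑ p ∈ words W (m + j), (((words W (k + l)).filter fun w => ¬ E p w).card : ℝ)
      ≤ (b₁ + ba + bb + b₀) *
        ((Fintype.card W : ℝ) ^ (m + j) * (Fintype.card W : ℝ) ^ (k + l)) := by
  have hc : ∀ n, ((words W n).card : ℝ) = (Fintype.card W : ℝ) ^ n := fun n => by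
    rw [card_words]; push_cast; rfl
  set M : ℝ := ((Fintype.card W : ℕ) : ℝ) with hM
  have hM0 : 0 ≤ M := Nat.cast_nonneg _
  rw [sum_words_add]
  simp only [card_filter_words_add]
  have hpt : ∀ α ∈ words W m, ∀ p ∈ words W j, ∀ w ∈ words W k,
      (((words W l).filter fun t => ¬ E (α ++ p) (w ++ t)).card : ℝ)
      ≤ (if ¬ E₁ p w then M ^ l else 0)
        + (((words W l).filter fun t => ¬ Ea (p ++ w) t).card : ℝ)
        + (((words W l).filter fun t => ¬ Eb (p ++ w) t).card : ℝ)
        + (((words W l).filter fun t =>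
          E₁ p w ∧ (Ea (p ++ w) t ∧ Eb (p ++ w) t) ∧ ¬ F p α w t).card : ℝ) := by
    intro α hα p hp w hw
    by_cases h1 : E₁ p w
    · rw [if_neg (not_not.2 h1), zero_add]
      have : ((words W l).filter fun t => ¬ E (α ++ p) (w ++ t)) ⊆
          ((words W l).filter fun t => ¬ Ea (p ++ w) t) ∪
          ((words W l).filter fun t => ¬ Eb (p ++ w) t) ∪
          ((words W l).filter fun t =>
            E₁ p w ∧ (Ea (p ++ w) t ∧ Eb (p ++ w) t) ∧ ¬ F p α w t) := by
        intro t ht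
        obtain ⟨ht, hnE⟩ := mem_filter_iff.1 ht
        have := hE α hα p hp w hw t ht h1
        simp only [Finset.mem_union, mem_filter_iff, ht, h1, true_and]
        tauto
      have h2 := (Finset.card_le_card this).trans
        ((Finset.card_union_le _ _).trans (Nat.add_le_add_right (Finset.card_union_le _ _) _))
      exact_mod_cast h2
    · rw [if_pos h1]
      refine (card_filter_words_le l _).trans ?_
      have h4 : ∀ s : Finset (List W), (0:ℝ) ≤ s.card := fun s => Nat.cast_nonneg _
      linarith [h4 ((words W l).filter fun t => ¬ Ea (p ++ w) t),
        h4 ((words W l).filter fun t => ¬ Eb (p ++ w) t), h4 ((words W l).filter fun t =>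
          E₁ p w ∧ (Ea (p ++ w) t ∧ Eb (p ++ w) t) ∧ ¬ F p α w t)]
  refine (Finset.sum_le_sum fun α hα => Finset.sum_le_sum fun p hp => Finset.sum_le_sum
    fun w hw => hpt α hα p hp w hw).trans ?_
  simp only [Finset.sum_add_distrib]
  have e1 : ∑ α ∈ words W m, ∑ p ∈ words W j, ∑ w ∈ words W k, (if ¬ E₁ p w then M ^ l else 0)
      ≤ b₁ * (M ^ (m + j) * M ^ (k + l)) := by
    simp only [← Finset.sum_filter, Finset.sum_const, nsmul_eq_mul]
    rw [← Finset.sum_mul, hc]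
    calc _ ≤ M ^ m * ((b₁ * (M ^ j * M ^ k)) * M ^ l) := by gcongr
      _ = _ := by ring
  have e2 : ∀ (G : List W → List W → Prop) (b : ℝ), (∑ p ∈ words W (j + k),
      (((words W l).filter fun w => ¬ G p w).card : ℝ) ≤ b * (M ^ (j + k) * M ^ l)) →
      ∑ α ∈ words W m, ∑ p ∈ words W j, ∑ w ∈ words W k,
      (((words W l).filter fun t => ¬ G (p ++ w) t).card : ℝ)
      ≤ b * (M ^ (m + j) * M ^ (k + l)) := by
    intro G b h
    rw [sum_words_add] at h
    rw [Finset.sum_const, nsmul_eq_mul, hc]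
    calc _ ≤ M ^ m * (b * (M ^ (j + k) * M ^ l)) := by gcongr
      _ = _ := by ring
  have e3 : ∑ α ∈ words W m, ∑ p ∈ words W j, ∑ w ∈ words W k, (((words W l).filter fun t =>
      E₁ p w ∧ (Ea (p ++ w) t ∧ Eb (p ++ w) t) ∧ ¬ F p α w t).card : ℝ)
      ≤ b₀ * (M ^ (m + j) * M ^ (k + l)) := by
    rw [Finset.sum_comm]
    refine (Finset.sum_le_card_nsmul _ _ _ h₀).trans (le_of_eq ?_)
    rw [nsmul_eq_mul, hc]
    ring
  have := e2 Ea ba ha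
  have := e2 Eb bb hb
  linarith

open Classical in
set_option maxHeartbeats 1000000 in
theorem exists_spread_add {σ η : ℝ} (hσ : 0 ≤ σ) (hση : σ + η < 1) (hη : 0 < η)
    (hM : 1 ≤ (Fintype.card W : ℕ) * S.ρ * S.Λ ^ (-σ)) :
    ∃ g > 0, ∀ δ, 0 ≤ δ → δ ≤ 1 - σ - η → S.Spread δ → S.Spread (δ + g) := by
  obtain ⟨g, hg, hcore⟩ := S.exists_flatten_core hσ hση hη hM
  refine ⟨g, hg, ?_⟩
  rintro δ hδ hδ1 ⟨C₀, hC₀, c₀, hc₀, hsp⟩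
  have hΓ := S.Γ_pos
  have hΓ1 := S.Γ_lt
  have hΛ := S.Λ_pos
  have hΛ1 := S.Λ_lt
  have hθB := S.thBound_nonneg
  have hM2 := S.two_le_card
  set K : ℝ := 2 + 2 * S.thBound with hK
  have hK1 : 1 ≤ K := by linarith
  set H : ℝ := K / S.Λ with hH
  have hH1 : 1 ≤ H := by rw [hH, one_le_div hΛ]; linarith
  have hH0 : 0 < H := by linarith
  obtain ⟨C', hC', hcore⟩ := hcore (C₀ * H) (by positivity)
  set M : ℝ := ((Fintype.card W : ℕ) : ℝ) with hMdef
  have hM0 : 0 < M := by linarith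
  set s₀ : ℝ := min (S.Γ / 2) ((1 / H) ^ 2) with hs₀
  have hs₀0 : 0 < s₀ := by positivity
  have hs₀Γ : s₀ < S.Γ := (min_le_left _ _).trans_lt (by linarith)
  refine ⟨C₀ + C₀ * H ^ c₀ + C₀ * H ^ c₀ + C' + (s₀ ^ 2) ^ (-(δ + g)), by positivity,
    min (c₀ / 4) g, by positivity, fun r hr hr1 m l hm hl => ?_⟩
  rcases lt_or_ge (s₀ ^ 2) r with hrs | hrs
  · refine ⟨fun _ _ => True, ?_, fun p _ y => ?_⟩
    · simp only [not_true_eq_false, Finset.filter_false, Finset.card_empty, Nat.cast_zero,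
        Finset.sum_const_zero]
      positivity
    · refine (card_filter_words_le _ _).trans ?_
      refine le_mul_of_one_le_left (by positivity) ?_
      calc (1:ℝ) = (s₀ ^ 2) ^ (-(δ + g)) * (s₀ ^ 2) ^ (δ + g) := by
            rw [← Real.rpow_add (by positivity)]; simp
        _ ≤ (s₀ ^ 2) ^ (-(δ + g)) * r ^ (δ + g) := by gcongr
        _ ≤ _ := by
            gcongr
            have : 0 ≤ C₀ + C₀ * H ^ c₀ + C₀ * H ^ c₀ + C' := by positivity
            linarith
  · set s : ℝ := √r with hs
    have hs0 : 0 < s := Real.sqrt_pos.2 hr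
    have hs2 : s ^ 2 = r := Real.sq_sqrt hr.le
    have hss₀ : s ≤ s₀ := by
      rw [← hs2] at hrs
      exact le_of_sq_le_sq hrs hs₀0.le
    have hsΓ : s < S.Γ := hss₀.trans_lt hs₀Γ
    have hs1 : s ≤ 1 := by linarith
    have hpow : ∀ x : ℝ, s ^ (2 * x) = r ^ x := fun x => by
      rw [Real.rpow_mul hs0.le, ← hs2]; norm_num
    have hexΓ : ∃ n, S.Γ ^ n ≤ s := by
      obtain ⟨n, hn⟩ := exists_pow_lt_of_lt_one hs0 hΓ1
      exact ⟨n, hn.le⟩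
    obtain ⟨n, hn, hnmin⟩ : ∃ n, S.Γ ^ n ≤ s ∧ ∀ n', S.Γ ^ n' ≤ s → n ≤ n' :=
      ⟨Nat.find hexΓ, Nat.find_spec hexΓ, fun n' h => Nat.find_min' hexΓ h⟩
    have hn2 : 2 ≤ n := by
      by_contra h
      have : S.Γ ^ 1 ≤ S.Γ ^ n := pow_le_pow_of_le_one hΓ.le hΓ1.le (by omega)
      rw [pow_one] at this
      linarith
    obtain ⟨J, rfl⟩ : ∃ J, n = J + 2 := ⟨n - 2, by omega⟩
    have hJ2 : s < S.Γ ^ (J + 1) := by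
      by_contra h
      have := hnmin (J + 1) (not_lt.1 h)
      omega
    have hexΛ : ∃ n, S.Λ ^ n ≤ s := by
      obtain ⟨n, hn⟩ := exists_pow_lt_of_lt_one hs0 hΛ1
      exact ⟨n, hn.le⟩
    obtain ⟨k, hk, hkmin⟩ : ∃ n, S.Λ ^ n ≤ s ∧ ∀ n', S.Λ ^ n' ≤ s → n ≤ n' :=
      ⟨Nat.find hexΛ, Nat.find_spec hexΛ, fun n' h => Nat.find_min' hexΛ h⟩
    have hk2 : S.Λ * s ≤ S.Λ ^ k := by
      rcases Nat.eq_zero_or_pos k with rfl | hk0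
      · rw [pow_zero]; nlinarith
      · obtain ⟨k', rfl⟩ : ∃ k', k = k' + 1 := ⟨k - 1, by omega⟩
        rw [pow_succ']
        have : ¬ S.Λ ^ k' ≤ s := fun h => by have := hkmin k' h; omega
        exact mul_le_mul_of_nonneg_left (not_le.1 this).le hΛ.le
    have hkl : k ≤ l := hkmin l (by rw [← hs2] at hl; nlinarith)
    obtain ⟨l, rfl⟩ : ∃ l', l = k + l' := ⟨l - k, by omega⟩
    have hmJ : 2 * J + 3 ≤ m := by
      by_contra h
      have h1 : S.Γ ^ ((J + 1) + (J + 1)) ≤ S.Γ ^ m :=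
        pow_le_pow_of_le_one hΓ.le hΓ1.le (by omega)
      rw [pow_add] at h1
      rw [← hs2] at hm
      nlinarith
    obtain ⟨m, rfl⟩ : ∃ m', m = m' + (J + 2) := ⟨m - (J + 2), by omega⟩
    have hl1 : S.Λ ^ l ≤ s / S.Λ := by
      rw [pow_add, ← hs2] at hl
      rw [le_div_iff₀ hΛ]
      have h1 : S.Λ * s * S.Λ ^ l ≤ s * s := by
        calc _ ≤ S.Λ ^ k * S.Λ ^ l := by gcongr
          _ ≤ _ := by rw [← sq]; exact hl
      have h2 : (S.Λ ^ l * S.Λ) * s ≤ s * s := by linarith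
      exact le_of_mul_le_mul_right h2 hs0
    have hη8 : s ≤ s ^ (1 - η / 8) := by
      conv_lhs => rw [← Real.rpow_one s]
      exact Real.rpow_le_rpow_of_exponent_ge hs0 hs1 (by linarith)
    have hη2 : s ^ (1 - η / 8) ≤ s ^ (1 / 2 : ℝ) :=
      Real.rpow_le_rpow_of_exponent_ge hs0 hs1 (by linarith)
    have hsH : s ^ (1 / 2 : ℝ) ≤ 1 / H := by
      rw [← Real.sqrt_eq_rpow]
      exact Real.sqrt_le_iff.2 ⟨by positivity, hss₀.trans (min_le_right _ _)⟩
    set ra : ℝ := K * s / S.Λ with hra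
    set rb : ℝ := K * s ^ (1 - η / 8) / S.Λ with hrb
    have hra' : ra = H * s := by rw [hra, hH]; ring
    have hrb' : rb = H * s ^ (1 - η / 8) := by rw [hrb, hH]; ring
    have hrab : ra ≤ rb := by rw [hra', hrb']; gcongr
    have hrb1 : rb ≤ 1 := by
      rw [hrb']
      calc _ ≤ H * (1 / H) := by gcongr; exact hη2.trans hsH
        _ = 1 := by field_simp
    have hsra : s ≤ ra := by rw [hra']; nlinarith
    have hra0 : 0 < ra := by positivity
    have hlra : S.Λ ^ l ≤ ra := by
      refine hl1.trans ?_
      rw [hra]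
      gcongr
      nlinarith
    have hΓra : S.Γ ^ (J + 2 + k) ≤ ra := by
      refine le_trans ?_ (hn.trans hsra)
      exact pow_le_pow_of_le_one hΓ.le hΓ1.le (by omega)
    obtain ⟨E₁, hE₁, hw₁⟩ := hsp s hs0 hs1 (J + 2) k hn hk
    obtain ⟨Ea, hEa, hwa⟩ := hsp ra hra0 (hrab.trans hrb1) (J + 2 + k) l hΓra hlra
    obtain ⟨Eb, hEb, hwb⟩ := hsp rb (hra0.trans_le hrab) hrb1 (J + 2 + k) l
      (hΓra.trans hrab) (hlra.trans hrab)
    have hHδ : H ^ δ ≤ H := by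
      conv_rhs => rw [← Real.rpow_one H]
      exact Real.rpow_le_rpow_of_exponent_le hH1 (by linarith)
    have hF : ∀ p, p ∈ words W (J + 2) → ∃ F : List W → List W → List W → Prop, _ :=
      fun p hp => hcore δ s J m k l p (E₁ p) (fun w t => Ea (p ++ w) t ∧ Eb (p ++ w) t)
        hδ hδ1 hs0 hs1 hn hJ2 (by omega) hk hk2 (mem_words.1 hp)
        (fun y => (hw₁ p hp y).trans (by
          gcongr
          exact le_mul_of_one_le_right hC₀.le hH1))
        (fun w hw y => by
          have hpw : p ++ w ∈ words W (J + 2 + k) := by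
            rw [mem_words, List.length_append, mem_words.1 hp, mem_words.1 hw]
          refine le_trans (Nat.cast_le.2 (Finset.card_le_card fun t ht => ?_))
            ((hwa (p ++ w) hpw y).trans ?_)
          · obtain ⟨ht0, h1, h2⟩ := mem_filter_iff.1 ht
            exact mem_filter_iff.2 ⟨ht0, h1.1, h2⟩
          · rw [hra', Real.mul_rpow hH0.le hs0.le, ← mul_assoc]
            gcongr)
        (fun w hw y => by
          have hpw : p ++ w ∈ words W (J + 2 + k) := by
            rw [mem_words, List.length_append, mem_words.1 hp, mem_words.1 hw]
          refine le_trans (Nat.cast_le.2 (Finset.card_le_card fun t ht => ?_))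
            ((hwb (p ++ w) hpw y).trans ?_)
          · obtain ⟨ht0, h1, h2⟩ := mem_filter_iff.1 ht
            exact mem_filter_iff.2 ⟨ht0, h1.2, h2⟩
          · rw [hrb', Real.mul_rpow hH0.le (by positivity), ← mul_assoc, ← Real.rpow_mul hs0.le,
              mul_comm (1 - η / 8) δ]
            gcongr)
    choose! F hF using hF
    refine ⟨fun q u => E₁ (q.drop m) (u.take k) ∧
      Ea (q.drop m ++ u.take k) (u.drop k) ∧ Eb (q.drop m ++ u.take k) (u.drop k) ∧
      F (q.drop m) (q.take m) (u.take k) (u.drop k), ?_, ?_⟩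
    · refine (bad_sum_le (b₀ := C' * s ^ (2 * g)) E₁ Ea Eb F _ ?_ hE₁ hEa hEb
        fun p hp => ?_).trans ?_
      · intro α hα p hp w hw t ht h1 h2 h3 h4
        have hαl := mem_words.1 hα
        have hwl := mem_words.1 hw
        subst hαl hwl
        simp only [List.drop_left, List.take_left]
        exact ⟨h1, h2, h3, h4⟩
      · convert (hF p hp).1
      · gcongr
        have hmin1 : min (c₀ / 4) g ≤ c₀ / 4 := min_le_left _ _
        have b1 : s ^ c₀ ≤ r ^ (min (c₀ / 4) g) := by
          rw [← hpow (min (c₀ / 4) g)]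
          exact Real.rpow_le_rpow_of_exponent_ge hs0 hs1 (by linarith)
        have b3 : rb ^ c₀ ≤ H ^ c₀ * r ^ (min (c₀ / 4) g) := by
          rw [hrb', Real.mul_rpow hH0.le (by positivity), ← Real.rpow_mul hs0.le,
            ← hpow (min (c₀ / 4) g)]
          refine mul_le_mul_of_nonneg_left ?_ (by positivity)
          exact Real.rpow_le_rpow_of_exponent_ge hs0 hs1 (by nlinarith)
        have b2 : ra ^ c₀ ≤ H ^ c₀ * r ^ (min (c₀ / 4) g) :=
          (Real.rpow_le_rpow hra0.le hrab hc₀.le).trans b3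
        have b4 : s ^ (2 * g) ≤ r ^ (min (c₀ / 4) g) := by
          rw [← hpow (min (c₀ / 4) g)]
          exact Real.rpow_le_rpow_of_exponent_ge hs0 hs1 (by linarith [min_le_right (c₀ / 4) g])
        have b5 : 0 ≤ (s₀ ^ 2) ^ (-(δ + g)) * r ^ (min (c₀ / 4) g) := by positivity
        calc _ ≤ C₀ * r ^ (min (c₀ / 4) g) + C₀ * (H ^ c₀ * r ^ (min (c₀ / 4) g))
              + C₀ * (H ^ c₀ * r ^ (min (c₀ / 4) g)) + C' * r ^ (min (c₀ / 4) g) := by gcongr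
          _ ≤ _ := by linarith
    · intro q hq y
      obtain ⟨α, p, hα, hp, rfl⟩ : ∃ α p, α ∈ words W m ∧ p ∈ words W (J + 2) ∧ q = α ++ p := by
        refine ⟨q.take m, q.drop m, ?_, ?_, (List.take_append_drop m q).symm⟩
        · rw [mem_words] at hq ⊢; simp [hq]
        · rw [mem_words] at hq ⊢; simp [hq]
      have h1 := (hF p hp).2 α hα y
      rw [card_filter_words_add]
      refine le_trans (Finset.sum_le_sum fun w hw => ?_) (h1.trans ?_)
      · refine Nat.cast_le.2 (Finset.card_le_card fun t ht => ?_)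
        obtain ⟨ht0, h2, h3⟩ := mem_filter_iff.1 ht
        refine mem_filter_iff.2 ⟨ht0, ?_, by rw [hs2]; exact h3⟩
        have hαl := mem_words.1 hα
        have hwl := mem_words.1 hw
        clear_value s
        subst hαl
        rw [← hwl] at h2
        simp only [List.drop_left, List.take_left] at h2
        exact ⟨h2.1, ⟨h2.2.1, h2.2.2.1⟩, h2.2.2.2⟩
      · rw [hpow, ← pow_add]
        gcongr
        have : 0 ≤ C₀ + C₀ * H ^ c₀ + C₀ * H ^ c₀ + (s₀ ^ 2) ^ (-(δ + g)) := by positivity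
        linarith

theorem spread_of_lt {σ δ : ℝ} (hσ : 0 ≤ σ) (hδσ : δ < 1 - σ) (hσ1 : σ < 1)
    (hM : 1 ≤ (Fintype.card W : ℕ) * S.ρ * S.Λ ^ (-σ)) : S.Spread δ := by
  set η : ℝ := min ((1 - σ) / 2) (1 - σ - δ) with hη
  have hη0 : 0 < η := by
    rw [hη]; exact lt_min (by linarith) (by linarith)
  have hη1 : η ≤ (1 - σ) / 2 := min_le_left _ _
  have hη2 : η ≤ 1 - σ - δ := min_le_right _ _
  obtain ⟨g, hg, hstep⟩ := S.exists_spread_add hσ (by linarith : σ + η < 1) hη0 hM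
  have key : ∀ n : ℕ, S.Spread (min (n * g) (1 - σ - η)) := by
    intro n
    induction n with
    | zero =>
      rw [Nat.cast_zero, zero_mul, min_eq_left (by linarith)]
      exact S.spread_zero
    | succ n ih =>
      have := hstep _ (le_min (by positivity) (by linarith)) (min_le_right _ _) ih
      refine Spread.mono S this ?_
      rw [← min_add_add_right]
      push_cast
      refine min_le_min (by linarith) (by linarith)
  obtain ⟨n, hn⟩ := exists_nat_gt ((1 - σ - η) / g)
  have h1 := key n
  rw [div_lt_iff₀ hg] at hn
  rw [min_eq_right hn.le] at h1
  exact Spread.mono S h1 (by linarith)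

end AffSys

/-- The mass distribution principle. -/
theorem le_dimH_of_mass {E : Type*} [EMetricSpace E] (μ : OuterMeasure E) {s : Set E} {t C r₀ : ℝ}
    (ht : 0 < t) (hC : 0 < C) (hr₀ : 0 < r₀) (hs : μ s ≠ 0)
    (h : ∀ (U : Set E) (ε : ℝ), 0 < ε → ε ≤ r₀ → Metric.ediam U ≤ ENNReal.ofReal ε →
      μ U ≤ ENNReal.ofReal (C * ε ^ t)) : ENNReal.ofReal t ≤ dimH s := by
  let _ : MeasurableSpace E := borel E
  have : BorelSpace E := ⟨rfl⟩
  have hC0 : ENNReal.ofReal C ≠ 0 := (ENNReal.ofReal_pos.2 hC).ne'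
  have key : (ENNReal.ofReal C)⁻¹ • μ ≤ OuterMeasure.mkMetric (fun r : ENNReal => r ^ t) := by
    refine OuterMeasure.le_mkMetric _ _ (ENNReal.ofReal r₀) (ENNReal.ofReal_pos.2 hr₀)
      fun U hU => ?_
    rw [smul_apply, smul_eq_mul, ENNReal.inv_mul_le_iff hC0 ENNReal.ofReal_ne_top]
    rcases eq_or_ne (Metric.ediam U) 0 with h0 | h0
    · have h1 : Tendsto (fun ε : ℝ => ENNReal.ofReal (C * ε ^ t)) (nhdsWithin 0 (Ioi 0))
          (nhds (ENNReal.ofReal (C * 0 ^ t))) := by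
        refine (ENNReal.continuous_ofReal.tendsto _).comp (Tendsto.mono_left ?_ nhdsWithin_le_nhds)
        exact (((Real.continuous_rpow_const ht.le).const_mul C).tendsto 0)
      have h2 : μ U ≤ ENNReal.ofReal (C * 0 ^ t) := by
        refine ge_of_tendsto h1 ?_
        filter_upwards [Ioc_mem_nhdsGT hr₀] with ε hε
        exact h U ε hε.1 hε.2 (by rw [h0]; exact zero_le)
      rw [Real.zero_rpow ht.ne', mul_zero, ENNReal.ofReal_zero] at h2
      exact h2.trans zero_le
    · have htop : Metric.ediam U ≠ ⊤ := ne_top_of_le_ne_top ENNReal.ofReal_ne_top hU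
      have h1 := h U (Metric.ediam U).toReal (ENNReal.toReal_pos h0 htop)
        (ENNReal.toReal_le_of_le_ofReal hr₀.le hU) (by rw [ENNReal.ofReal_toReal htop])
      rwa [ENNReal.ofReal_mul hC.le, ← ENNReal.ofReal_rpow_of_nonneg ENNReal.toReal_nonneg ht.le,
        ENNReal.ofReal_toReal htop] at h1
  have h1 : Measure.hausdorffMeasure (Real.toNNReal t : ℝ) s ≠ 0 := by
    intro h0
    have h2 := key s
    rw [← Measure.mkMetric_toOuterMeasure] at h2
    have h3 : (Measure.mkMetric (fun r : ENNReal => r ^ t) : Measure E) s = 0 := by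
      rw [Real.coe_toNNReal t ht.le] at h0
      exact h0
    change _ ≤ (Measure.mkMetric (fun r : ENNReal => r ^ t) : Measure E) s at h2
    rw [h3, smul_apply, smul_eq_mul, nonpos_iff_eq_zero, mul_eq_zero] at h2
    rcases h2 with h2 | h2
    · exact ENNReal.ofReal_ne_top (ENNReal.inv_eq_zero.1 h2)
    · exact hs h2
  exact le_dimH_of_hausdorffMeasure_ne_zero h1

section Words

variable {W : Type}

/-- The initial word of a sequence. -/
def initWord : ℕ → (ℕ → W) → List W
  | 0, _ => []
  | n + 1, ω => ω 0 :: initWord n fun i => ω (i + 1)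

theorem length_initWord (n : ℕ) (ω : ℕ → W) : (initWord n ω).length = n := by
  induction n generalizing ω with
  | zero => rfl
  | succ n ih => simp [initWord, ih]

theorem initWord_add (n l : ℕ) (ω : ℕ → W) :
    initWord (n + l) ω = initWord n ω ++ initWord l fun i => ω (i + n) := by
  induction n generalizing ω with
  | zero => simp [initWord]
  | succ n ih =>
    rw [Nat.succ_add]
    simp only [initWord, ih, List.cons_append]
    rfl

theorem getElem?_initWord (n : ℕ) (ω : ℕ → W) (i : ℕ) (hi : i < n) :
    (initWord n ω)[i]? = some (ω i) := by
  induction n generalizing ω i with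
  | zero => omega
  | succ n ih =>
    cases i with
    | zero => simp [initWord]
    | succ i =>
      simp only [initWord, List.getElem?_cons_succ]
      exact ih _ i (by omega)

/-- The Bernoulli measure with equal weights. -/
def coinMeasure (W : Type) [Fintype W] [MeasurableSpace W] : Measure (ℕ → W) :=
  Measure.infinitePi fun _ => ProbabilityTheory.uniformOn univ

variable [Fintype W] [MeasurableSpace W] [MeasurableSingletonClass W] [Nonempty W]

theorem coinMeasure_univ : coinMeasure W univ = 1 := by
  have : IsProbabilityMeasure (ProbabilityTheory.uniformOn (univ : Set W)) :=
    ProbabilityTheory.isProbabilityMeasure_uniformOn finite_univ univ_nonempty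
  unfold coinMeasure
  exact measure_univ

theorem coinMeasure_cylinder_le (w : List W) :
    coinMeasure W {ω | initWord w.length ω = w}
      ≤ ENNReal.ofReal (((Fintype.card W : ℝ) ^ w.length)⁻¹) := by
  have : IsProbabilityMeasure (ProbabilityTheory.uniformOn (univ : Set W)) :=
    ProbabilityTheory.isProbabilityMeasure_uniformOn finite_univ univ_nonempty
  let v₀ : W := Classical.arbitrary W
  have hsub : {ω : ℕ → W | initWord w.length ω = w} ⊆
      (↑(Finset.range w.length) : Set ℕ).pi fun i => {(w[i]?).getD v₀} := by
    intro ω hω i hi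
    have h1 := getElem?_initWord w.length ω i (by simpa using hi)
    rw [hω] at h1
    simp [h1]
  refine (measure_mono hsub).trans ?_
  rw [coinMeasure, Measure.infinitePi_pi _ fun _ _ => measurableSet_singleton _]
  simp only [ProbabilityTheory.uniformOn_univ, Measure.count_singleton, Finset.prod_const,
    Finset.card_range]
  have hM : (0:ℝ) < Fintype.card W := by exact_mod_cast Fintype.card_pos
  rw [ENNReal.ofReal_inv_of_pos (by positivity), ENNReal.ofReal_pow hM.le, ENNReal.ofReal_natCast,
    one_div, ENNReal.inv_pow]

theorem coinMeasure_le (n : ℕ) (P : List W → Prop) {dP : DecidablePred P} :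
    coinMeasure W {ω | P (initWord n ω)}
      ≤ ENNReal.ofReal ((((words W n).filter P).card : ℝ) / (Fintype.card W : ℝ) ^ n) := by
  have hsub : {ω : ℕ → W | P (initWord n ω)} ⊆
      ⋃ w ∈ (words W n).filter P, {ω | initWord w.length ω = w} := by
    intro ω hω
    rw [mem_iUnion₂]
    exact ⟨initWord n ω, Finset.mem_filter.2 ⟨mem_words.2 (length_initWord n ω), hω⟩,
      by rw [mem_ofPred_eq, length_initWord]⟩
  refine (measure_mono hsub).trans ((measure_biUnion_finset_le _ _).trans ?_)
  calc _ ≤ ∑ w ∈ (words W n).filter P, ENNReal.ofReal (((Fintype.card W : ℝ) ^ n)⁻¹) := by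
        refine Finset.sum_le_sum fun w hw => ?_
        have := coinMeasure_cylinder_le w
        rwa [mem_words.1 (Finset.mem_filter.1 hw).1] at this ⊢
    _ = _ := by
        rw [Finset.sum_const, nsmul_eq_mul, div_eq_mul_inv, ENNReal.ofReal_mul (by positivity),
          ENNReal.ofReal_natCast]

end Words

namespace AffSys

variable {W : Type} (S : AffSys W)

/-- The base point coded by a sequence. -/
def pt (ω : ℕ → W) : ℝ := ∑' j, S.ρ ^ j * S.a (ω j)

theorem summable_pt (ω : ℕ → W) : Summable fun j => S.ρ ^ j * S.a (ω j) := by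
  have hρ := S.ρ_pos
  have hρ1 : S.ρ < 1 := S.ρ_lt.trans S.Λ_lt
  refine Summable.of_nonneg_of_le (fun j => mul_nonneg (pow_nonneg hρ.le j) (S.a_nonneg _))
    (fun j => ?_) (summable_geometric_of_lt_one hρ.le hρ1)
  exact mul_le_of_le_one_right (by positivity) (by linarith [S.a_lt (ω j)])

theorem pt_succ (ω : ℕ → W) : S.pt ω = S.ρ * S.pt (fun i => ω (i + 1)) + S.a (ω 0) := by
  unfold pt
  rw [(S.summable_pt ω).tsum_eq_zero_add, ← tsum_mul_left, add_comm]
  simp only [pow_zero, one_mul]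
  congr 1
  exact tsum_congr fun j => by ring

theorem pt_mem (ω : ℕ → W) : S.pt ω ∈ Ico (0:ℝ) 1 := by
  have hρ := S.ρ_pos
  have hρ1 : S.ρ < 1 := S.ρ_lt.trans S.Λ_lt
  have h1 : ∀ ω, S.pt ω ≤ 1 := by
    intro ω
    have h2 : S.pt ω ≤ ∑' j : ℕ, S.ρ ^ j * (1 - S.ρ) :=
      (S.summable_pt ω).tsum_le_tsum
        (fun j => mul_le_mul_of_nonneg_left (by linarith [S.a_lt (ω j)]) (by positivity))
        ((summable_geometric_of_lt_one hρ.le hρ1).mul_right _)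
    rw [tsum_mul_right, tsum_geometric_of_lt_one hρ.le hρ1,
      inv_mul_cancel₀ (by linarith)] at h2
    exact h2
  refine ⟨tsum_nonneg fun j => mul_nonneg (pow_nonneg hρ.le j) (S.a_nonneg _), ?_⟩
  rw [pt_succ]
  have := h1 fun i => ω (i + 1)
  have := S.a_lt (ω 0)
  nlinarith

theorem pt_eq (n : ℕ) (ω : ℕ → W) :
    S.pt ω = S.A (initWord n ω) + S.ρ ^ n * S.pt (fun i => ω (i + n)) := by
  induction n generalizing ω with
  | zero => simp [initWord, A]
  | succ n ih =>
    rw [pt_succ, ih]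
    simp only [initWord, A]
    have : (fun i => ω (i + n + 1)) = fun i => ω (i + (n + 1)) := rfl
    rw [this]
    ring

theorem graph_word {h : ℝ → ℝ} (hh : ∀ v, ∀ u ∈ Ico (0:ℝ) 1,
      h (S.ρ * u + S.a v) = S.Λ * h u + S.Λ * S.e v * u + S.d v)
    (w : List W) (θ : ℝ) {u : ℝ} (hu : u ∈ Ico (0:ℝ) 1) :
    S.A w + S.ρ ^ w.length * u ∈ Ico (0:ℝ) 1 ∧
      h (S.A w + S.ρ ^ w.length * u) + θ * (S.A w + S.ρ ^ w.length * u)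
        = S.X θ w + S.Λ ^ w.length * (h u + S.th θ w * u) := by
  have hρ := S.ρ_pos
  induction w generalizing θ with
  | nil => simp [A, X, th, hu.1, hu.2]
  | cons v w ih =>
    obtain ⟨h1, h2⟩ := ih (S.e v + S.Γ * θ)
    have h3 : S.A (v :: w) + S.ρ ^ (v :: w).length * u
        = S.ρ * (S.A w + S.ρ ^ w.length * u) + S.a v := by
      simp only [A, List.length_cons]; ring
    rw [h3]
    refine ⟨⟨by have := S.a_nonneg v; have := h1.1; positivity, ?_⟩, ?_⟩
    · have := S.a_lt v
      have := h1.2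
      nlinarith
    · rw [hh v _ h1]
      simp only [X, th, List.length_cons]
      have h4 : θ * (S.ρ * (S.A w + S.ρ ^ w.length * u))
          = S.Λ * (S.Γ * θ * (S.A w + S.ρ ^ w.length * u)) := by
        rw [← S.Γ_mul]; ring
      rw [pow_succ']
      linear_combination S.Λ * h2 + h4

variable [Fintype W]

open Classical in
set_option maxHeartbeats 1000000 in
/-- The graph of a function satisfying the functional equations of a spread affine system has
large Hausdorff dimension. -/
theorem le_dimH_graph {δ t B : ℝ} (hsp : S.Spread δ) (ht : 0 < t)
    (hMt : ((Fintype.card W : ℕ) : ℝ)⁻¹ * S.Γ ^ δ ≤ S.ρ ^ t) {h : ℝ → ℝ}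
    (hB : ∀ u ∈ Ico (0:ℝ) 1, |h u| ≤ B) (hh : ∀ v, ∀ u ∈ Ico (0:ℝ) 1,
      h (S.ρ * u + S.a v) = S.Λ * h u + S.Λ * S.e v * u + S.d v) :
    ENNReal.ofReal t ≤ dimH {p : ℝ × ℝ | p.1 ∈ Ico (0:ℝ) 1 ∧ p.2 = h p.1} := by
  let _ : MeasurableSpace W := ⊤
  have : MeasurableSingletonClass W := ⟨fun _ => trivial⟩
  have : Nonempty W := ⟨S.v₀⟩
  have hρ := S.ρ_pos
  have hρ1 : S.ρ < 1 := S.ρ_lt.trans S.Λ_lt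
  have hΓ := S.Γ_pos
  have hΓ1 := S.Γ_lt
  have hΛ := S.Λ_pos
  have hΛ1 := S.Λ_lt
  have hθB := S.thBound_nonneg
  have hM2 := S.two_le_card
  have hB0 : 0 ≤ B := (abs_nonneg _).trans (hB 0 ⟨le_rfl, one_pos⟩)
  obtain ⟨C, hC, c, hc, hsp⟩ := hsp
  set M : ℝ := ((Fintype.card W : ℕ) : ℝ) with hMdef
  have hM0 : 0 < M := by linarith
  set K : ℝ := 1 + B + S.thBound with hK
  have hK1 : 1 ≤ K := by linarith
  obtain ⟨n₁, hn₁⟩ := exists_pow_lt_of_lt_one (by positivity : 0 < 1 / K) hΓ1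
  have hex : ∀ n : ℕ, ∃ (l : ℕ) (E : List W → List W → Prop), n₁ ≤ n → S.Λ ^ l ≤ S.Γ ^ n ∧
      (∑ p ∈ words W n, (((words W l).filter fun w => ¬ E p w).card : ℝ)
        ≤ C * (K * S.Γ ^ n) ^ c * (M ^ n * M ^ l)) ∧
      ∀ p ∈ words W n, ∀ y, (((words W l).filter fun w => E p w ∧
        |S.X (S.th 0 p) w - y| ≤ K * S.Γ ^ n).card : ℝ) ≤ C * (K * S.Γ ^ n) ^ δ * M ^ l := by
    intro n
    by_cases hn : n₁ ≤ n
    · obtain ⟨l, hl⟩ := exists_pow_lt_of_lt_one (by positivity : 0 < S.Γ ^ n) hΛ1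
      have h1 : S.Γ ^ n ≤ K * S.Γ ^ n := le_mul_of_one_le_left (by positivity) hK1
      have h2 : K * S.Γ ^ n ≤ 1 := by
        have := pow_le_pow_of_le_one hΓ.le hΓ1.le hn
        calc _ ≤ K * (1 / K) := by gcongr; linarith
          _ = 1 := by field_simp
      obtain ⟨E, hE⟩ := hsp (K * S.Γ ^ n) (by positivity) h2 n l h1 (hl.le.trans h1)
      exact ⟨l, E, fun _ => ⟨hl.le, hE⟩⟩
    · exact ⟨0, fun _ _ => True, fun h => absurd h hn⟩
  choose l E hE using hex
  set P := coinMeasure W with hP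
  have hbad : ∀ n, n₁ ≤ n → P {ω | ¬ E n (initWord n ω) (initWord (l n) fun i => ω (i + n))}
      ≤ ENNReal.ofReal (C * K ^ c * (S.Γ ^ c) ^ n) := by
    intro n hn
    have h1 := coinMeasure_le (W := W) (n + l n)
      (fun q => ¬ E n (q.take n) (q.drop n)) (dP := fun _ => Classical.propDecidable _)
    have h2 : {ω : ℕ → W | ¬ E n (initWord n ω) (initWord (l n) fun i => ω (i + n))}
        = {ω | ¬ E n ((initWord (n + l n) ω).take n) ((initWord (n + l n) ω).drop n)} := by
      ext ω
      have h3 : (initWord (n + l n) ω).take n = initWord n ω := by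
        rw [initWord_add, List.take_left' (length_initWord n ω)]
      have h4 : (initWord (n + l n) ω).drop n = initWord (l n) fun i => ω (i + n) := by
        rw [initWord_add, List.drop_left' (length_initWord n ω)]
      simp only [mem_ofPred_eq, h3, h4]
    rw [h2]
    refine h1.trans (ENNReal.ofReal_le_ofReal ?_)
    rw [← hMdef, div_le_iff₀ (by positivity), card_filter_words_add]
    refine le_trans (Finset.sum_le_sum fun p hp => ?_) ((hE n hn).2.1.trans (le_of_eq ?_))
    · refine Nat.cast_le.2 (Finset.card_le_card fun w hw => ?_)
      obtain ⟨h3, h4⟩ := mem_filter_iff.1 hw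
      refine mem_filter_iff.2 ⟨h3, ?_⟩
      rwa [List.take_left' (mem_words.1 hp), List.drop_left' (mem_words.1 hp)] at h4
    · rw [Real.mul_rpow (by positivity) (by positivity), ← Real.rpow_natCast_mul hΓ.le,
        ← Real.rpow_mul_natCast hΓ.le, mul_comm (n : ℝ) c, pow_add]
      ring
  have hq0 : 0 < S.Γ ^ c := by positivity
  have hq1 : S.Γ ^ c < 1 := Real.rpow_lt_one hΓ.le hΓ1 hc
  obtain ⟨n₂, hn₂⟩ := exists_pow_lt_of_lt_one
    (div_pos (by linarith : 0 < 1 - S.Γ ^ c) (by positivity : 0 < C * K ^ c)) hq1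
  set n₀ := max n₁ n₂ with hn₀
  have hn₀₂ : (S.Γ ^ c) ^ n₀ < (1 - S.Γ ^ c) / (C * K ^ c) :=
    (pow_le_pow_of_le_one hq0.le hq1.le (le_max_right _ _)).trans_lt hn₂
  set G : Set (ℕ → W) :=
    {ω | ∀ n, n₀ ≤ n → E n (initWord n ω) (initWord (l n) fun i => ω (i + n))} with hG
  have hPG : P G ≠ 0 := by
    intro h0
    have h1 : (univ : Set (ℕ → W)) ⊆ G ∪ ⋃ i : ℕ,
        {ω | ¬ E (n₀ + i) (initWord (n₀ + i) ω) (initWord (l (n₀ + i)) fun j => ω (j + (n₀ + i)))}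
        := by
      intro ω _
      by_cases hω : ω ∈ G
      · exact Or.inl hω
      · right
        simp only [hG, mem_ofPred_eq, not_forall] at hω
        obtain ⟨n, hn, hω⟩ := hω
        obtain ⟨i, rfl⟩ := Nat.exists_eq_add_of_le hn
        exact mem_iUnion.2 ⟨i, hω⟩
    have h2 : (1 : ENNReal) ≤ ∑' i : ℕ, ENNReal.ofReal (C * K ^ c * (S.Γ ^ c) ^ (n₀ + i)) := by
      rw [← coinMeasure_univ (W := W)]
      refine (measure_mono h1).trans ((measure_union_le _ _).trans ?_)
      rw [← hP, h0, zero_add]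
      refine (measure_iUnion_le _).trans (ENNReal.tsum_le_tsum fun i => hbad _ ?_)
      exact (le_max_left _ _).trans (Nat.le_add_right _ _)
    have h3 : ∀ i : ℕ, C * K ^ c * (S.Γ ^ c) ^ (n₀ + i)
        = C * K ^ c * (S.Γ ^ c) ^ n₀ * (S.Γ ^ c) ^ i := fun i => by rw [pow_add]; ring
    simp only [h3] at h2
    rw [← ENNReal.ofReal_tsum_of_nonneg (fun i => by positivity)
      ((summable_geometric_of_lt_one hq0.le hq1).mul_left _), tsum_mul_left,
      tsum_geometric_of_lt_one hq0.le hq1, ← ENNReal.ofReal_one,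
      ENNReal.ofReal_le_ofReal_iff (by have : 0 < 1 - S.Γ ^ c := by linarith
                                       positivity)] at h2
    rw [lt_div_iff₀ (by positivity)] at hn₀₂
    rw [← div_eq_mul_inv, le_div_iff₀ (by linarith)] at h2
    linarith
  set z : (ℕ → W) → ℝ × ℝ := fun ω => (S.pt ω, h (S.pt ω)) with hz
  have hball : ∀ n, n₀ ≤ n → ∀ U : Set (ℝ × ℝ), Metric.ediam U ≤ ENNReal.ofReal (S.ρ ^ n) →
      P (z ⁻¹' U ∩ G) ≤ ENNReal.ofReal (6 * (C * K ^ δ) * (S.ρ ^ n) ^ t) := by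
    intro n hn U hU
    rcases (z ⁻¹' U ∩ G).eq_empty_or_nonempty with h0 | ⟨ω₀, hω₀, -⟩
    · rw [h0, measure_empty]; exact zero_le
    obtain ⟨hl, -, hwin⟩ := hE n ((le_max_left _ _).trans hn)
    set u₀ := S.pt ω₀ with hu₀
    set Q : List W → Prop := fun q => |S.A (q.take n) - u₀| ≤ 2 * S.ρ ^ n ∧
      E n (q.take n) (q.drop n) ∧ |S.X (S.th 0 (q.take n)) (q.drop n)
        - (h u₀ - S.X 0 (q.take n)) / S.Λ ^ n| ≤ K * S.Γ ^ n with hQ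
    have hsub : z ⁻¹' U ∩ G ⊆ {ω | Q (initWord (n + l n) ω)} := by
      rintro ω ⟨hω, hωG⟩
      have hd : dist (z ω) (z ω₀) ≤ S.ρ ^ n := by
        rw [← ENNReal.ofReal_le_ofReal_iff (by positivity), ← edist_dist]
        exact (Metric.edist_le_ediam_of_mem (show z ω ∈ U from hω)
          (show z ω₀ ∈ U from hω₀)).trans hU
      rw [Prod.dist_eq, max_le_iff, Real.dist_eq, Real.dist_eq] at hd
      obtain ⟨hd1, hd2⟩ := hd
      simp only [hz] at hd1 hd2
      have h3 : (initWord (n + l n) ω).take n = initWord n ω := by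
        rw [initWord_add, List.take_left' (length_initWord n ω)]
      have h4 : (initWord (n + l n) ω).drop n = initWord (l n) fun i => ω (i + n) := by
        rw [initWord_add, List.drop_left' (length_initWord n ω)]
      simp only [mem_ofPred_eq, hQ, h3, h4]
      have hwl := length_initWord n ω
      have hp1 := S.pt_eq n ω
      have hmem := S.pt_mem fun i => ω (i + n)
      set w := initWord n ω with hw
      set ω' : ℕ → W := fun i => ω (i + n) with hω'
      have hg1 := S.graph_word hh w 0 hmem
      rw [hwl, ← hp1, zero_mul, add_zero] at hg1
      refine ⟨?_, hωG n hn, ?_⟩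
      · have h5 : S.A w - u₀ = (S.pt ω - u₀) - S.ρ ^ n * S.pt ω' := by rw [hp1]; ring
        have h6 : 0 ≤ S.ρ ^ n * S.pt ω' := mul_nonneg (by positivity) hmem.1
        have h7 : S.ρ ^ n * S.pt ω' ≤ S.ρ ^ n :=
          mul_le_of_le_one_right (by positivity) hmem.2.le
        rw [h5]
        rw [abs_le] at hd1 ⊢
        constructor <;> linarith
      · have hp2 := S.pt_eq (l n) ω'
        have hmem2 := S.pt_mem fun i => ω' (i + l n)
        have hwl2 := length_initWord (l n) ω'
        set w' := initWord (l n) ω' with hw'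
        set x'' := S.pt fun i => ω' (i + l n) with hx''
        have hg2 := S.graph_word hh w' (S.th 0 w) hmem2
        rw [hwl2, ← hp2] at hg2
        have h5 : S.X (S.th 0 w) w' - (h u₀ - S.X 0 w) / S.Λ ^ n
            = (h (S.pt ω) - h u₀) / S.Λ ^ n
              - S.Λ ^ (l n) * (h x'' + S.th (S.th 0 w) w' * x'') := by
          rw [hg1.2]
          field_simp
          linear_combination (- S.Λ ^ n) * hg2.2
        have h6 : |(h (S.pt ω) - h u₀) / S.Λ ^ n| ≤ S.Γ ^ n := by
          rw [abs_div, abs_of_pos (by positivity : 0 < S.Λ ^ n), div_le_iff₀ (by positivity),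
            ← mul_pow, mul_comm, S.Γ_mul]
          exact hd2
        have h7 : |S.Λ ^ (l n) * (h x'' + S.th (S.th 0 w) w' * x'')|
            ≤ S.Γ ^ n * (B + S.thBound) := by
          rw [abs_mul, abs_of_pos (by positivity : 0 < S.Λ ^ (l n))]
          refine mul_le_mul hl ?_ (abs_nonneg _) (by positivity)
          refine (abs_add_le _ _).trans (add_le_add (hB _ hmem2) ?_)
          rw [abs_mul]
          refine mul_le_of_le_one_right (abs_nonneg _) ?_ |>.trans
            (S.abs_th_le w' _ (S.abs_th_zero_le w))
          rw [abs_of_nonneg hmem2.1]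
          exact hmem2.2.le
        rw [h5]
        refine (abs_sub _ _).trans ((add_le_add h6 h7).trans (le_of_eq ?_))
        rw [hK]; ring
    refine (measure_mono hsub).trans ((coinMeasure_le (n + l n) Q
      (dP := fun _ => Classical.propDecidable _)).trans (ENNReal.ofReal_le_ofReal ?_))
    rw [← hMdef, div_le_iff₀ (by positivity), card_filter_words_add]
    set N := (words W n).filter fun w => |S.A w - u₀| ≤ 2 * S.ρ ^ n with hN
    have hNc : (N.card : ℝ) ≤ 6 := by
      have := card_le_of_separated N S.A (h := S.ρ ^ n) (c := u₀) (r := 2 * S.ρ ^ n)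
        (by positivity) (by positivity)
        (fun a ha b hb hab => S.A_sep (mem_words.1 (mem_filter_iff.1 ha).1)
          (mem_words.1 (mem_filter_iff.1 hb).1) hab) (fun a ha => (mem_filter_iff.1 ha).2)
      rw [mul_div_cancel_right₀ _ (by positivity)] at this
      linarith
    calc _ ≤ ∑ w ∈ words W n, (if |S.A w - u₀| ≤ 2 * S.ρ ^ n then
          C * (K * S.Γ ^ n) ^ δ * M ^ (l n) else 0) := by
          refine Finset.sum_le_sum fun w hw => ?_
          split_ifs with hcond
          · refine le_trans (Nat.cast_le.2 (Finset.card_le_card fun t ht => ?_))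
              (hwin w hw ((h u₀ - S.X 0 w) / S.Λ ^ n))
            obtain ⟨h3, -, h4⟩ := mem_filter_iff.1 ht
            refine mem_filter_iff.2 ⟨h3, ?_⟩
            rwa [List.take_left' (mem_words.1 hw), List.drop_left' (mem_words.1 hw)] at h4
          · rw [Finset.card_eq_zero.2, Nat.cast_zero]
            refine Finset.eq_empty_of_forall_notMem fun t ht => hcond ?_
            have h3 := (mem_filter_iff.1 ht).2.1
            rwa [List.take_left' (mem_words.1 hw)] at h3
      _ = N.card * (C * (K * S.Γ ^ n) ^ δ * M ^ (l n)) := by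
          rw [← Finset.sum_filter, Finset.sum_const, nsmul_eq_mul]
      _ ≤ 6 * (C * (K * S.Γ ^ n) ^ δ * M ^ (l n)) := by gcongr
      _ = 6 * (C * K ^ δ) * (M⁻¹ * S.Γ ^ δ) ^ n * M ^ (n + l n) := by
          rw [Real.mul_rpow (by positivity) (by positivity), ← Real.rpow_natCast_mul hΓ.le,
            mul_comm (n : ℝ) δ, Real.rpow_mul_natCast hΓ.le, pow_add, mul_pow, inv_pow]
          field_simp
      _ ≤ 6 * (C * K ^ δ) * (S.ρ ^ t) ^ n * M ^ (n + l n) := by gcongr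
      _ = _ := by
          rw [← Real.rpow_mul_natCast hρ.le, mul_comm t, Real.rpow_natCast_mul hρ.le]
  refine le_dimH_of_mass (OuterMeasure.map z (OuterMeasure.restrict G P.toOuterMeasure))
    (C := 6 * (C * K ^ δ) * S.ρ ^ (-t)) (r₀ := S.ρ ^ n₀) ht (by positivity) (by positivity) ?_ ?_
  · rw [OuterMeasure.map_apply, OuterMeasure.restrict_apply]
    have : z ⁻¹' {p : ℝ × ℝ | p.1 ∈ Ico (0:ℝ) 1 ∧ p.2 = h p.1} ∩ G = G := by
      refine inter_eq_right.2 fun ω _ => ⟨S.pt_mem ω, rfl⟩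
    rw [this]
    exact hPG
  · intro U ε hε hε₀ hU
    rw [OuterMeasure.map_apply, OuterMeasure.restrict_apply]
    obtain ⟨n, hn1, hn2⟩ := exists_nat_pow_near_of_lt_one hε
      (hε₀.trans (pow_le_one₀ hρ.le hρ1.le)) hρ hρ1
    have hn : n₀ ≤ n := by
      have h1 : S.ρ ^ (n + 1) < S.ρ ^ n₀ := hn1.trans_le hε₀
      have := (pow_lt_pow_iff_right_of_lt_one₀ hρ hρ1).1 h1
      omega
    refine (hball n hn U (hU.trans (ENNReal.ofReal_le_ofReal hn2))).trans
      (ENNReal.ofReal_le_ofReal ?_)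
    have h1 : (S.ρ ^ n) ^ t ≤ S.ρ ^ (-t) * ε ^ t := by
      have h2 : S.ρ ^ n ≤ S.ρ⁻¹ * ε := by
        rw [inv_mul_eq_div, le_div_iff₀ hρ, ← pow_succ]
        exact hn1.le
      rw [Real.rpow_neg hρ.le, ← Real.inv_rpow hρ.le, ← Real.mul_rpow (by positivity) hε.le]
      gcongr
    calc _ ≤ 6 * (C * K ^ δ) * (S.ρ ^ (-t) * ε ^ t) := by gcongr
      _ = _ := by ring

end AffSys

theorem distInt_nonneg (t : ℝ) : 0 ≤ distInt t := abs_nonneg _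

theorem distInt_le_half (t : ℝ) : distInt t ≤ 1 / 2 := abs_sub_round t

theorem distInt_sub_le (s t : ℝ) : distInt s - distInt t ≤ |s - t| := by
  have h1 : distInt s ≤ |s - (round t : ℤ)| := round_le s (round t)
  have h2 : |s - (round t : ℤ)| ≤ |s - t| + |t - (round t : ℤ)| := abs_sub_le _ _ _
  unfold distInt at *
  linarith

theorem abs_distInt_sub_le (s t : ℝ) : |distInt s - distInt t| ≤ |s - t| := by
  rw [abs_le]
  have h1 := distInt_sub_le s t
  have h2 := distInt_sub_le t s
  rw [abs_sub_comm] at h2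
  constructor <;> linarith

theorem distInt_of_le_half {t : ℝ} (h0 : 0 ≤ t) (h1 : t ≤ 1 / 2) : distInt t = t := by
  rcases h1.eq_or_lt with rfl | h1
  · norm_num [distInt, round_eq]
  · have : round t = 0 := by
      rw [round_eq_zero_iff]
      exact ⟨by linarith, h1⟩
    rw [distInt, this, Int.cast_zero, sub_zero, abs_of_nonneg h0]

theorem distInt_of_half_le {t : ℝ} (h0 : 1 / 2 ≤ t) (h1 : t ≤ 1) : distInt t = 1 - t := by
  have : round t = 1 := by
    rw [round_eq, Int.floor_eq_iff]
    push_cast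
    constructor <;> linarith
  rw [distInt, this, Int.cast_one, abs_sub_comm, abs_of_nonneg (by linarith)]

/-- The slope of the distance to the integers to the right of a point. -/
def tentSign (p : ℝ) : ℝ := if p < 1 / 2 then 1 else -1

theorem tentSign_le_one (p : ℝ) : tentSign p ≤ 1 := by
  unfold tentSign; split_ifs <;> norm_num

theorem distInt_affine {p q u : ℝ} (hp : 0 ≤ p) (hq : 0 ≤ q) (hpq : p + q ≤ 1)
    (h : ¬ (p < 1 / 2 ∧ 1 / 2 < p + q)) (hu0 : 0 ≤ u) (hu1 : u ≤ 1) :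
    distInt (p + q * u) = distInt p + tentSign p * q * u := by
  have h1 : q * u ≤ q := mul_le_of_le_one_right hq hu1
  have h2 : 0 ≤ q * u := mul_nonneg hq hu0
  unfold tentSign
  split_ifs with h3
  · have h4 : p + q ≤ 1 / 2 := not_lt.1 fun h4 => h ⟨h3, h4⟩
    rw [distInt_of_le_half hp h3.le, distInt_of_le_half (by linarith) (by linarith)]
    ring
  · rw [not_lt] at h3
    rw [distInt_of_half_le h3 (by linarith), distInt_of_half_le (by linarith) (by linarith)]
    ring

section BetaMap

variable {b : ℝ}

theorem betaMap_nonneg (x : ℝ) : 0 ≤ betaMap b x := Int.fract_nonneg _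

theorem betaMap_lt_one (x : ℝ) : betaMap b x < 1 := Int.fract_lt_one _

theorem betaMap_iterate_mem (n : ℕ) {x : ℝ} (hx : x ∈ Ico (0:ℝ) 1) :
    (betaMap b)^[n] x ∈ Ico (0:ℝ) 1 := by
  induction n with
  | zero => exact hx
  | succ n ih =>
    rw [Function.iterate_succ_apply']
    exact ⟨betaMap_nonneg _, betaMap_lt_one _⟩

theorem betaMap_zero_iterate (n : ℕ) : (betaMap b)^[n] 0 = 0 := by
  induction n with
  | zero => rfl
  | succ n ih => rw [Function.iterate_succ_apply', ih]; simp [betaMap]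

theorem betaMap_le (hb : 0 ≤ b) {x : ℝ} (hx : 0 ≤ x) : betaMap b x ≤ b * x := by
  have h : (0:ℤ) ≤ ⌊b * x⌋ := Int.floor_nonneg.2 (by positivity)
  have h2 : (0:ℝ) ≤ (⌊b * x⌋ : ℝ) := by exact_mod_cast h
  unfold betaMap
  linarith [Int.floor_add_fract (b * x)]

theorem betaMap_iterate_le (hb : 0 ≤ b) (n : ℕ) {x : ℝ} (hx : x ∈ Ico (0:ℝ) 1) :
    (betaMap b)^[n] x ≤ b ^ n * x := by
  induction n with
  | zero => simp
  | succ n ih =>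
    rw [Function.iterate_succ_apply', pow_succ', mul_assoc]
    exact (betaMap_le hb (betaMap_iterate_mem n hx).1).trans (mul_le_mul_of_nonneg_left ih hb)

theorem betaMap_add {x v : ℝ} (h0 : 0 ≤ betaMap b x + b * v) (h1 : betaMap b x + b * v < 1) :
    betaMap b (x + v) = betaMap b x + b * v := by
  unfold betaMap at *
  rw [Int.fract_eq_iff]
  refine ⟨h0, h1, ⌊b * x⌋, ?_⟩
  linarith [Int.floor_add_fract (b * x)]

/-- Points to the right of `z` follow the orbit of `z` as long as they do not leave `[0,1)`. -/
theorem betaMap_iterate_add {n : ℕ} {z v : ℝ} (hz : z ∈ Ico (0:ℝ) 1) (hb : 0 ≤ b) (hv : 0 ≤ v)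
    (h : ∀ k, 1 ≤ k → k ≤ n → (betaMap b)^[k] z + b ^ k * v < 1) :
    ∀ k ≤ n, (betaMap b)^[k] (z + v) = (betaMap b)^[k] z + b ^ k * v := by
  intro k hk
  induction k with
  | zero => simp
  | succ k ih =>
    have h1 := h (k + 1) (by omega) hk
    have h2 := (betaMap_iterate_mem (b := b) (k + 1) hz).1
    rw [Function.iterate_succ_apply'] at h1 h2
    rw [Function.iterate_succ_apply', ih (by omega), Function.iterate_succ_apply',
      betaMap_add, pow_succ']
    · ring
    · positivity
    · rw [pow_succ'] at h1; linarith

/-- The left endpoint of the cylinder of order `n` containing `x`. -/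
def cylLeft (b : ℝ) (n : ℕ) (x : ℝ) : ℝ := x - (betaMap b)^[n] x / b ^ n

theorem betaMap_iterate_cylLeft (hb : 0 < b) {n k : ℕ} (hk : k ≤ n) {x : ℝ}
    (hx : x ∈ Ico (0:ℝ) 1) :
    (betaMap b)^[k] (cylLeft b n x) = (betaMap b)^[k] x - b ^ k * ((betaMap b)^[n] x / b ^ n) := by
  induction k with
  | zero => simp [cylLeft]
  | succ k ih =>
    have h1 : (betaMap b)^[n] x ≤ b ^ (n - (k + 1)) * (betaMap b)^[k + 1] x := by
      have := betaMap_iterate_le hb.le (n - (k + 1)) (betaMap_iterate_mem (b := b) (k + 1) hx)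
      rwa [← Function.iterate_add_apply, Nat.sub_add_cancel hk] at this
    have h2 : b ^ n = b ^ (n - (k + 1)) * b ^ (k + 1) := by
      rw [← pow_add, Nat.sub_add_cancel hk]
    have h3 : b ^ (k + 1) * ((betaMap b)^[n] x / b ^ n) ≤ (betaMap b)^[k + 1] x := by
      rw [h2]
      have : b ^ (k + 1) * ((betaMap b)^[n] x / (b ^ (n - (k + 1)) * b ^ (k + 1)))
          = (betaMap b)^[n] x / b ^ (n - (k + 1)) := by field_simp
      rw [this, div_le_iff₀ (by positivity)]
      linarith
    have h4 : 0 ≤ b ^ (k + 1) * ((betaMap b)^[n] x / b ^ n) :=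
      mul_nonneg (by positivity) (div_nonneg (betaMap_iterate_mem n hx).1 (by positivity))
    have h5 := (betaMap_iterate_mem (b := b) (k + 1) hx).2
    rw [Function.iterate_succ_apply'] at h3 h5
    rw [pow_succ', mul_assoc] at h3 h4
    rw [Function.iterate_succ_apply', ih (by omega), Function.iterate_succ_apply',
      sub_eq_add_neg, betaMap_add]
    · ring
    · linarith
    · linarith

theorem cylLeft_mem (hb : 0 < b) (n : ℕ) {x : ℝ} (hx : x ∈ Ico (0:ℝ) 1) :
    cylLeft b n x ∈ Ico (0:ℝ) 1 := by
  have h1 := betaMap_iterate_le hb.le n hx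
  have h2 := (betaMap_iterate_mem (b := b) n hx).1
  have h3 : (betaMap b)^[n] x / b ^ n ≤ x := by
    rw [div_le_iff₀ (by positivity)]; linarith
  have h4 : 0 ≤ (betaMap b)^[n] x / b ^ n := by positivity
  unfold cylLeft
  exact ⟨by linarith, by linarith [hx.2]⟩

theorem betaMap_iterate_cylLeft_self (hb : 0 < b) (n : ℕ) {x : ℝ} (hx : x ∈ Ico (0:ℝ) 1) :
    (betaMap b)^[n] (cylLeft b n x) = 0 := by
  rw [betaMap_iterate_cylLeft hb le_rfl hx, mul_div_cancel₀ _ (by positivity), sub_self]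

/-- A bound for the number of preimages in `[0,c)` of a point under an iterate of the β-map. -/
theorem card_preimage_Ico_le (hb : 1 < b) (n : ℕ) : ∀ (c y : ℝ) (s : Finset ℝ), 0 ≤ c → c ≤ 1 →
    (∀ x ∈ s, 0 ≤ x ∧ x < c ∧ (betaMap b)^[n] x = y) →
    (s.card : ℝ) ≤ b ^ n * c * (∑ i ∈ Finset.range n, (b⁻¹) ^ i) + 1 := by
  have hb0 : 0 < b := by linarith
  induction n with
  | zero =>
    intro c y s _ _ h
    have : s.card ≤ 1 := Finset.card_le_one.2 fun x hx x' hx' => by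
      have h1 := (h x hx).2.2
      have h2 := (h x' hx').2.2
      simp only [Function.iterate_zero, id] at h1 h2
      rw [h1, h2]
    simpa using this
  | succ n ih =>
    intro c y s hc0 hc1 h
    set T := ∑ i ∈ Finset.range n, (b⁻¹) ^ i with hT
    have hT0 : 0 ≤ T := by positivity
    set F : ℕ := ⌊b * c⌋₊ with hF
    have hbc : 0 ≤ b * c := by positivity
    have hF1 : (F : ℝ) ≤ b * c := Nat.floor_le hbc
    have hF2 : b * c < F + 1 := Nat.lt_floor_add_one _
    have hinj : ∀ i : ℕ, Set.InjOn (betaMap b) (s.filter fun x => ⌊b * x⌋₊ = i) := by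
      intro i x hx x' hx' hxx
      rw [Finset.mem_coe, Finset.mem_filter] at hx hx'
      have h1 := natCast_floor_eq_intCast_floor (mul_nonneg hb0.le (h x hx.1).1)
      have h2 := natCast_floor_eq_intCast_floor (mul_nonneg hb0.le (h x' hx'.1).1)
      rw [hx.2] at h1
      rw [hx'.2] at h2
      have h3 := Int.floor_add_fract (b * x)
      have h4 := Int.floor_add_fract (b * x')
      unfold betaMap at hxx
      have h5 : b * x = b * x' := by rw [← h3, ← h4, ← h1, ← h2, hxx]
      exact mul_left_cancel₀ hb0.ne' h5
    have hfib : ∀ (i : ℕ) (c' : ℝ), 0 ≤ c' → c' ≤ 1 →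
        (∀ x ∈ s, ⌊b * x⌋₊ = i → betaMap b x < c') →
        ((s.filter fun x => ⌊b * x⌋₊ = i).card : ℝ) ≤ b ^ n * c' * T + 1 := by
      intro i c' h0 h1 h2
      rw [← Finset.card_image_of_injOn (hinj i)]
      refine ih c' y _ h0 h1 fun w hw => ?_
      obtain ⟨x, hx, rfl⟩ := Finset.mem_image.1 hw
      rw [Finset.mem_filter] at hx
      exact ⟨betaMap_nonneg _, h2 x hx.1 hx.2, (h x hx.1).2.2⟩
    have hmaps : ∀ x ∈ s, ⌊b * x⌋₊ ∈ Finset.range (F + 1) := by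
      intro x hx
      rw [Finset.mem_range, Nat.lt_succ_iff]
      exact Nat.floor_le_floor (mul_le_mul_of_nonneg_left (h x hx).2.1.le hb0.le)
    rw [Finset.card_eq_sum_card_fiberwise hmaps, Nat.cast_sum, Finset.sum_range_succ,
      Finset.sum_range_succ, ← hT]
    have h1 : ∑ i ∈ Finset.range F, ((s.filter fun x => ⌊b * x⌋₊ = i).card : ℝ)
        ≤ F * (b ^ n * 1 * T + 1) := by
      refine (Finset.sum_le_card_nsmul _ _ _ fun i _ =>
        hfib i 1 zero_le_one le_rfl fun x _ _ => betaMap_lt_one x).trans ?_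
      rw [Finset.card_range, nsmul_eq_mul]
    have h2 := hfib F (b * c - F) (by linarith) (by linarith) (by
      intro x hx hxF
      have h3 := natCast_floor_eq_intCast_floor (mul_nonneg hb0.le (h x hx).1)
      rw [hxF] at h3
      have h4 := Int.floor_add_fract (b * x)
      have h5 := mul_lt_mul_of_pos_left (h x hx).2.1 hb0
      unfold betaMap
      rw [← h3] at h4
      linarith)
    refine (add_le_add h1 h2).trans ?_
    have h3 : b ^ (n + 1) * (b⁻¹) ^ n = b := by
      rw [pow_succ, mul_right_comm, ← mul_pow, mul_inv_cancel₀ hb0.ne', one_pow, one_mul]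
    have h4 : b ^ (n + 1) * c * (T + (b⁻¹) ^ n) = b ^ (n + 1) * c * T + b * c := by
      linear_combination c * h3
    rw [h4, pow_succ]
    nlinarith

/-- A constant for the growth of the number of preimages. -/
def preimageConst (b : ℝ) : ℝ := (1 - b⁻¹)⁻¹ + 1

theorem preimageConst_pos (hb : 1 < b) : 0 < preimageConst b := by
  have : b⁻¹ < 1 := inv_lt_one_of_one_lt₀ hb
  have : 0 < (1 - b⁻¹)⁻¹ := inv_pos.2 (by linarith)
  unfold preimageConst
  linarith

theorem card_preimage_le (hb : 1 < b) (n : ℕ) (y : ℝ) (s : Finset ℝ)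
    (h : ∀ x ∈ s, x ∈ Ico (0:ℝ) 1 ∧ (betaMap b)^[n] x = y) :
    (s.card : ℝ) ≤ preimageConst b * b ^ n := by
  have hb0 : 0 < b := by linarith
  have h1 := card_preimage_Ico_le hb n 1 y s zero_le_one le_rfl
    fun x hx => ⟨(h x hx).1.1, (h x hx).1.2, (h x hx).2⟩
  have h2 : ∑ i ∈ Finset.range n, (b⁻¹) ^ i ≤ (1 - b⁻¹)⁻¹ := by
    rw [← tsum_geometric_of_lt_one (by positivity) (inv_lt_one_of_one_lt₀ hb)]
    exact (summable_geometric_of_lt_one (by positivity)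
      (inv_lt_one_of_one_lt₀ hb)).sum_le_tsum _ fun i _ => by positivity
  have h3 : (1:ℝ) ≤ b ^ n := one_le_pow₀ hb.le
  unfold preimageConst
  calc (s.card : ℝ) ≤ b ^ n * 1 * (1 - b⁻¹)⁻¹ + 1 := h1.trans (by gcongr)
    _ ≤ _ := by linarith

theorem finite_zeros (hb : 1 < b) (n : ℕ) :
    {x | x ∈ Ico (0:ℝ) 1 ∧ (betaMap b)^[n] x = 0}.Finite := by
  by_contra hinf
  obtain ⟨k, hk⟩ := exists_nat_gt (preimageConst b * b ^ n)
  obtain ⟨s, hs1, hs2⟩ := Set.Infinite.exists_subset_card_eq hinf k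
  have := card_preimage_le hb n 0 s fun x hx => hs1 hx
  rw [hs2] at this
  linarith

/-- The left endpoints of the cylinders of order `n`. -/
def cylPoints (hb : 1 < b) (n : ℕ) : Finset ℝ := (finite_zeros hb n).toFinset

theorem mem_cylPoints {hb : 1 < b} {n : ℕ} {x : ℝ} :
    x ∈ cylPoints hb n ↔ x ∈ Ico (0:ℝ) 1 ∧ (betaMap b)^[n] x = 0 := by
  simp [cylPoints]

theorem card_cylPoints_le (hb : 1 < b) (n : ℕ) :
    ((cylPoints hb n).card : ℝ) ≤ preimageConst b * b ^ n :=
  card_preimage_le hb n 0 _ fun _ hx => mem_cylPoints.1 hx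

theorem cylLeft_mem_cylPoints (hb : 1 < b) (n : ℕ) {x : ℝ} (hx : x ∈ Ico (0:ℝ) 1) :
    cylLeft b n x ∈ cylPoints hb n :=
  mem_cylPoints.2 ⟨cylLeft_mem (by linarith) n hx, betaMap_iterate_cylLeft_self (by linarith) n hx⟩

end BetaMap

section UpperBound

variable {b lam : ℝ}

theorem summable_betaTakagi (h0 : 0 < lam) (h1 : lam < 1) (x : ℝ) :
    Summable fun k : ℕ => lam ^ k * distInt ((betaMap b)^[k] x) := by
  refine Summable.of_nonneg_of_le (fun k => mul_nonneg (by positivity) (distInt_nonneg _))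
    (fun k => ?_) (summable_geometric_of_lt_one h0.le h1)
  exact mul_le_of_le_one_right (by positivity) ((distInt_le_half _).trans (by norm_num))

theorem betaTakagi_nonneg (h0 : 0 < lam) (x : ℝ) : 0 ≤ betaTakagi b lam x :=
  tsum_nonneg fun _ => mul_nonneg (by positivity) (distInt_nonneg _)

theorem betaTakagi_le (h0 : 0 < lam) (h1 : lam < 1) (x : ℝ) :
    betaTakagi b lam x ≤ (1 - lam)⁻¹ := by
  rw [← tsum_geometric_of_lt_one h0.le h1]
  refine (summable_betaTakagi h0 h1 x).tsum_le_tsum (fun k => ?_)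
    (summable_geometric_of_lt_one h0.le h1)
  exact mul_le_of_le_one_right (by positivity) ((distInt_le_half _).trans (by norm_num))

theorem betaTakagi_split (h0 : 0 < lam) (h1 : lam < 1) (n : ℕ) (x : ℝ) :
    betaTakagi b lam x = ∑ k ∈ Finset.range n, lam ^ k * distInt ((betaMap b)^[k] x)
      + lam ^ n * betaTakagi b lam ((betaMap b)^[n] x) := by
  unfold betaTakagi
  rw [← (summable_betaTakagi (b := b) h0 h1 x).sum_add_tsum_nat_add n, ← tsum_mul_left]
  congr 1
  refine tsum_congr fun k => ?_
  rw [← Function.iterate_add_apply, pow_add]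
  ring

theorem abs_betaTakagi_sub_cylLeft_le (h0 : 0 < lam) (h1 : lam < 1) (hb : 1 < b)
    (hbl : 1 < lam * b) (n : ℕ) {x : ℝ} (hx : x ∈ Ico (0:ℝ) 1) :
    |betaTakagi b lam x - betaTakagi b lam (cylLeft b n x)|
      ≤ ((lam * b - 1)⁻¹ + (1 - lam)⁻¹) * lam ^ n := by
  have hb0 : 0 < b := by linarith
  rw [betaTakagi_split h0 h1 n x, betaTakagi_split h0 h1 n (cylLeft b n x)]
  have hy := betaMap_iterate_mem (b := b) n hx
  set y := (betaMap b)^[n] x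
  set w := (betaMap b)^[n] (cylLeft b n x)
  have h2 : |∑ k ∈ Finset.range n, lam ^ k * distInt ((betaMap b)^[k] x)
      - ∑ k ∈ Finset.range n, lam ^ k * distInt ((betaMap b)^[k] (cylLeft b n x))|
      ≤ (lam * b - 1)⁻¹ * lam ^ n := by
    rw [← Finset.sum_sub_distrib]
    calc _ ≤ ∑ k ∈ Finset.range n, |lam ^ k * distInt ((betaMap b)^[k] x)
          - lam ^ k * distInt ((betaMap b)^[k] (cylLeft b n x))| :=
          Finset.abs_sum_le_sum_abs _ _
      _ ≤ ∑ k ∈ Finset.range n, (lam * b) ^ k * (b ^ n)⁻¹ := by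
          refine Finset.sum_le_sum fun k hk => ?_
          rw [← mul_sub, abs_mul, abs_of_pos (pow_pos h0 k), mul_pow, mul_assoc]
          refine mul_le_mul_of_nonneg_left ((abs_distInt_sub_le _ _).trans ?_) (by positivity)
          rw [betaMap_iterate_cylLeft hb0 (Finset.mem_range.1 hk).le hx, sub_sub_cancel,
            abs_of_nonneg (mul_nonneg (by positivity) (div_nonneg hy.1 (by positivity)))]
          refine mul_le_mul_of_nonneg_left ?_ (by positivity)
          rw [div_eq_mul_inv]
          exact mul_le_of_le_one_left (by positivity) hy.2.le
      _ ≤ (lam * b - 1)⁻¹ * lam ^ n := by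
          rw [← Finset.sum_mul, geom_sum_eq hbl.ne', mul_pow, div_eq_inv_mul, mul_assoc]
          refine mul_le_mul_of_nonneg_left ?_ (inv_nonneg.2 (by linarith))
          rw [sub_mul, mul_assoc, mul_inv_cancel₀ (by positivity), mul_one]
          have : 0 < 1 * (b ^ n)⁻¹ := by positivity
          linarith
  have h3 : |betaTakagi b lam y - betaTakagi b lam w| ≤ (1 - lam)⁻¹ := by
    rw [abs_le]
    have e1 := betaTakagi_nonneg (b := b) h0 y
    have e2 := betaTakagi_nonneg (b := b) h0 w
    have e3 := betaTakagi_le (b := b) h0 h1 y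
    have e4 := betaTakagi_le (b := b) h0 h1 w
    constructor <;> linarith
  have h4 : |lam ^ n * betaTakagi b lam y - lam ^ n * betaTakagi b lam w|
      ≤ (1 - lam)⁻¹ * lam ^ n := by
    rw [← mul_sub, abs_mul, abs_of_pos (pow_pos h0 n), mul_comm]
    exact mul_le_mul_of_nonneg_right h3 (by positivity)
  rw [abs_le] at *
  constructor <;> nlinarith

/-- The boxes covering the graph of the β-Takagi function at level `n`. -/
def graphBox (b lam C : ℝ) (n : ℕ) (z : ℝ) (i : ℕ) : Set (ℝ × ℝ) :=
  Icc z (z + (b ^ n)⁻¹) ×ˢ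
    Icc (betaTakagi b lam z - C * lam ^ n + i * (b ^ n)⁻¹)
      (betaTakagi b lam z - C * lam ^ n + i * (b ^ n)⁻¹ + (b ^ n)⁻¹)

theorem ediam_graphBox_le {C : ℝ} {n : ℕ} {z : ℝ} {i : ℕ} :
    Metric.ediam (graphBox b lam C n z i) ≤ ENNReal.ofReal ((b ^ n)⁻¹) := by
  refine Metric.ediam_le fun p hp q hq => ?_
  obtain ⟨⟨h1, h2⟩, h3, h4⟩ := hp
  obtain ⟨⟨h5, h6⟩, h7, h8⟩ := hq
  rw [edist_dist]
  refine ENNReal.ofReal_le_ofReal ?_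
  rw [Prod.dist_eq, max_le_iff, Real.dist_eq, Real.dist_eq, abs_le, abs_le]
  refine ⟨⟨?_, ?_⟩, ?_, ?_⟩ <;> linarith

theorem graph_subset_boxes (h0 : 0 < lam) (h1 : lam < 1) (hb : 1 < b)
    (hbl : 1 < lam * b) {C : ℝ} (hC : C = (lam * b - 1)⁻¹ + (1 - lam)⁻¹) (n : ℕ) :
    {p : ℝ × ℝ | p.1 ∈ Ico (0:ℝ) 1 ∧ p.2 = betaTakagi b lam p.1} ⊆
      ⋃ j : (cylPoints hb n) × Fin (⌊2 * C * (lam * b) ^ n⌋₊ + 1),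
        graphBox b lam C n j.1 (j.2 : ℕ) := by
  have hb0 : 0 < b := by linarith
  have hbn : 0 < b ^ n := by positivity
  rintro ⟨x, y⟩ ⟨hx, hy⟩
  simp only at hx hy
  have h2 := abs_le.1 (abs_betaTakagi_sub_cylLeft_le h0 h1 hb hbl n hx)
  rw [← hC, ← hy] at h2
  have hf := betaMap_iterate_mem (b := b) n hx
  have hz : cylLeft b n x ≤ x ∧ x ≤ cylLeft b n x + (b ^ n)⁻¹ := by
    have e1 : 0 ≤ (betaMap b)^[n] x / b ^ n := div_nonneg hf.1 hbn.le
    have e2 : (betaMap b)^[n] x / b ^ n ≤ (b ^ n)⁻¹ := by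
      rw [div_eq_mul_inv]
      exact mul_le_of_le_one_left (by positivity) hf.2.le
    unfold cylLeft
    constructor <;> linarith
  have hcz := cylLeft_mem_cylPoints hb n hx
  set z := cylLeft b n x
  set w := (y - betaTakagi b lam z + C * lam ^ n) * b ^ n with hw
  have hw0 : 0 ≤ w := mul_nonneg (by linarith) hbn.le
  have hw1 : w ≤ 2 * C * (lam * b) ^ n := by
    rw [mul_pow, ← mul_assoc]
    exact mul_le_mul_of_nonneg_right (by linarith) hbn.le
  have hy2 : y = betaTakagi b lam z - C * lam ^ n + w * (b ^ n)⁻¹ := by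
    rw [hw, mul_assoc, mul_inv_cancel₀ hbn.ne']; ring
  have hbi : 0 < (b ^ n)⁻¹ := by positivity
  refine mem_iUnion.2 ⟨(⟨z, hcz⟩, ⟨⌊w⌋₊, Nat.lt_succ_of_le (Nat.floor_le_floor hw1)⟩), ?_⟩
  refine ⟨hz, ?_⟩
  show y ∈ Icc _ _
  rw [hy2]
  have e1 := Nat.floor_le hw0
  have e2 := (Nat.lt_floor_add_one w).le
  constructor
  · exact add_le_add_right (mul_le_mul_of_nonneg_right e1 hbi.le) _
  · have := mul_le_mul_of_nonneg_right e2 hbi.le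
    simp only
    linarith

theorem dimH_graph_Ico_le (h0 : 0 < lam) (h1 : lam < 1) (hb : 1 < b) (hbl : 1 < lam * b)
    {t : NNReal} (ht : lam * b ^ 2 < b ^ (t:ℝ)) :
    dimH {p : ℝ × ℝ | p.1 ∈ Ico (0:ℝ) 1 ∧ p.2 = betaTakagi b lam p.1} ≤ t := by
  have hb0 : 0 < b := by linarith
  obtain ⟨C, hC⟩ : ∃ C, C = (lam * b - 1)⁻¹ + (1 - lam)⁻¹ := ⟨_, rfl⟩
  have hC0 : 0 < C := by
    have e1 : 0 < (lam * b - 1)⁻¹ := inv_pos.2 (by linarith)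
    have e2 : 0 < (1 - lam)⁻¹ := inv_pos.2 (by linarith)
    linarith
  apply dimH_le_of_hausdorffMeasure_ne_top
  have hlim : Tendsto (fun n : ℕ => ENNReal.ofReal ((b ^ n)⁻¹)) atTop (nhds 0) := by
    rw [← ENNReal.ofReal_zero]
    refine ENNReal.tendsto_ofReal ?_
    simp_rw [← inv_pow]
    exact tendsto_pow_atTop_nhds_zero_of_lt_one (by positivity) (inv_lt_one_of_one_lt₀ hb)
  set K := preimageConst b * (2 * C + 1) with hK
  set r := lam * b ^ 2 / b ^ (t:ℝ) with hr
  have hbt : 0 < b ^ (t:ℝ) := Real.rpow_pos_of_pos hb0 _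
  have hr1 : r < 1 := (div_lt_one hbt).2 ht
  have hr0 : 0 ≤ r := by positivity
  have hpc := preimageConst_pos hb
  have hle : ∀ n : ℕ, ∑ j : (cylPoints hb n) × Fin (⌊2 * C * (lam * b) ^ n⌋₊ + 1),
      Metric.ediam (graphBox b lam C n j.1 (j.2 : ℕ)) ^ (t:ℝ) ≤ ENNReal.ofReal (K * r ^ n) := by
    intro n
    have hbn : 0 < b ^ n := by positivity
    calc _ ≤ ∑ j : (cylPoints hb n) × Fin (⌊2 * C * (lam * b) ^ n⌋₊ + 1),
          ENNReal.ofReal ((b ^ n)⁻¹) ^ (t:ℝ) :=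
          Finset.sum_le_sum fun j _ => ENNReal.rpow_le_rpow ediam_graphBox_le t.coe_nonneg
      _ = ENNReal.ofReal (((cylPoints hb n).card * (⌊2 * C * (lam * b) ^ n⌋₊ + 1 : ℕ) : ℕ)
            * ((b ^ n)⁻¹) ^ (t:ℝ)) := by
          rw [Finset.sum_const, nsmul_eq_mul, ENNReal.ofReal_mul (by positivity),
            ENNReal.ofReal_natCast, ENNReal.ofReal_rpow_of_nonneg (by positivity) t.coe_nonneg]
          simp
      _ ≤ _ := by
          refine ENNReal.ofReal_le_ofReal ?_
          have e1 := card_cylPoints_le hb n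
          have e2 : (⌊2 * C * (lam * b) ^ n⌋₊ : ℝ) ≤ 2 * C * (lam * b) ^ n :=
            Nat.floor_le (by positivity)
          have e3 : (1:ℝ) ≤ (lam * b) ^ n := one_le_pow₀ hbl.le
          have e4 : ((b ^ n)⁻¹) ^ (t:ℝ) = ((b ^ (t:ℝ)) ^ n)⁻¹ := by
            rw [Real.inv_rpow hbn.le, ← Real.rpow_natCast, ← Real.rpow_mul hb0.le, mul_comm,
              Real.rpow_mul hb0.le, Real.rpow_natCast]
          rw [e4, hK, hr, div_pow, div_eq_mul_inv, ← mul_assoc]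
          refine mul_le_mul_of_nonneg_right ?_ (by positivity)
          push_cast
          calc _ ≤ (preimageConst b * b ^ n) * ((2 * C + 1) * (lam * b) ^ n) :=
                mul_le_mul e1 (by linarith) (by positivity) (by positivity)
            _ = _ := by rw [mul_pow, mul_pow, ← pow_mul, mul_comm 2 n, pow_mul]; ring
  have hlim2 : Tendsto (fun n : ℕ => ENNReal.ofReal (K * r ^ n)) atTop (nhds 0) := by
    rw [← ENNReal.ofReal_zero]
    refine ENNReal.tendsto_ofReal ?_
    simpa using (tendsto_pow_atTop_nhds_zero_of_lt_one hr0 hr1).const_mul K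
  have := Measure.hausdorffMeasure_le_liminf_sum (t:ℝ)
    {p : ℝ × ℝ | p.1 ∈ Ico (0:ℝ) 1 ∧ p.2 = betaTakagi b lam p.1} (l := atTop)
    (fun n : ℕ => ENNReal.ofReal ((b ^ n)⁻¹)) hlim
    (ι := fun n => (cylPoints hb n) × Fin (⌊2 * C * (lam * b) ^ n⌋₊ + 1))
    (fun n j => graphBox b lam C n j.1 (j.2 : ℕ))
    (Eventually.of_forall fun n j => ediam_graphBox_le)
    (Eventually.of_forall fun n => graph_subset_boxes h0 h1 hb hbl hC n)
  refine ne_top_of_le_ne_top ENNReal.zero_ne_top (this.trans ?_)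
  rw [← hlim2.liminf_eq]
  exact liminf_le_liminf (Eventually.of_forall hle)

theorem dimH_betaTakagi_graph_le (h0 : 0 < lam) (h1 : lam < 1) (hb : 1 < b)
    (hbl : 1 < lam * b) :
    dimH {p : ℝ × ℝ | p.1 ∈ Icc (0:ℝ) 1 ∧ p.2 = betaTakagi b lam p.1}
      ≤ ENNReal.ofReal (2 + Real.log lam / Real.log b) := by
  have hb0 : 0 < b := by linarith
  have hlb : 0 < Real.log b := Real.log_pos hb
  have hsub : {p : ℝ × ℝ | p.1 ∈ Icc (0:ℝ) 1 ∧ p.2 = betaTakagi b lam p.1} ⊆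
      {p : ℝ × ℝ | p.1 ∈ Ico (0:ℝ) 1 ∧ p.2 = betaTakagi b lam p.1} ∪
        {((1:ℝ), betaTakagi b lam 1)} := by
    rintro ⟨x, y⟩ ⟨hx, hy⟩
    simp only at hx hy
    rcases hx.2.eq_or_lt with rfl | h
    · exact Or.inr (by rw [hy]; rfl)
    · exact Or.inl ⟨⟨hx.1, h⟩, hy⟩
  refine (dimH_mono hsub).trans ?_
  rw [dimH_union, dimH_singleton]
  refine max_le ?_ bot_le
  refine le_of_forall_gt_imp_ge_of_dense fun t ht => ?_
  rcases eq_or_ne t ⊤ with rfl | htop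
  · exact le_top
  lift t to NNReal using htop
  refine dimH_graph_Ico_le h0 h1 hb hbl ?_
  have ht2 : 2 + Real.log lam / Real.log b < t := by
    by_contra! h
    refine absurd ht (not_lt.2 ?_)
    rw [← ENNReal.ofReal_coe_nnreal]
    exact ENNReal.ofReal_le_ofReal h
  have e : lam * b ^ 2 = b ^ (2 + Real.log lam / Real.log b) := by
    rw [Real.rpow_add hb0, Real.rpow_ofNat, Real.rpow_def_of_pos hb0 (Real.log lam / Real.log b),
      mul_div_cancel₀ _ hlb.ne', Real.exp_log h0, mul_comm]
  rw [e]
  exact Real.rpow_lt_rpow_of_exponent_lt hb ht2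

end UpperBound

section FullCylinders

variable {b q : ℝ}

/-- The first `n` iterates of the β-map are affine, with values in `[0,1]`, on `[z, z + q)`. -/
def StaysBelow (b : ℝ) (n : ℕ) (q z : ℝ) : Prop :=
  ∀ k ≤ n, (betaMap b)^[k] z + b ^ k * q ≤ 1

theorem StaysBelow.iterate_add {n : ℕ} {z v : ℝ} (h : StaysBelow b n q z) (hb : 0 < b)
    (hz : z ∈ Ico (0:ℝ) 1) (hv : 0 ≤ v) (hvq : v < q) {k : ℕ} (hk : k ≤ n) :
    (betaMap b)^[k] (z + v) = (betaMap b)^[k] z + b ^ k * v := by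
  refine betaMap_iterate_add hz hb.le hv (fun j _ hj => ?_) k hk
  have h1 := h j hj
  have h2 : b ^ j * v < b ^ j * q := mul_lt_mul_of_pos_left hvq (by positivity)
  linarith

theorem StaysBelow.add_le {hb : 1 < b} {n : ℕ} {z w : ℝ} (h : StaysBelow b n q z)
    (hz : z ∈ cylPoints hb n) (hw : w ∈ cylPoints hb n) (hzw : z < w) : z + q ≤ w := by
  by_contra! hc
  have hb0 : 0 < b := by linarith
  rw [mem_cylPoints] at hz hw
  have h1 := h.iterate_add hb0 hz.1 (v := w - z) (by linarith) (by linarith) le_rfl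
  rw [add_sub_cancel, hw.2, hz.2] at h1
  have : 0 < b ^ n * (w - z) := mul_pos (by positivity) (by linarith)
  linarith

open Classical in
theorem le_card_staysBelow (hb : 1 < b) (n L : ℕ) (hq : q = (b ^ (n + L))⁻¹) :
    (1 - preimageConst b * (b ^ L)⁻¹) * b ^ n
      ≤ (((cylPoints hb n).filter fun z => StaysBelow b n q z).card : ℝ) := by
  have hb0 : 0 < b := by linarith
  have hbn : 0 < b ^ n := by positivity
  have hbL : 0 < b ^ L := by positivity
  have hq0 : 0 < q := by rw [hq]; positivity
  set w : ℝ → ℝ := fun z => if StaysBelow b n q z then (b ^ n)⁻¹ else q with hw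
  have hw0 : ∀ z, 0 ≤ w z := fun z => by
    simp only [hw]; split_ifs <;> positivity
  have hcov : Ico (0:ℝ) 1 ⊆ ⋃ z ∈ cylPoints hb n, Icc z (z + w z) := by
    intro x hx
    refine mem_iUnion₂.2 ⟨cylLeft b n x, cylLeft_mem_cylPoints hb n hx, ?_⟩
    have hf := betaMap_iterate_mem (b := b) n hx
    have hv0 : 0 ≤ (betaMap b)^[n] x / b ^ n := div_nonneg hf.1 hbn.le
    have e0 : cylLeft b n x = x - (betaMap b)^[n] x / b ^ n := rfl
    refine ⟨by linarith, ?_⟩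
    suffices (betaMap b)^[n] x / b ^ n ≤ w (cylLeft b n x) by linarith
    simp only [hw]
    split_ifs with hs
    · rw [div_eq_mul_inv]
      exact mul_le_of_le_one_left (by positivity) hf.2.le
    · simp only [StaysBelow, not_forall, not_le] at hs
      obtain ⟨k, hk, hs⟩ := hs
      rw [betaMap_iterate_cylLeft hb0 hk hx] at hs
      have h1 := (betaMap_iterate_mem (b := b) k hx).2
      by_contra! hc
      have : b ^ k * q < b ^ k * ((betaMap b)^[n] x / b ^ n) :=
        mul_lt_mul_of_pos_left hc (by positivity)
      linarith
  have hvol : (1:ℝ) ≤ ∑ z ∈ cylPoints hb n, w z := by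
    have h1 := (measure_mono (μ := volume) hcov).trans (measure_biUnion_finset_le _ _)
    simp only [Real.volume_Ico, Real.volume_Icc, sub_zero, add_sub_cancel_left] at h1
    rw [← ENNReal.ofReal_sum_of_nonneg (fun z _ => hw0 z)] at h1
    exact (ENNReal.ofReal_le_ofReal_iff (Finset.sum_nonneg fun z _ => hw0 z)).1 h1
  rw [← Finset.sum_filter_add_sum_filter_not _ (fun z => StaysBelow b n q z)] at hvol
  have h1 : ∑ z ∈ (cylPoints hb n).filter (fun z => StaysBelow b n q z), w z
      = ((cylPoints hb n).filter fun z => StaysBelow b n q z).card * (b ^ n)⁻¹ := by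
    rw [← nsmul_eq_mul]
    refine Finset.sum_eq_card_nsmul fun z hz => ?_
    simp only [hw, (Finset.mem_filter.1 hz).2, if_true]
  have h2 : ∑ z ∈ (cylPoints hb n).filter (fun z => ¬ StaysBelow b n q z), w z
      ≤ preimageConst b * b ^ n * q := by
    have : ∑ z ∈ (cylPoints hb n).filter (fun z => ¬ StaysBelow b n q z), w z
        = ((cylPoints hb n).filter fun z => ¬ StaysBelow b n q z).card * q := by
      rw [← nsmul_eq_mul]
      refine Finset.sum_eq_card_nsmul fun z hz => ?_
      simp only [hw, (Finset.mem_filter.1 hz).2, if_false]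
    rw [this]
    refine mul_le_mul_of_nonneg_right (le_trans ?_ (card_cylPoints_le hb n)) hq0.le
    exact_mod_cast Finset.card_filter_le _ _
  have h3 : preimageConst b * b ^ n * q = preimageConst b * (b ^ L)⁻¹ := by
    rw [hq, pow_add]; field_simp
  rw [h1] at hvol
  rw [h3] at h2
  have h4 : 1 - preimageConst b * (b ^ L)⁻¹ ≤
      (((cylPoints hb n).filter fun z => StaysBelow b n q z).card : ℝ) * (b ^ n)⁻¹ := by linarith
  have h5 := mul_le_mul_of_nonneg_right h4 hbn.le
  rwa [mul_assoc, inv_mul_cancel₀ hbn.ne', mul_one] at h5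

open Classical in
theorem card_crossing_le_one (hb : 1 < b) (n : ℕ) (c : ℝ) :
    ((cylPoints hb n).filter fun z => StaysBelow b n q z ∧ z < c ∧ c ≤ z + q).card ≤ 1 := by
  refine Finset.card_le_one.2 fun z hz w hw => ?_
  rw [Finset.mem_filter] at hz hw
  obtain ⟨hz0, hz1, hz2, hz3⟩ := hz
  obtain ⟨hw0, hw1, hw2, hw3⟩ := hw
  rcases lt_trichotomy z w with h | h | h
  · have := hz1.add_le hz0 hw0 h
    linarith
  · exact h
  · have := hw1.add_le hw0 hz0 h
    linarith

/-- If the `k`-th image of `[z, z+q)` contains `1/2` in its interior, then the `k`-th image of `z`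
is determined by the orbit of `1/2`. -/
theorem StaysBelow.of_crossing {hb : 1 < b} {n L k : ℕ} {z : ℝ} (hq : q = (b ^ (n + L))⁻¹)
    (h : StaysBelow b n q z) (hz : z ∈ cylPoints hb n) (hk : k < n)
    (h1 : (betaMap b)^[k] z < 1 / 2) (h2 : 1 / 2 < (betaMap b)^[k] z + b ^ k * q) :
    (betaMap b)^[k] z = 1 / 2 - (betaMap b)^[n - k] (1 / 2) / b ^ (n - k) ∧
      0 < (betaMap b)^[n - k] (1 / 2) ∧ (betaMap b)^[n - k] (1 / 2) < (b ^ L)⁻¹ := by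
  have hb0 : 0 < b := by linarith
  obtain ⟨hz0, hz1⟩ := mem_cylPoints.1 hz
  set y := (betaMap b)^[k] z with hy
  have hy0 : y ∈ Ico (0:ℝ) 1 := betaMap_iterate_mem k hz0
  have hi : 0 < b ^ (n - k) := by positivity
  have hadd : (betaMap b)^[n - k] (y + (1 / 2 - y))
      = (betaMap b)^[n - k] y + b ^ (n - k) * (1 / 2 - y) := by
    refine betaMap_iterate_add hy0 hb0.le (by linarith) (fun j _ hj => ?_) _ le_rfl
    rw [hy, ← Function.iterate_add_apply, ← hy]
    have h3 := h (j + k) (by omega)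
    have h4 : b ^ j * (1 / 2 - y) < b ^ j * (b ^ k * q) :=
      mul_lt_mul_of_pos_left (by linarith) (by positivity)
    rw [← mul_assoc, ← pow_add] at h4
    linarith
  have hzero : (betaMap b)^[n - k] y = 0 := by
    rw [hy, ← Function.iterate_add_apply, Nat.sub_add_cancel hk.le, hz1]
  rw [add_sub_cancel, hzero, zero_add] at hadd
  rw [hadd]
  refine ⟨by field_simp; ring, mul_pos hi (by linarith), ?_⟩
  have h5 : b ^ (n - k) * (1 / 2 - y) < b ^ (n - k) * (b ^ k * q) :=
    mul_lt_mul_of_pos_left (by linarith) hi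
  rw [← mul_assoc, ← pow_add, Nat.sub_add_cancel hk.le, hq, pow_add] at h5
  refine h5.trans_eq ?_
  field_simp

open Classical in
theorem sum_card_crossing_le (hb : 1 < b) {n L j : ℕ} (hq : q = (b ^ (n + L))⁻¹) (hj : j ≤ n)
    (hL : ∀ i, 1 ≤ i → i ≤ j → (betaMap b)^[i] (1 / 2) ≠ 0 →
      (b ^ L)⁻¹ ≤ (betaMap b)^[i] (1 / 2)) :
    ∑ k ∈ Finset.range n, (((cylPoints hb n).filter fun z => StaysBelow b n q z ∧
      (betaMap b)^[k] z < 1 / 2 ∧ 1 / 2 < (betaMap b)^[k] z + b ^ k * q).card : ℝ)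
      ≤ preimageConst b * (b ^ j)⁻¹ * (b - 1)⁻¹ * b ^ n := by
  have hb0 : 0 < b := by linarith
  have hpc := preimageConst_pos hb
  obtain ⟨m, rfl⟩ := Nat.exists_eq_add_of_le' hj
  have hterm : ∀ k, (((cylPoints hb (m + j)).filter fun z => StaysBelow b (m + j) q z ∧
      (betaMap b)^[k] z < 1 / 2 ∧ 1 / 2 < (betaMap b)^[k] z + b ^ k * q).card : ℝ)
      ≤ preimageConst b * b ^ k ∨ ¬ k < m + j := by
    intro k
    by_cases hk : k < m + j
    · left
      refine card_preimage_le hb k (1 / 2 - (betaMap b)^[m + j - k] (1 / 2) / b ^ (m + j - k)) _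
        fun z hz => ?_
      obtain ⟨hz0, hz1, hz2, hz3⟩ := Finset.mem_filter.1 hz
      exact ⟨(mem_cylPoints.1 hz0).1, (hz1.of_crossing hq hz0 hk hz2 hz3).1⟩
    · exact Or.inr hk
  rw [Finset.sum_range_add]
  have h2 : ∑ k ∈ Finset.range j, (((cylPoints hb (m + j)).filter fun z =>
      StaysBelow b (m + j) q z ∧ (betaMap b)^[m + k] z < 1 / 2 ∧
        1 / 2 < (betaMap b)^[m + k] z + b ^ (m + k) * q).card : ℝ) = 0 := by
    refine Finset.sum_eq_zero fun k hk => ?_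
    rw [Finset.mem_range] at hk
    rw [Nat.cast_eq_zero, Finset.card_eq_zero, Finset.filter_eq_empty_iff]
    rintro z hz ⟨hz1, hz2, hz3⟩
    obtain ⟨-, h3, h4⟩ := hz1.of_crossing hq hz (by omega) hz2 hz3
    exact absurd h4 (not_lt.2 (hL _ (by omega) (by omega) h3.ne'))
  have h1 : ∑ k ∈ Finset.range m, (((cylPoints hb (m + j)).filter fun z =>
      StaysBelow b (m + j) q z ∧ (betaMap b)^[k] z < 1 / 2 ∧
        1 / 2 < (betaMap b)^[k] z + b ^ k * q).card : ℝ)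
      ≤ ∑ k ∈ Finset.range m, preimageConst b * b ^ k :=
    Finset.sum_le_sum fun k hk => (hterm k).resolve_right
      (not_not.2 (by have := Finset.mem_range.1 hk; omega))
  rw [h2, add_zero]
  refine h1.trans ?_
  rw [← Finset.mul_sum, geom_sum_eq hb.ne', pow_add]
  have h6 : preimageConst b * (b ^ j)⁻¹ * (b - 1)⁻¹ * (b ^ m * b ^ j)
      = preimageConst b * (b ^ m / (b - 1)) := by field_simp
  rw [h6]
  have : 0 < b - 1 := by linarith
  gcongr
  linarith

end FullCylinders

section GoodCylinders

variable {b lam : ℝ}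

/-- On the interval `[z, z+q)`, with `q = b^{-(n+L)}`, the terms of the β-Takagi series at
`b^{-L}x` of index less than `n + L` are affine. -/
structure GoodCyl (b : ℝ) (n L : ℕ) (q z : ℝ) : Prop where
  staysBelow : StaysBelow b n q z
  not_crossing : ∀ k < n, ¬ ((betaMap b)^[k] z < 1 / 2 ∧ 1 / 2 < (betaMap b)^[k] z + b ^ k * q)
  not_crossing_pow : ∀ i, 1 ≤ i → i ≤ L → ¬ (z < b ^ i / 2 ∧ b ^ i / 2 < z + q)
  lt_one : z + q < 1

open Classical in
/-- The points to the right of which the first `n + L` terms of the series are affine. -/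
def goodPoints (hb : 1 < b) (n L : ℕ) (q : ℝ) : Finset ℝ :=
  (cylPoints hb n).filter fun z => GoodCyl b n L q z

open Classical in
theorem mem_goodPoints {hb : 1 < b} {n L : ℕ} {q z : ℝ} :
    z ∈ goodPoints hb n L q ↔ z ∈ cylPoints hb n ∧ GoodCyl b n L q z := by
  unfold goodPoints
  rw [Finset.mem_filter]

open Classical in
theorem le_card_goodPoints (hb : 1 < b) {n L j : ℕ} {q : ℝ} (hq : q = (b ^ (n + L))⁻¹)
    (hj : j ≤ n)
    (hL : ∀ i, 1 ≤ i → i ≤ j → (betaMap b)^[i] (1 / 2) ≠ 0 →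
      (b ^ L)⁻¹ ≤ (betaMap b)^[i] (1 / 2))
    (hCL : preimageConst b * (b ^ L)⁻¹ ≤ 1 / 4)
    (hCj : preimageConst b * (b ^ j)⁻¹ * (b - 1)⁻¹ ≤ 1 / 8)
    (hn : (L : ℝ) + 1 ≤ b ^ n / 8) :
    b ^ n / 2 ≤ ((goodPoints hb n L q).card : ℝ) := by
  have hb0 : 0 < b := by linarith
  have hbn : 0 < b ^ n := by positivity
  set F := cylPoints hb n
  set A := F.filter fun z => StaysBelow b n q z
  set B : ℕ → Finset ℝ := fun k => F.filter fun z => StaysBelow b n q z ∧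
      (betaMap b)^[k] z < 1 / 2 ∧ 1 / 2 < (betaMap b)^[k] z + b ^ k * q with hB
  set D : ℝ → Finset ℝ := fun c => F.filter fun z => StaysBelow b n q z ∧ z < c ∧ c ≤ z + q with hD
  have hsub : A ⊆ goodPoints hb n L q ∪ ((Finset.range n).biUnion B ∪
      ((Finset.range L).biUnion (fun i => D (b ^ (i + 1) / 2)) ∪ D 1)) := by
    intro z hz
    obtain ⟨hz0, hz1⟩ := Finset.mem_filter.1 hz
    by_contra hc
    simp only [Finset.mem_union, not_or, Finset.mem_biUnion, not_exists, not_and,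
      Finset.mem_range] at hc
    obtain ⟨h1, h2, h3, h4⟩ := hc
    refine h1 (mem_goodPoints.2 ⟨hz0, hz1, fun k hk h => ?_, fun i hi hiL h => ?_, ?_⟩)
    · exact h2 k hk (Finset.mem_filter.2 ⟨hz0, hz1, h⟩)
    · obtain ⟨i, rfl⟩ := Nat.exists_eq_add_of_le' hi
      exact h3 i (by omega) (Finset.mem_filter.2 ⟨hz0, hz1, h.1, h.2.le⟩)
    · by_contra! h
      exact h4 (Finset.mem_filter.2 ⟨hz0, hz1, (mem_cylPoints.1 hz0).1.2, h⟩)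
  have h1 : A.card ≤ (goodPoints hb n L q).card + (∑ k ∈ Finset.range n, (B k).card +
      (L + 1)) := by
    refine (Finset.card_le_card hsub).trans ((Finset.card_union_le _ _).trans ?_)
    refine add_le_add le_rfl ((Finset.card_union_le _ _).trans ?_)
    refine add_le_add Finset.card_biUnion_le ((Finset.card_union_le _ _).trans ?_)
    refine add_le_add (Finset.card_biUnion_le.trans ?_) (card_crossing_le_one hb n 1)
    refine (Finset.sum_le_sum fun i _ => card_crossing_le_one hb n _).trans ?_
    simp
  have h2 := le_card_staysBelow hb n L hq
  have h3 := sum_card_crossing_le hb hq hj hL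
  have h4 : (A.card : ℝ) ≤ (goodPoints hb n L q).card + (∑ k ∈ Finset.range n, ((B k).card : ℝ) +
      (L + 1)) := by exact_mod_cast h1
  have h5 : 3 / 4 * b ^ n ≤ (1 - preimageConst b * (b ^ L)⁻¹) * b ^ n :=
    mul_le_mul_of_nonneg_right (by linarith) hbn.le
  have h6 : preimageConst b * (b ^ j)⁻¹ * (b - 1)⁻¹ * b ^ n ≤ 1 / 8 * b ^ n :=
    mul_le_mul_of_nonneg_right hCj hbn.le
  linarith

/-- The slope of the first `n + L` terms of the series of `u ↦ H(b^{-L}(z + qu))`. -/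
def cylSlope (b lam : ℝ) (n L : ℕ) (q z : ℝ) : ℝ :=
  ∑ j ∈ Finset.range L, lam ^ j * (tentSign (b ^ j * (z / b ^ L)) * (b ^ j * (q / b ^ L)))
    + lam ^ L * ∑ k ∈ Finset.range n, lam ^ k * (tentSign ((betaMap b)^[k] z) * (b ^ k * q))

/-- The value at the left endpoint of the first `n + L` terms of the series of
`u ↦ H(b^{-L}(z + qu))`. -/
def cylHeight (b lam : ℝ) (n L : ℕ) (z : ℝ) : ℝ :=
  ∑ j ∈ Finset.range L, lam ^ j * distInt (b ^ j * (z / b ^ L))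
    + lam ^ L * ∑ k ∈ Finset.range n, lam ^ k * distInt ((betaMap b)^[k] z)

theorem GoodCyl.betaTakagi_eq (h0 : 0 < lam) (h1 : lam < 1) (hb : 1 < b) {n L : ℕ} {q z u : ℝ}
    (hq : q = (b ^ (n + L))⁻¹) (h : GoodCyl b n L q z) (hz : z ∈ cylPoints hb n)
    (hu : u ∈ Ico (0:ℝ) 1) :
    betaTakagi b lam ((q * u + z) / b ^ L)
      = lam ^ (n + L) * betaTakagi b lam (u / b ^ L) + cylSlope b lam n L q z * u
        + cylHeight b lam n L z := by
  have hb0 : 0 < b := by linarith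
  have hbL : 0 < b ^ L := by positivity
  have hq0 : 0 < q := by rw [hq]; positivity
  obtain ⟨hz0, hz1⟩ := mem_cylPoints.1 hz
  have hqu0 : 0 ≤ q * u := mul_nonneg hq0.le hu.1
  have hqu : q * u < q := mul_lt_of_lt_one_right hq0 hu.2
  have hx : q * u + z ∈ Ico (0:ℝ) 1 := ⟨add_nonneg hqu0 hz0.1, by linarith [h.lt_one]⟩
  have hbase : ∀ j ≤ L, (betaMap b)^[j] ((q * u + z) / b ^ L) = b ^ j * ((q * u + z) / b ^ L) := by
    intro j hj
    have e := betaMap_iterate_add (b := b) (n := L) (z := 0) (v := (q * u + z) / b ^ L)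
      ⟨le_rfl, zero_lt_one⟩ hb0.le (div_nonneg hx.1 hbL.le) (fun k _ hk => ?_) j hj
    · rwa [zero_add, betaMap_zero_iterate, zero_add] at e
    · rw [betaMap_zero_iterate, zero_add, mul_div_assoc', div_lt_one hbL]
      have : b ^ k ≤ b ^ L := pow_le_pow_right₀ hb.le hk
      nlinarith [hx.1, hx.2, pow_pos hb0 k]
  have hiter : ∀ k ≤ n, (betaMap b)^[k] (q * u + z) = (betaMap b)^[k] z + b ^ k * q * u := by
    intro k hk
    rw [add_comm, h.staysBelow.iterate_add hb0 hz0 hqu0 hqu hk, mul_assoc]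
  rw [betaTakagi_split h0 h1 L, hbase L le_rfl, mul_div_cancel₀ _ hbL.ne',
    betaTakagi_split h0 h1 n (q * u + z), hiter n le_rfl, hz1, zero_add]
  have e1 : b ^ n * q * u = u / b ^ L := by
    rw [hq, pow_add]; field_simp
  have e2 : ∑ j ∈ Finset.range L, lam ^ j * distInt ((betaMap b)^[j] ((q * u + z) / b ^ L))
      = ∑ j ∈ Finset.range L, lam ^ j * distInt (b ^ j * (z / b ^ L))
        + (∑ j ∈ Finset.range L,
          lam ^ j * (tentSign (b ^ j * (z / b ^ L)) * (b ^ j * (q / b ^ L)))) * u := by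
    rw [Finset.sum_mul, ← Finset.sum_add_distrib]
    refine Finset.sum_congr rfl fun j hj => ?_
    rw [Finset.mem_range] at hj
    have hbj : 0 < b ^ j := by positivity
    rw [hbase j hj.le]
    have e3 : b ^ j * ((q * u + z) / b ^ L) = b ^ j * (z / b ^ L) + b ^ j * (q / b ^ L) * u := by
      ring
    have e4 : b ^ j * (z / b ^ L) = z / b ^ (L - j) := by
      have : b ^ L = b ^ (L - j) * b ^ j := by rw [← pow_add, Nat.sub_add_cancel hj.le]
      rw [this]; field_simp
    have e5 : b ^ j * (q / b ^ L) = q / b ^ (L - j) := by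
      have : b ^ L = b ^ (L - j) * b ^ j := by rw [← pow_add, Nat.sub_add_cancel hj.le]
      rw [this]; field_simp
    have hi : 0 < b ^ (L - j) := by positivity
    have hi1 : 1 ≤ b ^ (L - j) := one_le_pow₀ hb.le
    rw [e3, e4, e5, distInt_affine (div_nonneg hz0.1 hi.le) (by positivity) ?_ ?_ hu.1 hu.2.le]
    · ring
    · rw [← add_div, div_le_one hi]
      linarith [h.lt_one]
    · rw [← add_div, div_lt_iff₀ hi, lt_div_iff₀ hi]
      rintro ⟨h3, h4⟩
      exact h.not_crossing_pow (L - j) (by omega) (by omega) ⟨by linarith, by linarith⟩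
  have e3 : ∑ k ∈ Finset.range n, lam ^ k * distInt ((betaMap b)^[k] (q * u + z))
      = ∑ k ∈ Finset.range n, lam ^ k * distInt ((betaMap b)^[k] z)
        + (∑ k ∈ Finset.range n,
          lam ^ k * (tentSign ((betaMap b)^[k] z) * (b ^ k * q))) * u := by
    rw [Finset.sum_mul, ← Finset.sum_add_distrib]
    refine Finset.sum_congr rfl fun k hk => ?_
    rw [Finset.mem_range] at hk
    rw [hiter k hk.le, distInt_affine (betaMap_iterate_mem k hz0).1 (by positivity)
      (h.staysBelow k hk.le) (h.not_crossing k hk) hu.1 hu.2.le]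
    ring
  rw [e1, e2, e3, pow_add]
  unfold cylSlope cylHeight
  ring

theorem zero_mem_goodPoints (hb : 1 < b) {n L : ℕ} {q : ℝ} (hq : q = (b ^ (n + L))⁻¹)
    (hL : (b ^ (L + 1))⁻¹ ≤ 1 / 2) (hn : 1 ≤ n) : (0:ℝ) ∈ goodPoints hb n L q := by
  have hb0 : 0 < b := by linarith
  have hq0 : 0 < q := by rw [hq]; positivity
  have hqk : ∀ k ≤ n, b ^ k * q = (b ^ (n - k + L))⁻¹ := by
    intro k hk
    have : b ^ (n + L) = b ^ k * b ^ (n - k + L) := by rw [← pow_add]; congr 1; omega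
    rw [hq, this]; field_simp
  have hqk2 : ∀ k < n, b ^ k * q ≤ 1 / 2 := by
    intro k hk
    rw [hqk k hk.le]
    exact (inv_anti₀ (by positivity) (pow_le_pow_right₀ hb.le (by omega))).trans hL
  have hq2 : q ≤ 1 / 2 := by simpa using hqk2 0 hn
  refine mem_goodPoints.2 ⟨mem_cylPoints.2 ⟨⟨le_rfl, zero_lt_one⟩, betaMap_zero_iterate n⟩,
    ?_, ?_, ?_, by linarith⟩
  · intro k hk
    rw [betaMap_zero_iterate, zero_add, hqk k hk]
    exact inv_le_one_of_one_le₀ (one_le_pow₀ hb.le)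
  · rintro k hk ⟨-, h⟩
    rw [betaMap_zero_iterate, zero_add] at h
    exact absurd (hqk2 k hk) (not_le.2 h)
  · rintro i - - ⟨-, h⟩
    have : 1 ≤ b ^ i := one_le_pow₀ hb.le
    linarith

theorem mem_goodPoints_of_map_eq_zero (hb : 1 < b) {n L : ℕ} {q c : ℝ}
    (hq : q = (b ^ (n + L))⁻¹)
    (hL : (b ^ (L + 1))⁻¹ ≤ 1 / 2) (hn : 1 ≤ n) (hc0 : 1 / 2 ≤ c) (hc1 : c + q < 1)
    (hfc : betaMap b c = 0) (hc : ∀ i, 1 ≤ i → i ≤ L → c < b ^ i / 2 → c + q ≤ b ^ i / 2) :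
    c ∈ goodPoints hb n L q := by
  have hb0 : 0 < b := by linarith
  have hq0 : 0 < q := by rw [hq]; positivity
  obtain ⟨-, h1⟩ := mem_goodPoints.1 (zero_mem_goodPoints hb hq hL hn)
  have hit : ∀ k, (betaMap b)^[k + 1] c = 0 := fun k => by
    rw [Function.iterate_succ_apply, hfc, betaMap_zero_iterate]
  refine mem_goodPoints.2 ⟨mem_cylPoints.2 ⟨⟨by linarith, by linarith⟩, ?_⟩,
    ?_, ?_, ?_, hc1⟩
  · obtain ⟨n, rfl⟩ := Nat.exists_eq_add_of_le' hn
    exact hit n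
  · rintro (_ | k) hk
    · simpa using hc1.le
    · rw [hit]
      simpa only [betaMap_zero_iterate] using h1.staysBelow (k + 1) hk
  · rintro (_ | k) hk h
    · exact absurd h.1 (not_lt.2 hc0)
    · rw [hit] at h
      exact h1.not_crossing (k + 1) hk (by rwa [betaMap_zero_iterate])
  · rintro i hi hiL ⟨h3, h4⟩
    exact absurd (hc i hi hiL h3) (not_le.2 h4)

theorem cylSlope_lt (h0 : 0 < lam) (hb : 1 < b) {n L : ℕ} {q c : ℝ} (hq : 0 < q) (hn : 1 ≤ n)
    (hc0 : 1 / 2 ≤ c) : cylSlope b lam n L q c < cylSlope b lam n L q 0 := by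
  have hb0 : 0 < b := by linarith
  have hone : tentSign 0 = 1 := by norm_num [tentSign]
  unfold cylSlope
  simp only [betaMap_zero_iterate, zero_div, mul_zero, hone]
  refine add_lt_add_of_le_of_lt ?_ (mul_lt_mul_of_pos_left ?_ (by positivity))
  · refine Finset.sum_le_sum fun j _ => mul_le_mul_of_nonneg_left ?_ (by positivity)
    exact mul_le_mul_of_nonneg_right (tentSign_le_one _) (by positivity)
  · refine Finset.sum_lt_sum (fun j _ => mul_le_mul_of_nonneg_left ?_ (by positivity))
      ⟨0, Finset.mem_range.2 hn, ?_⟩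
    · exact mul_le_mul_of_nonneg_right (tentSign_le_one _) (by positivity)
    · have : tentSign c = -1 := if_neg (not_lt.2 hc0)
      simp only [Function.iterate_zero, id, this, pow_zero]
      linarith

theorem exists_half_le_betaMap_eq_zero (hb : 1 < b) :
    ∃ c, 1 / 2 ≤ c ∧ c < 1 ∧ betaMap b c = 0 := by
  have hb0 : 0 < b := by linarith
  have h2 : (2:ℤ) ≤ ⌈b⌉ := by
    have : (1:ℤ) < ⌈b⌉ := Int.lt_ceil.2 (by simpa using hb)
    omega
  have h2' : (2:ℝ) ≤ ⌈b⌉ := by exact_mod_cast h2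
  have h3 := Int.le_ceil b
  have h4 := Int.ceil_lt_add_one b
  refine ⟨(⌈b⌉ - 1) / b, ?_, ?_, ?_⟩
  · rw [le_div_iff₀ hb0]; linarith
  · rw [div_lt_one hb0]; linarith
  · rw [betaMap, mul_div_cancel₀ _ hb0.ne']
    have : ((⌈b⌉ : ℝ) - 1) = ((⌈b⌉ - 1 : ℤ) : ℝ) := by push_cast; ring
    rw [this, Int.fract_intCast]

/-- The affine system generated by the good cylinders. -/
def cylSys (h0 : 0 < lam) (h1 : lam < 1) (hb : 1 < b) (hbl : 1 < lam * b) (n L : ℕ) (q c : ℝ)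
    (hq : q = (b ^ (n + L))⁻¹) (hn : 1 ≤ n) (hz : (0:ℝ) ∈ goodPoints hb n L q)
    (hc : c ∈ goodPoints hb n L q) (hc0 : 1 / 2 ≤ c) : AffSys (goodPoints hb n L q) where
  ρ := q
  Λ := lam ^ (n + L)
  a z := z
  e z := cylSlope b lam n L q z / lam ^ (n + L)
  d z := cylHeight b lam n L z
  ρ_pos := by rw [hq]; exact inv_pos.2 (pow_pos (by linarith) _)
  ρ_lt := by
    have hb0 : 0 < b := by linarith
    rw [hq, inv_lt_iff_one_lt_mul₀ (by positivity), ← mul_pow]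
    exact one_lt_pow₀ hbl (Nat.ne_of_gt (by omega : 0 < n + L))
  Λ_lt := pow_lt_one₀ h0.le h1 (by omega)
  a_nonneg z := (mem_cylPoints.1 (mem_goodPoints.1 z.2).1).1.1
  a_lt z := (mem_goodPoints.1 z.2).2.lt_one
  a_sep := by
    rintro ⟨z, hz⟩ ⟨w, hw⟩ hne
    obtain ⟨hz, gz⟩ := mem_goodPoints.1 hz
    obtain ⟨hw, gw⟩ := mem_goodPoints.1 hw
    rcases lt_or_gt_of_ne (fun h => hne (Subtype.ext h) : z ≠ w) with h | h
    · have := gz.staysBelow.add_le hz hw h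
      rw [abs_sub_comm]
      exact le_trans (by simp only; linarith) (le_abs_self _)
    · have := gw.staysBelow.add_le hw hz h
      exact le_trans (by simp only; linarith) (le_abs_self _)
  v₀ := ⟨0, hz⟩
  v₁ := ⟨c, hc⟩
  e_ne := by
    have hq0 : 0 < q := by rw [hq]; exact inv_pos.2 (pow_pos (by linarith) _)
    exact (div_lt_div_of_pos_right (cylSlope_lt h0 hb hq0 hn hc0) (by positivity)).ne'

end GoodCylinders

section LowerBound

variable {b lam : ℝ}

theorem dimH_rescaled_graph_le (hb : 1 < b) (L : ℕ) :
    dimH {p : ℝ × ℝ | p.1 ∈ Ico (0:ℝ) 1 ∧ p.2 = betaTakagi b lam (p.1 / b ^ L)}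
      ≤ dimH {p : ℝ × ℝ | p.1 ∈ Icc (0:ℝ) 1 ∧ p.2 = betaTakagi b lam p.1} := by
  have hb0 : 0 < b := by linarith
  have hbL : 0 < b ^ L := by positivity
  have hlip : LipschitzWith (max (Real.toNNReal (b ^ L)) 1)
      (fun p : ℝ × ℝ => (b ^ L * p.1, p.2)) := by
    refine LipschitzWith.prodMk ?_ LipschitzWith.prod_snd
    refine LipschitzWith.of_dist_le_mul fun p q => ?_
    rw [Real.coe_toNNReal _ hbL.le, Real.dist_eq, ← mul_sub, abs_mul, abs_of_pos hbL, Prod.dist_eq]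
    exact mul_le_mul_of_nonneg_left (le_max_left _ _) hbL.le
  refine le_trans (dimH_mono ?_) (hlip.dimH_image_le _)
  rintro ⟨x, y⟩ ⟨hx, hy⟩
  simp only at hx hy
  refine ⟨(x / b ^ L, y), ⟨⟨div_nonneg hx.1 hbL.le, ?_⟩, hy⟩, ?_⟩
  · exact (div_le_one hbL).2 (hx.2.le.trans (one_le_pow₀ hb.le))
  · simp only [mul_div_cancel₀ _ hbL.ne']

theorem exists_good_scale (hb : 1 < b) : ∃ j L : ℕ,
    preimageConst b * (b ^ j)⁻¹ * (b - 1)⁻¹ ≤ 1 / 8 ∧ preimageConst b * (b ^ L)⁻¹ ≤ 1 / 4 ∧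
    (b ^ (L + 1))⁻¹ ≤ 1 / 2 ∧ ∀ i, 1 ≤ i → i ≤ j → (betaMap b)^[i] (1 / 2) ≠ 0 →
      (b ^ L)⁻¹ ≤ (betaMap b)^[i] (1 / 2) := by
  have hb0 : 0 < b := by linarith
  have ht : Tendsto (fun n : ℕ => (b ^ n)⁻¹) atTop (nhds 0) := by
    simp_rw [← inv_pow]
    exact tendsto_pow_atTop_nhds_zero_of_lt_one (by positivity) (inv_lt_one_of_one_lt₀ hb)
  have h1 : Tendsto (fun n : ℕ => preimageConst b * (b ^ n)⁻¹) atTop (nhds 0) := by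
    simpa using ht.const_mul (preimageConst b)
  have h2 : Tendsto (fun n : ℕ => preimageConst b * (b ^ n)⁻¹ * (b - 1)⁻¹) atTop (nhds 0) := by
    simpa using h1.mul_const (b - 1)⁻¹
  obtain ⟨j, hj⟩ := (h2.eventually_le_const (show (0:ℝ) < 1 / 8 by norm_num)).exists
  have h3 : ∀ᶠ L : ℕ in atTop, ∀ i ∈ Finset.Icc 1 j, (betaMap b)^[i] (1 / 2) ≠ 0 →
      (b ^ L)⁻¹ ≤ (betaMap b)^[i] (1 / 2) := by
    rw [eventually_all_finset]
    intro i _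
    rcases eq_or_ne ((betaMap b)^[i] (1 / 2)) 0 with h | h
    · exact Eventually.of_forall fun _ h' => absurd h h'
    · have hpos : 0 < (betaMap b)^[i] (1 / 2) :=
        lt_of_le_of_ne (betaMap_iterate_mem i ⟨by norm_num, by norm_num⟩).1 h.symm
      filter_upwards [ht.eventually_le_const hpos] with L hL _ using hL
  obtain ⟨L, hL1, hL2, hL3⟩ := ((h1.eventually_le_const (show (0:ℝ) < 1 / 4 by norm_num)).and
    ((ht.eventually_le_const (show (0:ℝ) < 1 / 2 by norm_num)).and h3)).exists
  refine ⟨j, L, hj, hL1, le_trans ?_ hL2, fun i hi hij => hL3 i (Finset.mem_Icc.2 ⟨hi, hij⟩)⟩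
  exact inv_anti₀ (by positivity) (pow_le_pow_right₀ hb.le (by omega))

theorem exists_good_level (h0 : 0 < lam) (h1 : lam < 1) (hb : 1 < b) {σ c : ℝ} (hσ : 0 < σ)
    (hc : c < 1) (j L : ℕ) : ∃ n : ℕ, 1 ≤ n ∧ j ≤ n ∧ (L:ℝ) + 1 ≤ b ^ n / 8 ∧
      c + (b ^ (n + L))⁻¹ < 1 ∧
      (∀ i, 1 ≤ i → i ≤ L → c < b ^ i / 2 → c + (b ^ (n + L))⁻¹ ≤ b ^ i / 2) ∧
      2 * b ^ L ≤ (lam ^ (n + L)) ^ (-σ) := by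
  have hb0 : 0 < b := by linarith
  have ht : Tendsto (fun n : ℕ => (b ^ (n + L))⁻¹) atTop (nhds 0) := by
    simp_rw [← inv_pow]
    exact (tendsto_add_atTop_iff_nat L).2
      (tendsto_pow_atTop_nhds_zero_of_lt_one (by positivity) (inv_lt_one_of_one_lt₀ hb))
  have hlt : ∀ x, c < x → ∀ᶠ n : ℕ in atTop, c + (b ^ (n + L))⁻¹ < x := by
    intro x hx
    filter_upwards [ht.eventually_lt_const (sub_pos.2 hx)] with n hn
    linarith
  have e1 : ∀ᶠ n : ℕ in atTop, (L:ℝ) + 1 ≤ b ^ n / 8 :=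
    ((tendsto_pow_atTop_atTop_of_one_lt hb).atTop_div_const (by norm_num)).eventually_ge_atTop _
  have e2 : ∀ᶠ n : ℕ in atTop, ∀ i ∈ Finset.Icc 1 L, c < b ^ i / 2 →
      c + (b ^ (n + L))⁻¹ ≤ b ^ i / 2 := by
    rw [eventually_all_finset]
    intro i _
    by_cases h : c < b ^ i / 2
    · filter_upwards [hlt _ h] with n hn _ using hn.le
    · exact Eventually.of_forall fun _ h' => absurd h' h
  have hr : 1 < lam ^ (-σ) := Real.one_lt_rpow_of_pos_of_lt_one_of_neg h0 h1 (by linarith)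
  have e3 : ∀ᶠ n : ℕ in atTop, 2 * b ^ L ≤ (lam ^ (n + L)) ^ (-σ) := by
    have := (tendsto_add_atTop_iff_nat L).2 (tendsto_pow_atTop_atTop_of_one_lt hr)
    filter_upwards [this.eventually_ge_atTop (2 * b ^ L)] with n hn
    rwa [← Real.rpow_natCast lam, ← Real.rpow_mul h0.le, mul_comm (_ : ℝ) (-σ),
      Real.rpow_mul h0.le, Real.rpow_natCast]
  obtain ⟨n, hn1, hn2, hn3, hn4, hn5, hn6⟩ := ((eventually_ge_atTop 1).and
    ((eventually_ge_atTop j).and (e1.and ((hlt 1 hc).and (e2.and e3))))).exists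
  exact ⟨n, hn1, hn2, hn3, hn4, fun i hi hiL => hn5 i (Finset.mem_Icc.2 ⟨hi, hiL⟩), hn6⟩

theorem rpow_mul_div_rpow_eq (hb : 1 < b) (h0 : 0 < lam) (N : ℕ) (σ δ : ℝ) :
    (b ^ N)⁻¹ * (lam ^ N) ^ (-σ) * ((b ^ N)⁻¹ / lam ^ N) ^ δ
      = ((b ^ N)⁻¹) ^ (1 + δ + Real.log lam / Real.log b * (σ + δ)) := by
  have hb0 : 0 < b := by linarith
  have hlb : Real.log b ≠ 0 := (Real.log_pos hb).ne'
  have hB : 0 < (b ^ N)⁻¹ := by positivity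
  have hl : 0 < lam ^ N := by positivity
  refine Real.log_injOn_pos (mem_Ioi.2 (by positivity)) (mem_Ioi.2 (by positivity)) ?_
  rw [Real.log_mul (by positivity) (by positivity), Real.log_mul (by positivity) (by positivity),
    Real.log_rpow hl, Real.log_rpow (by positivity), Real.log_rpow hB,
    Real.log_div hB.ne' hl.ne', Real.log_inv, Real.log_pow, Real.log_pow]
  field_simp
  ring

theorem ofReal_le_dimH_betaTakagi_graph (h0 : 0 < lam) (h1 : lam < 1) (hb : 1 < b)
    (hbl : 1 < lam * b) {σ : ℝ} (hσ : 0 < σ) (hσ1 : σ < 1 / 2) :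
    ENNReal.ofReal (2 - 2 * σ + Real.log lam / Real.log b * (1 - σ)) ≤
      dimH {p : ℝ × ℝ | p.1 ∈ Icc (0:ℝ) 1 ∧ p.2 = betaTakagi b lam p.1} := by
  have hb0 : 0 < b := by linarith
  have hlb : 0 < Real.log b := Real.log_pos hb
  obtain ⟨j, L, hj, hL1, hL2, hL3⟩ := exists_good_scale hb
  obtain ⟨c, hc0, hc1, hfc⟩ := exists_half_le_betaMap_eq_zero hb
  obtain ⟨n, hn1, hn2, hn3, hn4, hn5, hn6⟩ := exists_good_level h0 h1 hb hσ hc1 j L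
  obtain ⟨q, hq⟩ : ∃ q, q = (b ^ (n + L))⁻¹ := ⟨_, rfl⟩
  rw [← hq] at hn4
  simp_rw [← hq] at hn5
  have hz := zero_mem_goodPoints hb hq hL2 hn1
  have hc := mem_goodPoints_of_map_eq_zero hb hq hL2 hn1 hc0 hn4 hfc hn5
  have hM := le_card_goodPoints hb hq hn2 hL3 hL1 hj hn3
  obtain ⟨S, hS⟩ : ∃ S, S = cylSys h0 h1 hb hbl n L q c hq hn1 hz hc hc0 := ⟨_, rfl⟩
  have hSρ : S.ρ = q := by rw [hS]; rfl
  have hSΛ : S.Λ = lam ^ (n + L) := by rw [hS]; rfl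
  have hq0 : 0 < q := by rw [← hSρ]; exact S.ρ_pos
  have hΛ0 : 0 < lam ^ (n + L) := by positivity
  have hcard : ((Fintype.card (goodPoints hb n L q) : ℕ) : ℝ)
      = ((goodPoints hb n L q).card : ℝ) := by rw [Fintype.card_coe]
  have hMσ : 1 ≤ ((Fintype.card (goodPoints hb n L q) : ℕ) : ℝ) * S.ρ * S.Λ ^ (-σ) := by
    rw [hcard, hSρ, hSΛ]
    have e1 : (b ^ L)⁻¹ / 2 ≤ ((goodPoints hb n L q).card : ℝ) * q := by
      refine le_trans (le_of_eq ?_) (mul_le_mul_of_nonneg_right hM hq0.le)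
      rw [hq, pow_add]; field_simp
    refine le_trans (le_of_eq ?_) (mul_le_mul e1 hn6 (by positivity) (by positivity))
    field_simp
  have hM0 : 0 < ((Fintype.card (goodPoints hb n L q) : ℕ) : ℝ) := by
    rw [hcard]
    have : 0 < b ^ n := by positivity
    linarith
  have hsp : S.Spread (1 - 2 * σ) := S.spread_of_lt hσ.le (by linarith) (by linarith) hMσ
  have hlog : -1 < Real.log lam / Real.log b := by
    rw [lt_div_iff₀ hlb]
    have := Real.log_pos hbl
    rw [Real.log_mul h0.ne' hb0.ne'] at this
    linarith
  have ht : 0 < 2 - 2 * σ + Real.log lam / Real.log b * (1 - σ) := by nlinarith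
  refine le_trans (S.le_dimH_graph (B := (1 - lam)⁻¹)
    (h := fun u => betaTakagi b lam (u / b ^ L)) hsp ht ?_ ?_ ?_) (dimH_rescaled_graph_le hb L)
  · have e1 : (((Fintype.card (goodPoints hb n L q) : ℕ) : ℝ))⁻¹ ≤ S.ρ * S.Λ ^ (-σ) := by
      rw [inv_le_iff_one_le_mul₀ hM0, mul_comm, ← mul_assoc]
      exact hMσ
    have e2 := rpow_mul_div_rpow_eq hb h0 (n + L) σ (1 - 2 * σ)
    rw [← hq] at e2
    refine (mul_le_mul_of_nonneg_right e1 (Real.rpow_nonneg S.Γ_pos.le _)).trans_eq ?_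
    rw [AffSys.Γ, hSρ, hSΛ, e2]
    congr 1
    ring
  · intro u _
    rw [abs_of_nonneg (betaTakagi_nonneg h0 _)]
    exact betaTakagi_le h0 h1 _
  · rintro ⟨z, hz⟩ u hu
    obtain ⟨hz, gz⟩ := mem_goodPoints.1 hz
    subst hS
    refine (gz.betaTakagi_eq h0 h1 hb hq hz hu).trans ?_
    simp only [cylSys]
    rw [mul_div_cancel₀ _ hΛ0.ne']

theorem le_dimH_betaTakagi_graph (h0 : 0 < lam) (h1 : lam < 1) (hb : 1 < b)
    (hbl : 1 < lam * b) :
    ENNReal.ofReal (2 + Real.log lam / Real.log b) ≤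
      dimH {p : ℝ × ℝ | p.1 ∈ Icc (0:ℝ) 1 ∧ p.2 = betaTakagi b lam p.1} := by
  have ht : Tendsto (fun σ : ℝ => ENNReal.ofReal (2 - 2 * σ + Real.log lam / Real.log b * (1 - σ)))
      (nhdsWithin 0 (Ioi 0)) (nhds (ENNReal.ofReal (2 + Real.log lam / Real.log b))) := by
    refine ENNReal.tendsto_ofReal (tendsto_nhdsWithin_of_tendsto_nhds ?_)
    have : Continuous fun σ : ℝ => 2 - 2 * σ + Real.log lam / Real.log b * (1 - σ) := by fun_prop
    simpa using this.tendsto 0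
  refine le_of_tendsto ht ?_
  filter_upwards [Ioo_mem_nhdsGT (show (0:ℝ) < 1 / 2 by norm_num)] with σ hσ
  exact ofReal_le_dimH_betaTakagi_graph h0 h1 hb hbl hσ.1 hσ.2

end LowerBound

/-- **Theorem (β-Takagi function).** Let `β > 1` and `0 < λ < 1` with `λβ > 1`.  Then the
Hausdorff dimension of the graph of the β-Takagi function `H_{β,λ}` equals
`2 + log λ / log β`. -/
theorem stmt16 (b lam : ℝ) (hb : 1 < b) (hlam0 : 0 < lam) (hlam1 : lam < 1)
    (hbl : 1 < lam * b) :
    dimH {p : ℝ × ℝ | p.1 ∈ Icc (0 : ℝ) 1 ∧ p.2 = betaTakagi b lam p.1}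
      = ENNReal.ofReal (2 + Real.log lam / Real.log b) :=
  le_antisymm (dimH_betaTakagi_graph_le hlam0 hlam1 hb hbl)
    (le_dimH_betaTakagi_graph hlam0 hlam1 hb hbl)
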